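/- Assume g is odd. Then for every θ ∈ K ∪ {∞}, the surface S_θ has no K-rational point: there is no nonzero tuple (x, y, z, u, v) ∈ K⁵ with x² − a z² = −b (u − A_θ v)(u − B_θ v) and x² − a y² = −a C_θ² u v. Moreover S_θ admits no zero-cycle of degree 1: there do not exist an integer r ≥ 1, finite field extensions L₁, …, L_r of K, and integers n₁, …, n_r with n₁[L₁:K] + ⋯ + n_r[L_r:K] = 1, such that for each i the surface S_θ has an L_i-point. -/

import Mathlib

open NumberField IsDedekindDomain

universe u

/-- `D_θ = a^{2h+1} b^{2h+1} θ^{g+1} − 1`. -/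
def Dval {F : Type*} [Field F] (a b : F) (h g : ℕ) (θ : F) : F :=
  a ^ (2 * h + 1) * b ^ (2 * h + 1) * θ ^ (g + 1) - 1

/-- `C_θ = a^{2h+1} θ^{g+1} − 1`. -/
def Cval {F : Type*} [Field F] (a : F) (h g : ℕ) (θ : F) : F :=
  a ^ (2 * h + 1) * θ ^ (g + 1) - 1

/-- `A_θ = a^{4h+3} θ^{2g+2} + b c² d D_θ²`. -/
def Aval {F : Type*} [Field F] (a b c d : F) (h g : ℕ) (θ : F) : F :=
  a ^ (4 * h + 3) * θ ^ (2 * g + 2) + b * c ^ 2 * d * (Dval a b h g θ) ^ 2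

/-- `B_θ = a^{4h+3} θ^{2g+2} + (b c² d + 2c) D_θ²`. -/
def Bval {F : Type*} [Field F] (a b c d : F) (h g : ℕ) (θ : F) : F :=
  a ^ (4 * h + 3) * θ ^ (2 * g + 2) + (b * c ^ 2 * d + 2 * c) * (Dval a b h g θ) ^ 2

/-- `D_∞ = a^{2h+1} b^{2h+1}`. -/
def Dinf {F : Type*} [Field F] (a b : F) (h : ℕ) : F := a ^ (2 * h + 1) * b ^ (2 * h + 1)

/-- `C_∞ = a^{2h+1}`. -/
def Cinf {F : Type*} [Field F] (a : F) (h : ℕ) : F := a ^ (2 * h + 1)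

/-- `A_∞ = a^{4h+3} + b c² d D_∞²`. -/
def Ainf {F : Type*} [Field F] (a b c d : F) (h : ℕ) : F :=
  a ^ (4 * h + 3) + b * c ^ 2 * d * (Dinf a b h) ^ 2

/-- `B_∞ = a^{4h+3} + (b c² d + 2c) D_∞²`. -/
def Binf {F : Type*} [Field F] (a b c d : F) (h : ℕ) : F :=
  a ^ (4 * h + 3) + (b * c ^ 2 * d + 2 * c) * (Dinf a b h) ^ 2

/-- The image of `x ∈ 𝓞 K` in the completion of `K` at the finite place `π`. -/
noncomputable def intToAdicCompletion {K : Type*} [Field K] [NumberField K]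
    (π : HeightOneSpectrum (𝓞 K)) (x : 𝓞 K) : π.adicCompletion K :=
  algebraMap K (π.adicCompletion K) (algebraMap (𝓞 K) K x)

/-- The arithmetic parameters `a, b, c, d` of Proposition 2.1 of Huang–Liang, for the
finite set `Ω⁰` of finite odd places of residue characteristic at most `4g²`;
`va, vb, vc, vd` are the finite places of `K` generated by `a, b, c, d`. -/
structure Params (K : Type u) [Field K] [NumberField K] (g : ℕ) (a b c d : 𝓞 K)
    (va vb vc vd : HeightOneSpectrum (𝓞 K)) : Prop where
  span_a : va.asIdeal = Ideal.span {a}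
  span_b : vb.asIdeal = Ideal.span {b}
  span_c : vc.asIdeal = Ideal.span {c}
  span_d : vd.asIdeal = Ideal.span {d}
  distinct : va ≠ vb ∧ va ≠ vc ∧ va ≠ vd ∧ vb ≠ vc ∧ vb ≠ vd ∧ vc ≠ vd
  not_dvd_two : (2 : 𝓞 K) ∉ va.asIdeal ∧ (2 : 𝓞 K) ∉ vb.asIdeal ∧
    (2 : 𝓞 K) ∉ vc.asIdeal ∧ (2 : 𝓞 K) ∉ vd.asIdeal
  char_odd : Odd (ringChar (𝓞 K ⧸ va.asIdeal)) ∧ Odd (ringChar (𝓞 K ⧸ vb.asIdeal)) ∧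
    Odd (ringChar (𝓞 K ⧸ vc.asIdeal)) ∧ Odd (ringChar (𝓞 K ⧸ vd.asIdeal))
  char_big : 4 * g ^ 2 < ringChar (𝓞 K ⧸ va.asIdeal) ∧
    4 * g ^ 2 < ringChar (𝓞 K ⧸ vb.asIdeal) ∧
    4 * g ^ 2 < ringChar (𝓞 K ⧸ vc.asIdeal) ∧
    4 * g ^ 2 < ringChar (𝓞 K ⧸ vd.asIdeal)
  sq_ab_bad : ∀ π : HeightOneSpectrum (𝓞 K),
    ((2 : 𝓞 K) ∈ π.asIdeal ∨ ringChar (𝓞 K ⧸ π.asIdeal) ≤ 4 * g ^ 2) →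
    IsSquare (intToAdicCompletion π a) ∧ IsSquare (intToAdicCompletion π b)
  pos_real : ∀ σ : K →+* ℝ, 0 < σ (algebraMap (𝓞 K) K a) ∧ 0 < σ (algebraMap (𝓞 K) K b)
  sq_two_a : IsSquare ((2 : va.adicCompletion K))
  sq_neg_one_a : IsSquare ((-1 : va.adicCompletion K))
  sq_two_b : IsSquare ((2 : vb.adicCompletion K))
  sq_neg_one_b : IsSquare ((-1 : vb.adicCompletion K))
  cong_a : b ∣ a - 1
  cong_bcd : a ∣ b * c ^ 2 * d - 1
  c_nsq_a : ¬ IsSquare (intToAdicCompletion va c)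
  c_nsq_b : ¬ IsSquare (intToAdicCompletion vb c)
  d_nsq_b : ¬ IsSquare (intToAdicCompletion vb d)
  d_sq_c : IsSquare (intToAdicCompletion vc d)
  d_sq_a : IsSquare (intToAdicCompletion va d)
  a_sq_b : IsSquare (intToAdicCompletion vb a)
  a_nsq_c : ¬ IsSquare (intToAdicCompletion vc a)
  b_sq_a : IsSquare (intToAdicCompletion va b)
  b_nsq_c : ¬ IsSquare (intToAdicCompletion vc b)
  not_dvd : ¬ a ∣ b * c * d + 2

/-- The del Pezzo surface `x² − a z² = −b(u − Av)(u − Bv)`, `x² − a y² = −a C² u v`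
in ℙ⁴ has an `L`-point. -/
def SPoint {L : Type*} [Field L] (a b A B C : L) : Prop :=
  ∃ x y z u v : L, ¬ (x = 0 ∧ y = 0 ∧ z = 0 ∧ u = 0 ∧ v = 0) ∧
    x ^ 2 - a * z ^ 2 = -(b * ((u - A * v) * (u - B * v))) ∧
    x ^ 2 - a * y ^ 2 = -(a * C ^ 2 * (u * v))

/-- The surface over `K` with parameters `a, b, A, B, C ∈ K` admits no zero-cycle of
degree 1: there is no collection of finite field extensions `Lᵢ/K`, each carrying a
point of the surface, together with integers `nᵢ` with `∑ nᵢ [Lᵢ : K] = 1`. -/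
def SNoZeroCycleDegOne (K : Type u) [Field K] (a b A B C : K) : Prop :=
  ∀ (r : ℕ), 1 ≤ r → ∀ (L : Fin r → Type u) [∀ i, Field (L i)] [∀ i, Algebra K (L i)]
    [∀ i, FiniteDimensional K (L i)] (n : Fin r → ℤ),
    (∀ i, SPoint (algebraMap K (L i) a) (algebraMap K (L i) b)
      (algebraMap K (L i) A) (algebraMap K (L i) B) (algebraMap K (L i) C)) →
    (∑ i, n i * (Module.finrank K (L i) : ℤ)) ≠ 1

section Mean

variable {A B : Type*} [AddCommGroup A] [AddCommGroup B]

/-- A function invariant under translation by the elements of `H`. -/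
def PeriodicMod (H : AddSubgroup A) (F : A → ℂ) : Prop :=
  ∀ x, ∀ h ∈ H, F (x + h) = F x

/-- The average of an `H`-periodic function over `A ⧸ H`. -/
noncomputable def avg (H : AddSubgroup A) (F : A → ℂ) : ℂ :=
  (H.index : ℂ)⁻¹ * ∑ᶠ q : A ⧸ H, F q.out

theorem PeriodicMod.mono {H H' : AddSubgroup A} (hle : H' ≤ H) {F : A → ℂ}
    (hF : PeriodicMod H F) : PeriodicMod H' F := fun x h hh => hF x h (hle hh)

theorem PeriodicMod.congr {H : AddSubgroup A} {F : A → ℂ} (hF : PeriodicMod H F) {x y : A}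
    (h : x - y ∈ H) : F x = F y := by
  have := hF y (x - y) h
  rwa [add_sub_cancel] at this

theorem PeriodicMod.out {H : AddSubgroup A} {F : A → ℂ} (hF : PeriodicMod H F) (x : A) :
    F (x : A ⧸ H).out = F x := by
  apply hF.congr
  have : ((x : A ⧸ H).out : A ⧸ H) = (x : A ⧸ H) := Quotient.out_eq' _
  rw [← neg_sub, H.neg_mem_iff, sub_eq_neg_add]
  exact QuotientAddGroup.eq.1 this

theorem PeriodicMod.mul {H : AddSubgroup A} {F G : A → ℂ} (hF : PeriodicMod H F)
    (hG : PeriodicMod H G) : PeriodicMod H (fun x => F x * G x) := fun x h hh => by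
  simp only [hF x h hh, hG x h hh]

theorem PeriodicMod.comp {H : AddSubgroup B} {F : B → ℂ} (hF : PeriodicMod H F) (φ : A →+ B) :
    PeriodicMod (H.comap φ) (F ∘ φ) := fun x h hh => by
  simpa using hF (φ x) (φ h) hh

theorem avg_eq_of_bijective {H : AddSubgroup A} {F : A → ℂ} (hF : PeriodicMod H F)
    {ι : Type*} [Fintype ι] (s : ι → A)
    (hs : Function.Bijective (fun i => (s i : A ⧸ H))) :
    avg H F = (Fintype.card ι : ℂ)⁻¹ * ∑ i, F (s i) := by
  have hc : H.index = Fintype.card ι := by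
    rw [AddSubgroup.index, ← Nat.card_eq_fintype_card]
    exact (Nat.card_congr (Equiv.ofBijective _ hs)).symm
  have := Fintype.ofBijective _ hs
  rw [avg, hc, finsum_eq_sum_of_fintype]
  congr 1
  rw [← hs.sum_comp]
  exact Finset.sum_congr rfl fun i _ => hF.out _

theorem avg_comp {H : AddSubgroup B} [H.FiniteIndex] {F : B → ℂ} (hF : PeriodicMod H F)
    (φ : A →+ B) (hφ : ∀ b, ∃ a, b - φ a ∈ H) : avg (H.comap φ) (F ∘ φ) = avg H F := by
  have h1 : Function.Bijective (fun q : A ⧸ H.comap φ => (φ q.out : B ⧸ H)) := by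
    constructor
    · intro p q hpq
      rw [← Quotient.out_eq' p, ← Quotient.out_eq' q]
      refine QuotientAddGroup.eq.2 ?_
      have := QuotientAddGroup.eq.1 hpq
      simpa using this
    · intro b
      obtain ⟨b, rfl⟩ := QuotientAddGroup.mk_surjective b
      obtain ⟨a, ha⟩ := hφ b
      refine ⟨(a : A ⧸ H.comap φ), ?_⟩
      refine QuotientAddGroup.eq.2 ?_
      have h2 : ((a : A ⧸ H.comap φ).out : A ⧸ H.comap φ) = a := Quotient.out_eq' _
      have h3 := QuotientAddGroup.eq.1 h2
      rw [AddSubgroup.mem_comap, map_add, map_neg] at h3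
      have := H.add_mem h3 ha
      convert this using 1
      abel
  have : Finite (A ⧸ H.comap φ) := Finite.of_injective _ h1.1
  have := Fintype.ofFinite (A ⧸ H.comap φ)
  rw [avg_eq_of_bijective hF _ h1, avg, finsum_eq_sum_of_fintype, AddSubgroup.index,
    Nat.card_eq_fintype_card]
  rfl

theorem avg_translate {H : AddSubgroup A} [H.FiniteIndex] {F : A → ℂ} (hF : PeriodicMod H F)
    (z : A) : avg H (fun x => F (x + z)) = avg H F := by
  have := Fintype.ofFinite (A ⧸ H)
  have h1 : Function.Bijective (fun q : A ⧸ H => ((q.out + z : A) : A ⧸ H)) := by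
    have : (fun q : A ⧸ H => ((q.out + z : A) : A ⧸ H)) = fun q => q + (z : A ⧸ H) := by
      funext q
      rw [QuotientAddGroup.mk_add]
      congr 1
      exact Quotient.out_eq' q
    rw [this]
    exact (Equiv.addRight (z : A ⧸ H)).bijective
  rw [avg_eq_of_bijective hF _ h1, avg, finsum_eq_sum_of_fintype, AddSubgroup.index,
    Nat.card_eq_fintype_card]

theorem avg_mono {H H' : AddSubgroup A} [H'.FiniteIndex] (hle : H' ≤ H)
    {F : A → ℂ} (hF : PeriodicMod H F) : avg H' F = avg H F := by
  have : H.FiniteIndex := AddSubgroup.finiteIndex_of_le hle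
  have := Fintype.ofFinite (A ⧸ H)
  have := Fintype.ofFinite (A ⧸ H')
  have := Fintype.ofFinite (H ⧸ H'.addSubgroupOf H)
  let s : (A ⧸ H) × (H ⧸ H'.addSubgroupOf H) → A := fun p => p.1.out + (p.2.out : H)
  have h1 : Function.Injective (fun i => (s i : A ⧸ H')) := by
    rintro ⟨p, q⟩ ⟨p', q'⟩ h
    have h2 := QuotientAddGroup.eq.1 h
    simp only [s] at h2
    have h3 : p = p' := by
      rw [← Quotient.out_eq' p, ← Quotient.out_eq' p']
      refine QuotientAddGroup.eq.2 ?_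
      have := H.add_mem (H.add_mem (hle h2) q.out.2) (H.neg_mem q'.out.2)
      convert this using 1
      abel
    subst h3
    congr 1
    rw [← Quotient.out_eq' q, ← Quotient.out_eq' q']
    refine QuotientAddGroup.eq.2 ?_
    rw [AddSubgroup.mem_addSubgroupOf]
    convert h2 using 1
    push_cast
    abel
  have h2 : Function.Bijective (fun i => (s i : A ⧸ H')) := by
    refine (Fintype.bijective_iff_injective_and_card _).2 ⟨h1, ?_⟩
    rw [Fintype.card_prod, ← Nat.card_eq_fintype_card, ← Nat.card_eq_fintype_card,
      ← Nat.card_eq_fintype_card]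
    have := AddSubgroup.relIndex_mul_index hle
    rw [AddSubgroup.relIndex, AddSubgroup.index, AddSubgroup.index, AddSubgroup.index] at this
    rw [mul_comm]; exact this
  rw [avg_eq_of_bijective (hF.mono hle) s h2, avg, finsum_eq_sum_of_fintype, AddSubgroup.index,
    Nat.card_eq_fintype_card, Fintype.sum_prod_type, Fintype.card_prod]
  have h3 : ∀ p : A ⧸ H, ∑ q : H ⧸ H'.addSubgroupOf H, F (s (p, q)) =
      Fintype.card (H ⧸ H'.addSubgroupOf H) * F p.out := by
    intro p
    rw [Finset.sum_congr rfl (fun q _ => hF p.out _ q.out.2)]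
    simp
  rw [Finset.sum_congr rfl (fun p _ => h3 p), ← Finset.mul_sum]
  have : (Fintype.card (H ⧸ H'.addSubgroupOf H) : ℂ) ≠ 0 :=
    Nat.cast_ne_zero.2 Fintype.card_ne_zero
  have : (Fintype.card (A ⧸ H) : ℂ) ≠ 0 := Nat.cast_ne_zero.2 Fintype.card_ne_zero
  push_cast
  field_simp

theorem avg_mul_of_coprime {H₁ H₂ : AddSubgroup A} [H₁.FiniteIndex] [H₂.FiniteIndex]
    {F₁ F₂ : A → ℂ} (hF₁ : PeriodicMod H₁ F₁) (hF₂ : PeriodicMod H₂ F₂)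
    (hH : ∀ x, ∃ y ∈ H₁, x - y ∈ H₂) :
    avg (H₁ ⊓ H₂) (fun x => F₁ x * F₂ x) = avg H₁ F₁ * avg H₂ F₂ := by
  have := Fintype.ofFinite (A ⧸ H₁)
  have := Fintype.ofFinite (A ⧸ H₂)
  have hex : ∀ p : (A ⧸ H₁) × (A ⧸ H₂), ∃ x : A, (x : A ⧸ H₁) = p.1 ∧ (x : A ⧸ H₂) = p.2 := by
    rintro ⟨p, q⟩
    obtain ⟨p, rfl⟩ := QuotientAddGroup.mk_surjective p
    obtain ⟨q, rfl⟩ := QuotientAddGroup.mk_surjective q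
    obtain ⟨y, hy, hyq⟩ := hH (q - p)
    refine ⟨p + y, QuotientAddGroup.eq.2 ?_, QuotientAddGroup.eq.2 ?_⟩
    · simpa using hy
    · convert hyq using 1; abel
  choose s hs₁ hs₂ using hex
  have hb : Function.Bijective (fun i => (s i : A ⧸ (H₁ ⊓ H₂))) := by
    constructor
    · intro p q h
      have h2 := QuotientAddGroup.eq.1 h
      refine Prod.ext ?_ ?_
      · rw [← hs₁ p, ← hs₁ q]; exact QuotientAddGroup.eq.2 h2.1
      · rw [← hs₂ p, ← hs₂ q]; exact QuotientAddGroup.eq.2 h2.2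
    · intro x
      obtain ⟨x, rfl⟩ := QuotientAddGroup.mk_surjective x
      refine ⟨((x : A ⧸ H₁), (x : A ⧸ H₂)), QuotientAddGroup.eq.2 ⟨?_, ?_⟩⟩
      · exact QuotientAddGroup.eq.1 (hs₁ _)
      · exact QuotientAddGroup.eq.1 (hs₂ _)
  rw [avg_eq_of_bijective ((hF₁.mono inf_le_left).mul (hF₂.mono inf_le_right)) s hb, avg, avg,
    finsum_eq_sum_of_fintype, finsum_eq_sum_of_fintype, AddSubgroup.index, AddSubgroup.index,
    Nat.card_eq_fintype_card, Nat.card_eq_fintype_card, mul_mul_mul_comm,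
    Finset.sum_mul_sum, ← Finset.univ_product_univ, Finset.sum_product]
  rw [Fintype.card_prod]
  push_cast
  rw [mul_inv]
  congr 1
  refine Finset.sum_congr rfl fun p _ => Finset.sum_congr rfl fun q _ => ?_
  congr 1
  · rw [← hF₁.out (s _), hs₁]
  · rw [← hF₂.out (s _), hs₂]

/-- Averaging a function over a subgroup outside of which it vanishes. -/
theorem avg_eq_index_inv_mul_avg {H D : AddSubgroup A} [H.FiniteIndex] (hle : H ≤ D)
    {F : A → ℂ} (hF : PeriodicMod H F) (hD : ∀ x ∉ D, F x = 0) :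
    avg H F = (D.index : ℂ)⁻¹ * avg (H.addSubgroupOf D) (fun x : D => F x) := by
  classical
  have := Fintype.ofFinite (A ⧸ H)
  have hF' : PeriodicMod (H.addSubgroupOf D) (fun x : D => F x) := hF.comp D.subtype
  have := Fintype.ofFinite (D ⧸ H.addSubgroupOf D)
  rw [avg, avg, ← AddSubgroup.relIndex_mul_index hle, AddSubgroup.relIndex,
    finsum_eq_sum_of_fintype, finsum_eq_sum_of_fintype]
  push_cast
  rw [mul_inv, mul_comm (_⁻¹) (D.index : ℂ)⁻¹, mul_assoc]
  congr 2
  symm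
  refine Finset.sum_of_injOn (fun q : D ⧸ H.addSubgroupOf D => ((q.out : A) : A ⧸ H))
    ?_ ?_ ?_ ?_
  · intro p _ q _ h
    rw [← Quotient.out_eq' p, ← Quotient.out_eq' q]
    refine QuotientAddGroup.eq.2 ?_
    rw [AddSubgroup.mem_addSubgroupOf]
    exact QuotientAddGroup.eq.1 h
  · intro _ _; simp
  · intro q _ hq
    apply hD
    intro hmem
    apply hq
    refine ⟨((⟨q.out, hmem⟩ : D) : D ⧸ H.addSubgroupOf D), by simp, ?_⟩
    conv_rhs => rw [← Quotient.out_eq' q]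
    refine QuotientAddGroup.eq.2 ?_
    have h2 : (((⟨q.out, hmem⟩ : D) : D ⧸ H.addSubgroupOf D).out : D ⧸ H.addSubgroupOf D) =
      ((⟨q.out, hmem⟩ : D) : D ⧸ H.addSubgroupOf D) := Quotient.out_eq' _
    exact (QuotientAddGroup.eq (s := H.addSubgroupOf D)).1 h2
  · intro q _
    exact (hF.out _).symm

/-- If translating by elements of `L` multiplies `F` by characters, then only the points whose
character is trivial on `L` contribute to the average of `F`. -/
theorem avg_eq_of_char {H L D : AddSubgroup A} [H.FiniteIndex] (hHD : H ≤ D)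
    {F : A → ℂ} (hF : PeriodicMod H F) (β : A → AddChar A ℂ)
    (hβ : ∀ x, ∀ l ∈ L, F (x + l) = F x * β x l) (hβH : ∀ x, ∀ h ∈ H, β x h = 1)
    (hD : ∀ x, x ∈ D ↔ ∀ l ∈ L, β x l = 1) :
    avg H F = (D.index : ℂ)⁻¹ * avg (H.addSubgroupOf D) (fun x : D => F x) := by
  classical
  have := Fintype.ofFinite (A ⧸ H)
  have : (H.addSubgroupOf L).FiniteIndex := inferInstance
  have := Fintype.ofFinite (L ⧸ H.addSubgroupOf L)
  let G : A → ℂ := fun x => if x ∈ D then F x else 0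
  have hG : PeriodicMod H G := by
    intro x h hh
    simp only [G, hF x h hh, D.add_mem_cancel_right (hHD hh)]
  have key : avg H F = avg H G := by
    have h1 : avg H F = (Fintype.card (L ⧸ H.addSubgroupOf L) : ℂ)⁻¹ *
        ∑ q : L ⧸ H.addSubgroupOf L, avg H (fun x => F (x + (q.out : L))) := by
      rw [Finset.sum_congr rfl (fun q _ => avg_translate hF _)]
      have : (Fintype.card (L ⧸ H.addSubgroupOf L) : ℂ) ≠ 0 :=
        Nat.cast_ne_zero.2 Fintype.card_ne_zero
      simp only [Finset.sum_const, Finset.card_univ, nsmul_eq_mul]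
      field_simp
    rw [h1]
    simp only [avg, finsum_eq_sum_of_fintype]
    rw [← Finset.mul_sum, mul_left_comm, Finset.sum_comm, Finset.mul_sum]
    congr 1
    refine Finset.sum_congr rfl fun x _ => ?_
    rw [Finset.sum_congr rfl (fun q _ => hβ _ _ (q.out : L).2), ← Finset.mul_sum]
    have h2 : ∀ y : L, (β x.out) ((y : L ⧸ H.addSubgroupOf L).out : L) = β x.out y := by
      intro y
      have hper : PeriodicMod (H.addSubgroupOf L) (fun l : L => β x.out l) := by
        intro l h hh
        rw [AddSubgroup.mem_addSubgroupOf] at hh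
        simp [AddChar.map_add_eq_mul, hβH _ _ hh]
      exact hper.out y
    by_cases hx : x.out ∈ D
    · have h3 : ∀ q : L ⧸ H.addSubgroupOf L, β x.out (q.out : L) = 1 :=
        fun q => (hD _).1 hx _ (q.out : L).2
      simp only [G, if_pos hx, h3, Finset.sum_const, Finset.card_univ, nsmul_eq_mul, mul_one]
      have : (Fintype.card (L ⧸ H.addSubgroupOf L) : ℂ) ≠ 0 :=
        Nat.cast_ne_zero.2 Fintype.card_ne_zero
      field_simp
    · simp only [G, if_neg hx]
      have hx' := hx
      rw [hD] at hx'
      push Not at hx'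
      obtain ⟨l, hl, hne⟩ := hx'
      have h4 : ∑ q : L ⧸ H.addSubgroupOf L, β x.out (q.out : L) =
          β x.out l * ∑ q : L ⧸ H.addSubgroupOf L, β x.out (q.out : L) := by
        rw [Finset.mul_sum]
        refine Fintype.sum_equiv (Equiv.subRight ((⟨l, hl⟩ : L) : L ⧸ H.addSubgroupOf L)) _ _ ?_
        intro q
        obtain ⟨y, rfl⟩ := QuotientAddGroup.mk_surjective q
        simp only [Equiv.subRight_apply]
        rw [← QuotientAddGroup.mk_sub, h2, h2, ← AddChar.map_add_eq_mul]
        congr 1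
        push_cast
        abel
      have h5 : ∑ q : L ⧸ H.addSubgroupOf L, β x.out (q.out : L) = 0 := by
        by_contra h0
        exact hne (mul_right_cancel₀ h0 (by rw [← h4, one_mul]))
      rw [h5]; ring
  rw [key, avg_eq_index_inv_mul_avg hHD hG (fun x hx => if_neg hx)]
  congr 2
  funext x
  simp [G]

end Mean

section QuadraticGaussSum

open Complex Filter Topology in
theorem tendsto_tsum_exp_neg_mul_sq (c : ℤ → ℂ) (hc : ∀ k, ‖c k‖ = 1) (h0 : c 0 = 1) :
    Tendsto (fun δ : ℝ => ∑' k : ℤ, cexp (-Real.pi / δ * (k : ℂ) ^ 2) * c k) (𝓝[>] 0) (𝓝 1) := by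
  have hlim : Tendsto (fun δ : ℝ => ∑' k : ℤ, cexp (-Real.pi / δ * (k : ℂ) ^ 2) * c k) (𝓝[>] 0)
      (𝓝 (∑' k : ℤ, if k = 0 then (1 : ℂ) else 0)) := by
    refine tendsto_tsum_of_dominated_convergence
      (bound := fun k : ℤ => Real.exp (-Real.pi * k ^ 2)) ?_ ?_ ?_
    · simpa using summable_pow_mul_jacobiTheta₂_term_bound 0 one_pos 0
    · intro k
      split_ifs with hk
      · subst hk
        simp [h0]
      · rw [tendsto_zero_iff_norm_tendsto_zero]
        have h1 : ∀ δ : ℝ, ‖cexp (-Real.pi / δ * (k : ℂ) ^ 2) * c k‖ =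
            Real.exp (-((Real.pi * k ^ 2) * δ⁻¹)) := by
          intro δ
          rw [norm_mul, hc, mul_one, norm_exp]
          congr 1
          have : (-Real.pi / δ * (k : ℂ) ^ 2) = ((-((Real.pi * k ^ 2) * δ⁻¹) : ℝ) : ℂ) := by
            push_cast; ring
          rw [this, ofReal_re]
        simp_rw [h1]
        refine Real.tendsto_exp_neg_atTop_nhds_zero.comp ?_
        refine tendsto_inv_nhdsGT_zero.const_mul_atTop ?_
        have : (k : ℝ) ≠ 0 := by exact_mod_cast hk
        positivity
    · have : ∀ᶠ δ : ℝ in 𝓝[>] 0, δ ∈ Set.Ioo (0 : ℝ) 1 :=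
        Ioo_mem_nhdsGT one_pos
      filter_upwards [this] with δ hδ k
      rw [norm_mul, hc, mul_one, norm_exp]
      refine Real.exp_le_exp.2 ?_
      have h2 : (-Real.pi / δ * (k : ℂ) ^ 2) = ((-Real.pi / δ * k ^ 2 : ℝ) : ℂ) := by
        push_cast; ring
      rw [h2, ofReal_re]
      refine mul_le_mul_of_nonneg_right ?_ (sq_nonneg _)
      rw [div_le_iff₀ hδ.1]
      have := Real.pi_pos
      have := hδ.2
      nlinarith
  rwa [tsum_ite_eq] at hlim

open Complex Filter Topology in
theorem sum_exp_sq_div_aux {n : ℕ} (hn : 0 < n) {δ : ℝ} (hδ : 0 < δ) :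
    (δ + I * (2 * n : ℕ)) ^ (1 / 2 : ℂ) *
      (∑' k : ℤ, cexp (-Real.pi / δ * (k : ℂ) ^ 2) * 1) =
    ∑ x : Fin (2 * n), cexp (Real.pi * I * (x : ℕ) ^ 2 / (2 * n : ℕ)) *
      ((1 - I * δ / (2 * n : ℕ)) ^ (1 / 2 : ℂ) *
      ∑' k : ℤ, cexp (-Real.pi / δ * (k : ℂ) ^ 2) *
        cexp (((Real.pi * (k ^ 2 - 2 * (x : ℕ) * k) / (2 * n : ℕ) : ℝ) : ℂ) * I)) := by
  have : NeZero (2 * n) := ⟨by positivity⟩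
  set N : ℕ := 2 * n with hN
  have hN0 : (N : ℂ) ≠ 0 := Nat.cast_ne_zero.2 (NeZero.ne N)
  have hδ0 : (δ : ℂ) ≠ 0 := by exact_mod_cast hδ.ne'
  have hp : ((δ : ℂ) + I * N) ≠ 0 := by
    intro h; have := congrArg re h; simp at this; exact hδ.ne' this
  have hm : ((N : ℂ) - I * δ) ≠ 0 := by
    intro h; have := congrArg im h; simp at this; exact hδ.ne' this
  have e1 : ∑' m : ℤ, cexp (-Real.pi * (δ + I * N) * (m : ℂ) ^ 2) =
      ∑' m : ℤ, cexp (-Real.pi * δ * (m : ℂ) ^ 2) := by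
    congr 1; funext m
    rw [Complex.exp_eq_exp_iff_exists_int]
    refine ⟨-(n * m ^ 2), ?_⟩
    rw [hN]; push_cast; ring
  rw [Complex.tsum_exp_neg_mul_int_sq (by simpa using hδ),
    Complex.tsum_exp_neg_mul_int_sq (by simpa using hδ)] at e1
  have hpow : ((δ : ℂ) + I * N) ^ (1 / 2 : ℂ) ≠ 0 := by
    rw [Ne, cpow_eq_zero_iff]; simp [hp]
  have hδpow : (δ : ℂ) ^ (1 / 2 : ℂ) ≠ 0 := by
    rw [Ne, cpow_eq_zero_iff]; simp [hδ0]
  have e2 : (δ + I * N) ^ (1 / 2 : ℂ) * (∑' k : ℤ, cexp (-Real.pi / δ * (k : ℂ) ^ 2)) =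
      (δ : ℂ) ^ (1 / 2 : ℂ) * ∑' m : ℤ, cexp (-Real.pi / (δ + I * N) * (m : ℂ) ^ 2) := by
    have h6 := congrArg (fun z => (δ + I * N) ^ (1 / 2 : ℂ) * ((δ : ℂ) ^ (1 / 2 : ℂ) * z)) e1
    rw [mul_left_comm, ← mul_assoc (_ ^ _) (1 / _), mul_one_div_cancel hpow, one_mul,
      ← mul_assoc ((δ : ℂ) ^ (1 / 2 : ℂ)) (1 / _), mul_one_div_cancel hδpow, one_mul] at h6
    exact h6.symm
  simp_rw [mul_one]
  rw [e2]
  have hsum : Summable fun m : ℤ => cexp (-Real.pi / (δ + I * N) * (m : ℂ) ^ 2) := by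
    have h3 : 0 < (((δ : ℂ) + I * N)⁻¹).re := by
      rw [inv_re]
      refine div_pos (by simpa using hδ) (normSq_pos.2 hp)
    have h4 := summable_pow_mul_jacobiTheta₂_term_bound 0 h3 0
    refine Summable.of_norm_bounded h4 fun m => ?_
    rw [norm_exp, pow_zero, one_mul]
    refine Real.exp_le_exp.2 (le_of_eq ?_)
    have h5 : (-Real.pi / (δ + I * N) * (m : ℂ) ^ 2) =
      ((-Real.pi * m ^ 2 : ℝ) : ℂ) * ((δ : ℂ) + I * N)⁻¹ := by
      push_cast; ring
    rw [h5, re_ofReal_mul]; ring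
  let E : Fin N × ℤ ≃ ℤ := (Equiv.prodComm _ _).trans (Int.divModEquiv N).symm
  have hE : ∀ x k, E (x, k) = k * N + (x : ℕ) := fun x k => rfl
  have hsum' : Summable fun p => cexp (-Real.pi / (δ + I * N) * (E p : ℂ) ^ 2) :=
    E.summable_iff.2 hsum
  rw [← E.tsum_eq, hsum'.tsum_prod, tsum_fintype, Finset.mul_sum]
  refine Finset.sum_congr rfl fun x _ => ?_
  set a' : ℂ := 1 / δ - I / N with ha'
  have ha'0 : 0 < a'.re := by
    have : a' = ((1 / δ : ℝ) : ℂ) - ((1 / N : ℝ) : ℂ) * I := by rw [ha']; push_cast; ring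
    rw [this, sub_re, ofReal_re, re_ofReal_mul]
    simpa using hδ
  have ha'' : a' ≠ 0 := by rintro h; rw [h] at ha'0; simp at ha'0
  have ha'pow : a' ^ (1 / 2 : ℂ) ≠ 0 := by
    rw [Ne, cpow_eq_zero_iff]; simp [ha'']
  have h7 := Complex.tsum_exp_neg_quadratic ha'0 (-(I * (x : ℕ) / N))
  have h8 : ∀ k : ℤ, cexp (-Real.pi / (δ + I * N) * (E (x, k) : ℂ) ^ 2) =
      cexp (Real.pi * I * (x : ℕ) ^ 2 / N) *
        cexp (-Real.pi / a' * (k + I * -(I * (x : ℕ) / N)) ^ 2) := by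
    intro k
    rw [← Complex.exp_add, Complex.exp_eq_exp_iff_exists_int, hE]
    refine ⟨n * k ^ 2 + k * (x : ℕ), ?_⟩
    have h9 : a' = (δ + I * N) / (I * (δ * N)) := by
      rw [ha']; field_simp; linear_combination (-δ : ℂ) * I_sq
    have h10 : (N : ℂ) = 2 * n := by rw [hN]; push_cast; ring
    have hn0 : (n : ℂ) ≠ 0 := Nat.cast_ne_zero.2 hn.ne'
    have h11 : -Real.pi / a' = - Real.pi * (N : ℂ) ^ 2 / (δ + I * N) - Real.pi * I * N := by
      rw [h9]; field_simp; linear_combination (N : ℂ) * I_sq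
    have h12 : I * -(I * (x : ℕ) / N) = ((x : ℕ) : ℂ) / N := by
      linear_combination (-((x : ℕ) : ℂ) / N) * I_sq
    have h13 : (n : ℂ) = N / 2 := by rw [h10]; ring
    rw [h11, h12]
    push_cast
    rw [h13]
    field_simp
    ring
  have h14 : ∀ k : ℤ, cexp (-Real.pi / δ * (k : ℂ) ^ 2) *
        cexp (((Real.pi * (k ^ 2 - 2 * (x : ℕ) * k) / N : ℝ) : ℂ) * I) =
      cexp (-Real.pi * a' * k ^ 2 + 2 * Real.pi * -(I * (x : ℕ) / N) * k) := by
    intro k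
    rw [← Complex.exp_add]
    congr 1
    rw [ha']; push_cast; ring
  simp_rw [h8, h14, tsum_mul_left]
  rw [h7]
  have h15 : (1 - I * δ / N) ^ (1 / 2 : ℂ) = (δ : ℂ) ^ (1 / 2 : ℂ) * a' ^ (1 / 2 : ℂ) := by
    have h16 : 1 - I * δ / N = (δ : ℂ) * a' := by rw [ha']; field_simp
    rw [h16, cpow_def_of_ne_zero (mul_ne_zero hδ0 ha''), cpow_def_of_ne_zero hδ0,
      cpow_def_of_ne_zero ha'', log_ofReal_mul hδ ha'', ← Complex.exp_add, ofReal_log hδ.le]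
    congr 1; ring
  rw [h15]
  field_simp

open Complex Filter Topology in
theorem sum_exp_sq_div {n : ℕ} (hn : 0 < n) :
    ∑ x : Fin (2 * n), cexp (Real.pi * I * (x : ℕ) ^ 2 / (2 * n : ℕ)) =
      (I * (2 * n : ℕ)) ^ (1 / 2 : ℂ) := by
  have hN : (0 : ℝ) < (2 * n : ℕ) := by exact_mod_cast (by positivity : 0 < 2 * n)
  have hN0 : ((2 * n : ℕ) : ℂ) ≠ 0 := by exact_mod_cast hN.ne'
  have hδ : Tendsto (fun δ : ℝ => (δ : ℂ)) (𝓝[>] 0) (𝓝 0) :=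
    (Complex.continuous_ofReal.tendsto' 0 0 (by simp)).mono_left nhdsWithin_le_nhds
  have hl : Tendsto (fun δ : ℝ => (δ + I * (2 * n : ℕ)) ^ (1 / 2 : ℂ) *
      (∑' k : ℤ, cexp (-Real.pi / δ * (k : ℂ) ^ 2) * 1)) (𝓝[>] 0)
      (𝓝 ((I * (2 * n : ℕ)) ^ (1 / 2 : ℂ) * 1)) := by
    refine Tendsto.mul ?_ (tendsto_tsum_exp_neg_mul_sq (fun _ => 1) (by simp) rfl)
    have h1 : ContinuousAt (fun z : ℂ => z ^ (1 / 2 : ℂ)) (I * (2 * n : ℕ)) := by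
      refine continuousAt_cpow_const ?_
      right
      simp; positivity
    refine h1.tendsto.comp ?_
    simpa using hδ.add_const (I * (2 * n : ℕ))
  have hr : Tendsto (fun δ : ℝ => ∑ x : Fin (2 * n),
      cexp (Real.pi * I * (x : ℕ) ^ 2 / (2 * n : ℕ)) *
      ((1 - I * δ / (2 * n : ℕ)) ^ (1 / 2 : ℂ) *
      ∑' k : ℤ, cexp (-Real.pi / δ * (k : ℂ) ^ 2) *
        cexp (((Real.pi * (k ^ 2 - 2 * (x : ℕ) * k) / (2 * n : ℕ) : ℝ) : ℂ) * I))) (𝓝[>] 0)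
      (𝓝 (∑ x : Fin (2 * n), cexp (Real.pi * I * (x : ℕ) ^ 2 / (2 * n : ℕ)) *
        ((1 : ℂ) ^ (1 / 2 : ℂ) * 1))) := by
    refine tendsto_finsetSum _ fun x _ => Tendsto.const_mul _ (Tendsto.mul ?_ ?_)
    · have h1 : ContinuousAt (fun z : ℂ => z ^ (1 / 2 : ℂ)) 1 :=
        continuousAt_cpow_const (by simp)
      refine h1.tendsto.comp ?_
      have := ((hδ.const_mul I).div_const ((2 * n : ℕ) : ℂ)).const_sub 1
      simpa using this
    · refine tendsto_tsum_exp_neg_mul_sq _ (fun k => norm_exp_ofReal_mul_I _) (by simp)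
  have heq := hl.congr' (f₂ := _) (by
    filter_upwards [self_mem_nhdsWithin] with δ hδ
    exact sum_exp_sq_div_aux hn hδ)
  have := tendsto_nhds_unique heq hr
  simpa using this.symm

end QuadraticGaussSum

section QuadraticGaussSumPhase

/-- The additive character `q ↦ exp (2πiq)` of `ℚ`. -/
noncomputable def ratChar : AddChar ℚ ℂ where
  toFun q := Complex.exp (2 * Real.pi * Complex.I * q)
  map_zero_eq_one' := by simp
  map_add_eq_mul' a b := by rw [← Complex.exp_add]; push_cast; ring_nf

theorem ratChar_apply (q : ℚ) : ratChar q = Complex.exp (2 * Real.pi * Complex.I * q) := rfl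

theorem ratChar_eq_one_iff {q : ℚ} : ratChar q = 1 ↔ ∃ n : ℤ, q = n := by
  rw [ratChar_apply, Complex.exp_eq_one_iff]
  refine exists_congr fun n => ?_
  have : (2 * Real.pi * Complex.I : ℂ) ≠ 0 := Complex.two_pi_I_ne_zero
  rw [mul_comm (n : ℂ), mul_right_inj' this]
  norm_cast

theorem star_ratChar (q : ℚ) : star (ratChar q) = ratChar (-q) := by
  rw [ratChar_apply, ratChar_apply, Complex.star_def, ← Complex.exp_conj]
  simp [map_ofNat]

theorem star_avg {A : Type*} [AddCommGroup A] (H : AddSubgroup A) [H.FiniteIndex] (F : A → ℂ) :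
    star (avg H F) = avg H (fun x => star (F x)) := by
  have := Fintype.ofFinite (A ⧸ H)
  rw [avg, avg, finsum_eq_sum_of_fintype, finsum_eq_sum_of_fintype, star_mul', star_sum]
  simp

theorem avg_ratChar_sq_div_pos {n : ℕ} (hn : 0 < n) :
    ∃ c : ℝ, 0 < c ∧ avg (AddSubgroup.zmultiples (2 * (n : ℤ)))
      (fun x : ℤ => ratChar (x ^ 2 / (4 * n))) = c * Complex.exp (Real.pi / 4 * Complex.I) := by
  have : NeZero (2 * n) := ⟨by positivity⟩
  have hn0 : (n : ℚ) ≠ 0 := by positivity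
  have hper : PeriodicMod (AddSubgroup.zmultiples (2 * (n : ℤ)))
      (fun x : ℤ => ratChar (x ^ 2 / (4 * n))) := by
    rintro x _ ⟨k, rfl⟩
    have : (((x + k • (2 * (n : ℤ)) : ℤ) : ℚ) ^ 2 / (4 * n)) =
        x ^ 2 / (4 * n) + ((k * x + n * k ^ 2 : ℤ) : ℚ) := by
      push_cast
      simp
      field_simp
      ring
    simp only [this, AddChar.map_add_eq_mul, ratChar_eq_one_iff.2 ⟨_, rfl⟩, mul_one]
  have hbij : Function.Bijective (fun i : Fin (2 * n) =>
      (((i : ℕ) : ℤ) : ℤ ⧸ AddSubgroup.zmultiples (2 * (n : ℤ)))) := by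
    constructor
    · intro i j hij
      have h1 := QuotientAddGroup.eq.1 hij
      rw [Int.mem_zmultiples_iff] at h1
      have h2 := i.2
      have h3 := j.2
      apply Fin.ext
      obtain ⟨k, hk⟩ := h1
      have : ((i : ℕ) : ℤ) ≡ ((j : ℕ) : ℤ) [ZMOD ((2 * n : ℕ) : ℤ)] := by
        rw [Int.modEq_iff_dvd]; exact ⟨k, by push_cast; linarith⟩
      rw [Int.natCast_modEq_iff] at this
      exact this.eq_of_lt_of_lt h2 h3
    · intro x
      obtain ⟨x, rfl⟩ := QuotientAddGroup.mk_surjective x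
      have hpos : (0 : ℤ) < 2 * n := by positivity
      refine ⟨⟨(x % (2 * n)).toNat, ?_⟩, QuotientAddGroup.eq.2 ?_⟩
      · have := Int.emod_lt_of_pos x hpos
        have := Int.emod_nonneg x hpos.ne'
        omega
      · rw [Int.mem_zmultiples_iff]
        have := Int.emod_nonneg x hpos.ne'
        simp only [Int.toNat_of_nonneg this]
        have := Int.emod_add_mul_ediv x (2 * n)
        exact ⟨x / (2 * n), by linarith⟩
  have hN : (0 : ℝ) < (2 * n : ℕ) := by positivity
  refine ⟨(Fintype.card (Fin (2 * n)) : ℝ)⁻¹ * Real.exp (Real.log (2 * n : ℕ) / 2), ?_, ?_⟩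
  · rw [Fintype.card_fin]; positivity
  rw [avg_eq_of_bijective hper _ hbij]
  have h1 : ∀ i : Fin (2 * n), ratChar ((((i : ℕ) : ℤ) : ℚ) ^ 2 / (4 * n)) =
      Complex.exp (Real.pi * Complex.I * (i : ℕ) ^ 2 / (2 * n : ℕ)) := by
    intro i
    rw [ratChar_apply]
    congr 1
    push_cast
    ring
  have hC : ((2 * n : ℕ) : ℂ) ≠ 0 := by exact_mod_cast hN.ne'
  simp_rw [h1]
  rw [sum_exp_sq_div hn]
  push_cast
  rw [mul_assoc]
  congr 1
  have h2 : Complex.I * (2 * n : ℂ) = ((2 * n : ℕ) : ℝ) * Complex.I := by push_cast; ring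
  rw [h2, Complex.cpow_def_of_ne_zero (by push_cast; push_cast at hC; simpa using hC),
    Complex.log_ofReal_mul hN Complex.I_ne_zero, Complex.log_I, ← Complex.exp_add]
  congr 1
  push_cast
  ring

theorem avg_ratChar_sq_div {n : ℤ} (hn : n ≠ 0) :
    ∃ c : ℝ, 0 < c ∧ avg (AddSubgroup.zmultiples (2 * n))
      (fun x : ℤ => ratChar (x ^ 2 / (4 * n))) =
        c * Complex.exp (if 0 < n then Real.pi / 4 * Complex.I else -(Real.pi / 4 * Complex.I)) := by
  split_ifs with h
  · lift n to ℕ using h.le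
    simpa using avg_ratChar_sq_div_pos (n := n) (by exact_mod_cast h)
  · obtain ⟨m, hm⟩ : ∃ m : ℕ, n = -m := ⟨n.natAbs, by omega⟩
    obtain ⟨c, hc, he⟩ := avg_ratChar_sq_div_pos (n := m) (by omega)
    refine ⟨c, hc, ?_⟩
    have : (AddSubgroup.zmultiples (2 * (m : ℤ))).FiniteIndex := by
      refine ⟨?_⟩
      rw [Int.index_zmultiples]
      omega
    have h1 := congrArg star he
    rw [star_avg, star_mul'] at h1
    simp only [star_ratChar] at h1
    rw [Complex.star_def, ← Complex.exp_conj] at h1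
    simp only [map_mul, Complex.conj_ofReal, Complex.conj_I, map_div₀] at h1
    have h2 : AddSubgroup.zmultiples (2 * n) = AddSubgroup.zmultiples (2 * (m : ℤ)) := by
      rw [hm, mul_neg, AddSubgroup.zmultiples_neg]
    rw [h2]
    convert h1 using 3
    · congr 1
      rw [hm]; push_cast; ring
    · rw [map_ofNat]; ring

end QuadraticGaussSumPhase

section Signature

open NumberField NumberField.InfinitePlace

theorem re_eq_of_mk_eq {K : Type*} [Field K] {φ ψ : K →+* ℂ}
    (h : InfinitePlace.mk φ = InfinitePlace.mk ψ) (x : K) :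
    (φ x).re = (ψ x).re := by
  rcases mk_eq_iff.1 h with rfl | rfl
  · rfl
  · simp [ComplexEmbedding.conjugate_coe_eq]

variable {K : Type*} [Field K] [NumberField K]

theorem trace_eq_sum_infinitePlace (x : K) :
    ((Algebra.trace ℚ K x : ℚ) : ℝ) = ∑ w : InfinitePlace K, mult w * (w.embedding x).re := by
  classical
  have h := trace_eq_sum_embeddings (K := ℚ) (L := K) ℂ (x := x)
  have h1 := congrArg Complex.re h
  rw [eq_ratCast, Complex.ratCast_re, Complex.re_sum,
    Fintype.sum_equiv (RingHom.equivRatAlgHom K ℂ).symm (fun f => (f x).re)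
      (fun φ => (φ x).re) (fun _ => rfl),
    ← Finset.sum_fiberwise Finset.univ mk (fun φ => (φ x).re)] at h1
  rw [h1]
  refine Finset.sum_congr rfl fun w _ => ?_
  have (φ) (hφ : φ ∈ ({φ | mk φ = w} : Finset _)) : (φ x).re = (w.embedding x).re :=
    re_eq_of_mk_eq (by rw [mk_embedding]; exact (Finset.mem_filter.mp hφ).2) x
  rw [Finset.sum_congr rfl this, Finset.sum_const, card_filter_mk_eq, nsmul_eq_mul]

open scoped Classical in
/-- The real-linear extension of the trace to the mixed space. -/
noncomputable def mixedTrace (K : Type*) [Field K] [NumberField K] :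
    mixedEmbedding.mixedSpace K →ₗ[ℝ] ℝ where
  toFun x := ∑ w, x.1 w + ∑ w, 2 * (x.2 w).re
  map_add' x y := by
    simp only [Prod.fst_add, Prod.snd_add, Pi.add_apply, Complex.add_re, mul_add,
      Finset.sum_add_distrib]
    ring
  map_smul' c x := by
    simp only [Prod.smul_fst, Prod.smul_snd, Pi.smul_apply, smul_eq_mul, RingHom.id_apply,
      Complex.smul_re, Finset.mul_sum, mul_add, mul_left_comm]

theorem mixedTrace_mixedEmbedding (x : K) :
    mixedTrace K (mixedEmbedding K x) = Algebra.trace ℚ K x := by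
  classical
  rw [trace_eq_sum_infinitePlace]
  rw [sum_eq_sum_add_sum]
  change ∑ w, (mixedEmbedding K x).1 w + ∑ w, 2 * ((mixedEmbedding K x).2 w).re = _
  congr 1
  · refine Finset.sum_congr rfl fun w _ => ?_
    rw [w.2.mult_eq_one, mixedEmbedding.mixedEmbedding_apply_isReal,
      ← embedding_of_isReal_apply w.2, Complex.ofReal_re, Nat.cast_one, one_mul]
  · refine Finset.sum_congr rfl fun w _ => ?_
    rw [w.2.mult_eq_two, mixedEmbedding.mixedEmbedding_apply_isComplex]
    simp

theorem exists_mixedSpace_sq {K : Type*} [Field K] {a : K} (ha : ∀ σ : K →+* ℝ, 0 < σ a) :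
    ∃ ρ : mixedEmbedding.mixedSpace K, ρ * ρ = mixedEmbedding K a := by
  refine ⟨(fun w => Real.sqrt ((mixedEmbedding K a).1 w),
    fun w => (mixedEmbedding K a).2 w ^ (1 / 2 : ℂ)), Prod.ext ?_ ?_⟩
  · funext w
    exact Real.mul_self_sqrt (by
      rw [mixedEmbedding.mixedEmbedding_apply_isReal]; exact (ha _).le)
  · funext w
    change _ ^ (1 / 2 : ℂ) * _ ^ (1 / 2 : ℂ) = (mixedEmbedding K a).2 w
    rw [← sq, ← Complex.cpow_nat_mul]
    norm_num

theorem card_pos_trace_le {a : K} (ha : ∀ σ : K →+* ℝ, 0 < σ a) (μ : K) {ι : Type*} [Fintype ι]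
    (hι : Fintype.card ι = Module.finrank ℚ K) (e e' : ι → K)
    (he : ∀ i j, i ≠ j → Algebra.trace ℚ K (μ * (e i * e j)) = 0)
    (he' : ∀ i j, i ≠ j → Algebra.trace ℚ K (a * μ * (e' i * e' j)) = 0)
    (hne : ∀ i, Algebra.trace ℚ K (a * μ * (e' i * e' i)) ≠ 0) :
    Nat.card {i // 0 < Algebra.trace ℚ K (μ * (e i * e i))} ≤
      Nat.card {i // 0 < Algebra.trace ℚ K (a * μ * (e' i * e' i))} := by
  classical
  obtain ⟨ρ, hρ⟩ := exists_mixedSpace_sq ha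
  set P := fun i => 0 < Algebra.trace ℚ K (μ * (e i * e i)) with hP
  set P' := fun i => 0 < Algebra.trace ℚ K (a * μ * (e' i * e' i)) with hP'
  let m := mixedEmbedding K
  have expand : ∀ (κ : Type _) [Fintype κ] (ν : K) (f : κ → K) (c : κ → ℝ),
      (∀ i j, i ≠ j → Algebra.trace ℚ K (ν * (f i * f j)) = 0) →
      mixedTrace K (m ν * ((∑ i, c i • m (f i)) * (∑ i, c i • m (f i)))) =
        ∑ i, c i ^ 2 * (Algebra.trace ℚ K (ν * (f i * f i)) : ℝ) := by
    intro κ _ ν f c hf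
    rw [Finset.sum_mul_sum, Finset.mul_sum, map_sum]
    refine Finset.sum_congr rfl fun i _ => ?_
    rw [Finset.mul_sum, map_sum, Finset.sum_eq_single i]
    · rw [smul_mul_smul_comm, mul_smul_comm, map_smul, ← map_mul, ← map_mul,
        mixedTrace_mixedEmbedding, smul_eq_mul, sq]
    · intro j _ hj
      rw [smul_mul_smul_comm, mul_smul_comm, map_smul, ← map_mul, ← map_mul,
        mixedTrace_mixedEmbedding, hf i j hj.symm]
      simp
    · simp
  let F : {i // P i} ⊕ {i // ¬ P' i} → mixedEmbedding.mixedSpace K :=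
    Sum.elim (fun i => m (e i)) (fun j => ρ * m (e' j))
  have hF : LinearIndependent ℝ F := by
    rw [Fintype.linearIndependent_iff]
    intro c hc
    rw [Fintype.sum_sum_type] at hc
    simp only [F, Sum.elim_inl, Sum.elim_inr] at hc
    have h1 := expand {i // P i} μ (fun i => e i) (fun i => c (Sum.inl i))
      (fun i j hij => he _ _ (fun h => hij (Subtype.ext h)))
    have h2 := expand {i // ¬ P' i} (a * μ) (fun i => e' i) (fun i => c (Sum.inr i))
      (fun i j hij => he' _ _ (fun h => hij (Subtype.ext h)))
    simp_rw [← mul_smul_comm] at hc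
    rw [← Finset.mul_sum] at hc
    set X := ∑ i : {i // P i}, c (Sum.inl i) • m (e i)
    set Y := ∑ i : {i // ¬ P' i}, c (Sum.inr i) • m (e' i)
    have h3 : m (a * μ) * (Y * Y) = m μ * (X * X) := by
      rw [map_mul, ← hρ, eq_neg_of_add_eq_zero_left hc]; ring
    rw [h3, h1] at h2
    have h4 : ∀ i : {i // P i},
        0 ≤ c (Sum.inl i) ^ 2 * (Algebra.trace ℚ K (μ * (e i * e i)) : ℝ) :=
      fun i => mul_nonneg (sq_nonneg _) (by exact_mod_cast (le_of_lt i.2))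
    have h5 : ∀ i : {i // ¬ P' i},
        c (Sum.inr i) ^ 2 * (Algebra.trace ℚ K (a * μ * (e' i * e' i)) : ℝ) ≤ 0 :=
      fun i => mul_nonpos_of_nonneg_of_nonpos (sq_nonneg _) (by exact_mod_cast not_lt.1 i.2)
    have h6 := Finset.sum_nonneg fun i (_ : i ∈ Finset.univ) => h4 i
    have h7 := Finset.sum_nonpos fun i (_ : i ∈ Finset.univ) => h5 i
    have h8 := (Finset.sum_eq_zero_iff_of_nonneg fun i _ => h4 i).1 (le_antisymm (h2 ▸ h7) h6)
    have h9 := (Finset.sum_eq_zero_iff_of_nonpos fun i _ => h5 i).1 (le_antisymm h7 (h2 ▸ h6))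
    rintro (i | i)
    · have := h8 i (Finset.mem_univ _)
      rcases mul_eq_zero.1 this with h | h
      · exact pow_eq_zero_iff (two_ne_zero) |>.1 h
      · exact absurd (by exact_mod_cast h) i.2.ne'
    · have := h9 i (Finset.mem_univ _)
      rcases mul_eq_zero.1 this with h | h
      · exact pow_eq_zero_iff (two_ne_zero) |>.1 h
      · exact absurd (by exact_mod_cast h) (hne i)
  have h := hF.fintype_card_le_finrank
  rw [Fintype.card_sum, mixedEmbedding.finrank, ← hι, Fintype.card_subtype_compl] at h
  have := Fintype.card_subtype_le P'
  rw [Nat.card_eq_fintype_card, Nat.card_eq_fintype_card]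
  change Fintype.card {i // P i} ≤ Fintype.card {i // P' i}
  omega

end Signature

section MeanPi

theorem bijective_mk_pi_out {ι : Type*} {A : ι → Type*} [∀ i, AddCommGroup (A i)]
    (H : ∀ i, AddSubgroup (A i)) :
    Function.Bijective (fun q : (∀ i, A i ⧸ H i) =>
      ((fun i => (q i).out : ∀ i, A i) : (∀ i, A i) ⧸ AddSubgroup.pi Set.univ H)) := by
  constructor
  · intro p q h
    funext i
    have h2 := QuotientAddGroup.eq.1 h
    rw [← Quotient.out_eq' (p i), ← Quotient.out_eq' (q i)]
    exact QuotientAddGroup.eq.2 (h2 i (Set.mem_univ i))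
  · intro x
    obtain ⟨x, rfl⟩ := QuotientAddGroup.mk_surjective x
    refine ⟨fun i => x i, QuotientAddGroup.eq.2 fun i _ => ?_⟩
    have h2 : ((x i : A i ⧸ H i).out : A i ⧸ H i) = x i := Quotient.out_eq' _
    exact (QuotientAddGroup.eq (s := H i)).1 h2

variable {ι : Type*} [Fintype ι] {A : ι → Type*} [∀ i, AddCommGroup (A i)]

theorem finiteIndex_pi_univ (H : ∀ i, AddSubgroup (A i)) [∀ i, (H i).FiniteIndex] :
    (AddSubgroup.pi Set.univ H).FiniteIndex :=
  have := Finite.of_surjective _ (bijective_mk_pi_out H).2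
  AddSubgroup.finiteIndex_of_finite_quotient

theorem avg_pi (H : ∀ i, AddSubgroup (A i)) [∀ i, (H i).FiniteIndex] (F : ∀ i, A i → ℂ)
    (hF : ∀ i, PeriodicMod (H i) (F i)) :
    PeriodicMod (AddSubgroup.pi Set.univ H) (fun x => ∏ i, F i (x i)) ∧
    avg (AddSubgroup.pi Set.univ H) (fun x => ∏ i, F i (x i)) = ∏ i, avg (H i) (F i) := by
  classical
  have hper : PeriodicMod (AddSubgroup.pi Set.univ H) (fun x => ∏ i, F i (x i)) :=
    fun x h hh => Finset.prod_congr rfl fun i _ => hF i _ _ (hh i (Set.mem_univ i))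
  refine ⟨hper, ?_⟩
  have := fun i => Fintype.ofFinite (A i ⧸ H i)
  rw [avg_eq_of_bijective hper _ (bijective_mk_pi_out H)]
  simp only [avg, Finset.prod_mul_distrib, finsum_eq_sum_of_fintype, Finset.prod_univ_sum,
    Fintype.piFinset_univ, Fintype.card_pi, AddSubgroup.index, Nat.card_eq_fintype_card]
  push_cast
  rw [Finset.prod_inv_distrib]

end MeanPi

section Milgram

open NumberField nonZeroDivisors

variable {K : Type*} [Field K] [NumberField K]

/-- The function `y ↦ exp (2πi Tr (μ y²))` on the ring of integers. -/
noncomputable def traceSq (μ : K) (y : 𝓞 K) : ℂ :=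
  ratChar (Algebra.trace ℚ K (μ * (y : K) ^ 2))

/-- `4μ 𝓞 K` contains the codifferent. -/
def ContainsCodifferent (μ : K) : Prop :=
  ∀ w ∈ FractionalIdeal.dual ℤ ℚ (1 : FractionalIdeal (𝓞 K)⁰ K), ∃ r : 𝓞 K, w = 4 * μ * r

theorem fractionalIdeal_one_ne_zero : (1 : FractionalIdeal (𝓞 K)⁰ K) ≠ 0 := one_ne_zero

theorem mem_dual_one_iff {w : K} : w ∈ FractionalIdeal.dual ℤ ℚ (1 : FractionalIdeal (𝓞 K)⁰ K) ↔
    ∀ y : 𝓞 K, ∃ n : ℤ, Algebra.trace ℚ K (w * y) = n := by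
  rw [FractionalIdeal.mem_dual fractionalIdeal_one_ne_zero]
  constructor
  · intro h y
    obtain ⟨n, hn⟩ := h y ((FractionalIdeal.mem_one_iff _).2 ⟨y, rfl⟩)
    exact ⟨n, by rw [← Algebra.traceForm_apply, ← hn]; simp⟩
  · intro h y hy
    obtain ⟨y, rfl⟩ := (FractionalIdeal.mem_one_iff _).1 hy
    obtain ⟨n, hn⟩ := h y
    exact ⟨n, by rw [Algebra.traceForm_apply, ← RingOfIntegers.coe_eq_algebraMap, hn]; simp⟩

theorem mem_range_of_trace_mul_dual {x : K}
    (hx : ∀ w ∈ FractionalIdeal.dual ℤ ℚ (1 : FractionalIdeal (𝓞 K)⁰ K),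
      ∃ n : ℤ, Algebra.trace ℚ K (x * w) = n) : ∃ r : 𝓞 K, x = r := by
  have h1 : x ∈ FractionalIdeal.dual ℤ ℚ
      (FractionalIdeal.dual ℤ ℚ (1 : FractionalIdeal (𝓞 K)⁰ K)) := by
    rw [FractionalIdeal.mem_dual (FractionalIdeal.dual_ne_zero _ _ fractionalIdeal_one_ne_zero)]
    intro w hw
    obtain ⟨n, hn⟩ := hx w hw
    exact ⟨n, by rw [Algebra.traceForm_apply, hn]; simp⟩
  rw [FractionalIdeal.dual_dual] at h1
  obtain ⟨y, hy⟩ := (FractionalIdeal.mem_one_iff _).1 h1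
  exact ⟨y, hy.symm⟩

theorem coe_two_mul (r : 𝓞 K) : ((2 * r : 𝓞 K) : K) = 2 * (r : K) := by
  rw [RingOfIntegers.coe_eq_algebraMap, map_mul, map_ofNat]

theorem ratChar_sum {ι : Type*} (s : Finset ι) (f : ι → ℚ) :
    ratChar (∑ i ∈ s, f i) = ∏ i ∈ s, ratChar (f i) := by
  classical
  induction s using Finset.induction_on with
  | empty => simp
  | insert i s hi ih => rw [Finset.sum_insert hi, Finset.prod_insert hi,
      AddChar.map_add_eq_mul, ih]

theorem avg_traceSq_aux {μ : K} (hμ0 : μ ≠ 0) (hμ : ContainsCodifferent μ) {ι : Type*} [Fintype ι]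
    (e : Module.Basis ι ℚ K)
    (he : ∀ i j, i ≠ j → Algebra.trace ℚ K (μ * (e i * e j)) = 0)
    (hd : ∀ i, 2 * μ * e i ∈ FractionalIdeal.dual ℤ ℚ (1 : FractionalIdeal (𝓞 K)⁰ K))
    (n : ι → ℤ) (hn : ∀ i, Algebra.trace ℚ K (μ * (e i * e i)) = n i) (hn0 : ∀ i, n i ≠ 0) :
    ∃ c : ℝ, 0 < c ∧ ∀ H : AddSubgroup (𝓞 K), H.FiniteIndex → PeriodicMod H (traceSq μ) →
      avg H (traceSq μ) = c * ∏ i, Complex.exp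
        (if 0 < n i then Real.pi / 4 * Complex.I else -(Real.pi / 4 * Complex.I)) := by
  classical
  have hnQ : ∀ i, (n i : ℚ) ≠ 0 := fun i => by exact_mod_cast hn0 i
  let m : (ι → ℤ) →+ K :=
    { toFun := fun x => ∑ i, ((x i : ℚ) / (2 * n i)) • e i
      map_zero' := by simp
      map_add' := fun x y => by
        rw [← Finset.sum_add_distrib]
        refine Finset.sum_congr rfl fun i _ => ?_
        rw [← add_smul]; congr 1; simp; ring }
  have hm : ∀ x, m x = ∑ i, ((x i : ℚ) / (2 * n i)) • e i := fun x => rfl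
  have hce : ∀ (c : ι → ℚ) i, Algebra.trace ℚ K ((∑ j, c j • e j) * (2 * μ * e i)) =
      2 * n i * c i := by
    intro c i
    rw [Finset.sum_mul, map_sum, Finset.sum_eq_single i]
    · rw [smul_mul_assoc, map_smul, show e i * (2 * μ * e i) = (2 : ℚ) • (μ * (e i * e i)) by
        rw [Algebra.smul_def]; simp; ring, map_smul, hn, smul_eq_mul, smul_eq_mul]
      ring
    · intro j _ hj
      rw [smul_mul_assoc, map_smul, show e j * (2 * μ * e i) = (2 : ℚ) • (μ * (e j * e i)) by
        rw [Algebra.smul_def]; simp; ring, map_smul, he j i hj]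
      simp
    · simp
  have hme : ∀ x i, Algebra.trace ℚ K (m x * (2 * μ * e i)) = x i := by
    intro x i
    rw [hm, hce]
    field_simp [hnQ i]
  have hmm : ∀ x y, Algebra.trace ℚ K (2 * μ * (m x * m y)) = ∑ i, (x i * y i : ℚ) / (2 * n i) := by
    intro x y
    rw [hm y, Finset.mul_sum, Finset.mul_sum, map_sum]
    refine Finset.sum_congr rfl fun i _ => ?_
    rw [mul_smul_comm, mul_smul_comm, map_smul,
      show 2 * μ * (m x * e i) = m x * (2 * μ * e i) by ring, hme, smul_eq_mul]
    ring
  have hmq : ∀ x, Algebra.trace ℚ K (μ * (m x) ^ 2) = ∑ i, (x i : ℚ) ^ 2 / (4 * n i) := by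
    intro x
    have h1 := hmm x x
    rw [show 2 * μ * (m x * m x) = (2 : ℚ) • (μ * m x ^ 2) by
      rw [Algebra.smul_def]; simp; ring, map_smul, smul_eq_mul] at h1
    have : ∑ i, (x i : ℚ) ^ 2 / (4 * n i) = 2⁻¹ * ∑ i, (x i * x i : ℚ) / (2 * n i) := by
      rw [Finset.mul_sum]
      refine Finset.sum_congr rfl fun i _ => ?_
      have := hnQ i
      field_simp
      norm_num
    rw [this, ← h1]; ring
  have hminj : Function.Injective m := by
    intro x y h
    funext i
    have h1 := hme x i
    rw [h, hme] at h1
    exact_mod_cast h1.symm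
  have hmsurj : ∀ z : K, (∀ i, ∃ k : ℤ, Algebra.trace ℚ K (z * (2 * μ * e i)) = k) →
      ∃ x, m x = z := by
    intro z hz
    choose x hx using hz
    refine ⟨x, ?_⟩
    rw [hm]
    conv_rhs => rw [← e.sum_repr z]
    refine Finset.sum_congr rfl fun i _ => ?_
    congr 1
    have h1 := hx i
    rw [← e.sum_repr z, hce] at h1
    rw [← h1]
    field_simp [hnQ i]
  let δ := FractionalIdeal.dual ℤ ℚ (1 : FractionalIdeal (𝓞 K)⁰ K)
  let D : AddSubgroup (ι → ℤ) := (algebraMap (𝓞 K) K).toAddMonoidHom.range.comap m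
  let L : AddSubgroup (ι → ℤ) :=
    ((δ : Submodule (𝓞 K) K).toAddSubgroup.comap (AddMonoidHom.mulLeft (2 * μ))).comap m
  let H' : AddSubgroup (ι → ℤ) := AddSubgroup.pi Set.univ
    (fun i => AddSubgroup.zmultiples (2 * n i))
  have hD : ∀ x, x ∈ D ↔ ∃ r : 𝓞 K, (r : K) = m x := fun x => Iff.rfl
  have hL : ∀ x, x ∈ L ↔ 2 * μ * m x ∈ δ := fun x => Iff.rfl
  have hLr : ∀ x ∈ L, ∃ r : 𝓞 K, m x = 2 * r ∧ 2 * μ * m x = 4 * μ * r := by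
    intro x hx
    obtain ⟨r, hr⟩ := hμ _ ((hL x).1 hx)
    exact ⟨r, mul_left_cancel₀ hμ0 (by linear_combination hr / 2), hr⟩
  have hLq : ∀ x ∈ L, ∃ k : ℤ, Algebra.trace ℚ K (μ * (m x) ^ 2) = k := by
    intro x hx
    obtain ⟨r, hr, -⟩ := hLr x hx
    obtain ⟨k, hk⟩ := mem_dual_one_iff.1 ((hL x).1 hx) r
    refine ⟨k, ?_⟩
    rw [← hk]
    congr 1
    rw [hr]; ring
  have hLD : L ≤ D := fun x hx => by
    obtain ⟨r, hr, -⟩ := hLr x hx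
    exact (hD x).2 ⟨2 * r, by rw [hr]; exact coe_two_mul r⟩
  have hH'L : H' ≤ L := fun x hx => by
    rw [hL, hm, Finset.mul_sum]
    refine Submodule.sum_mem (δ : Submodule (𝓞 K) K) fun i _ => ?_
    obtain ⟨k, hk⟩ := AddSubgroup.mem_zmultiples_iff.1 (hx i (Set.mem_univ i))
    have h1 : 2 * μ * ((x i / (2 * n i) : ℚ) • e i) = k • (2 * μ * e i) := by
      rw [← hk]
      have : (((k • (2 * n i) : ℤ) : ℚ) / (2 * n i)) = k := by
        have := hnQ i
        simp
        field_simp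
      rw [this, Algebra.smul_def]
      simp
      ring
    rw [h1]
    exact (δ : Submodule (𝓞 K) K).toAddSubgroup.zsmul_mem (hd i) k
  have hfi : ∀ i, (AddSubgroup.zmultiples (2 * n i)).FiniteIndex := fun i =>
    ⟨by rw [Int.index_zmultiples]; have := hn0 i; omega⟩
  have hH'fi : H'.FiniteIndex := finiteIndex_pi_univ _
  have hper1 : ∀ i, PeriodicMod (AddSubgroup.zmultiples (2 * n i))
      (fun x : ℤ => ratChar (x ^ 2 / (4 * n i))) := by
    rintro i x _ ⟨k, rfl⟩
    have : (((x + k • (2 * n i) : ℤ) : ℚ) ^ 2 / (4 * n i)) =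
        x ^ 2 / (4 * n i) + ((k * x + n i * k ^ 2 : ℤ) : ℚ) := by
      have := hnQ i
      push_cast
      simp
      field_simp
      ring
    simp only [this, AddChar.map_add_eq_mul, ratChar_eq_one_iff.2 ⟨_, rfl⟩, mul_one]
  obtain ⟨hper, havg⟩ := avg_pi (fun i => AddSubgroup.zmultiples (2 * n i))
    (fun i (x : ℤ) => ratChar (x ^ 2 / (4 * n i))) hper1
  let F' : (ι → ℤ) → ℂ := fun x => ∏ i, ratChar ((x i) ^ 2 / (4 * n i))
  change PeriodicMod H' F' at hper
  change avg H' F' = _ at havg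
  have hF' : ∀ x, F' x = ratChar (Algebra.trace ℚ K (μ * (m x) ^ 2)) := fun x => by
    rw [hmq, ratChar_sum]
  let β : (ι → ℤ) → AddChar (ι → ℤ) ℂ := fun x => ratChar.compAddMonoidHom
    ((Algebra.trace ℚ K).toAddMonoidHom.comp ((AddMonoidHom.mulLeft (2 * μ * m x)).comp m))
  have hβ : ∀ x l, β x l = ratChar (Algebra.trace ℚ K (2 * μ * m x * m l)) := fun x l => rfl
  have key := avg_eq_of_char (H := H') (L := L) (D := D) (hH'L.trans hLD) hper β
    (fun x l hl => by
      rw [hF', hF', hβ, m.map_add, ← AddChar.map_add_eq_mul]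
      obtain ⟨k, hk⟩ := hLq l hl
      have h1 : μ * (m x + m l) ^ 2 = μ * m x ^ 2 + 2 * μ * m x * m l + μ * m l ^ 2 := by ring
      rw [h1, (Algebra.trace ℚ K).map_add, (Algebra.trace ℚ K).map_add, hk, AddChar.map_add_eq_mul _ (_ + _),
        ratChar_eq_one_iff.2 ⟨k, rfl⟩,
        mul_one])
    (fun x h hh => by
      rw [hβ, ratChar_eq_one_iff, mul_assoc, hmm]
      have : ∀ i, ∃ k : ℤ, (x i * h i : ℚ) / (2 * n i) = k := fun i => by
        obtain ⟨k, hk⟩ := AddSubgroup.mem_zmultiples_iff.1 (hh i (Set.mem_univ i))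
        refine ⟨x i * k, ?_⟩
        have := hnQ i
        rw [← hk]
        push_cast
        simp
        field_simp
      choose k hk using this
      exact ⟨∑ i, k i, by push_cast; exact Finset.sum_congr rfl fun i _ => hk i⟩)
    (fun x => by
      constructor
      · intro hx l hl
        obtain ⟨r, hr⟩ := (hD x).1 hx
        obtain ⟨k, hk⟩ := mem_dual_one_iff.1 ((hL l).1 hl) r
        rw [hβ, ratChar_eq_one_iff]
        exact ⟨k, by rw [← hk, hr]; congr 1; ring⟩
      · intro h
        rw [hD]
        obtain ⟨r, hr⟩ := mem_range_of_trace_mul_dual (x := m x) (fun w hw => by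
          obtain ⟨r, hr⟩ := hμ w hw
          obtain ⟨l, hl⟩ := hmsurj (w / (2 * μ)) (fun i => by
            obtain ⟨k, hk⟩ := mem_dual_one_iff.1 (hd i) (2 * r)
            refine ⟨k, ?_⟩
            rw [← hk]
            congr 1
            rw [hr, coe_two_mul]
            field_simp
            ring)
          have h2 : 2 * μ * m l = w := by rw [hl]; field_simp
          have h3 := h l (by rw [hL, h2]; exact hw)
          rw [hβ, ratChar_eq_one_iff] at h3
          obtain ⟨k, hk⟩ := h3
          refine ⟨k, ?_⟩
          rw [← hk, ← h2]
          congr 1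
          ring)
        exact ⟨r, hr.symm⟩)
  have hinj : Function.Injective (algebraMap (𝓞 K) K).toAddMonoidHom :=
    RingOfIntegers.coe_injective
  let φ : D →+ 𝓞 K := (AddMonoidHom.ofInjective hinj).symm.toAddMonoidHom.comp
    (m.addSubgroupComap _)
  have hφ : ∀ x, (φ x : K) = m x := fun x => by
    have h1 := (AddMonoidHom.ofInjective hinj).apply_symm_apply (m.addSubgroupComap _ x)
    exact congrArg Subtype.val h1
  have hφinj : Function.Injective φ := fun x y hxy => by
    apply Subtype.ext
    apply hminj
    rw [← hφ, ← hφ, hxy]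
  have hφsurj : Function.Surjective φ := fun y => by
    obtain ⟨x, hx⟩ := hmsurj y (fun i => by
      obtain ⟨k, hk⟩ := mem_dual_one_iff.1 (hd i) y
      exact ⟨k, by rw [← hk, mul_comm]⟩)
    exact ⟨⟨x, (hD x).2 ⟨y, hx.symm⟩⟩, RingOfIntegers.coe_injective ((hφ _).trans hx)⟩
  have hFφ : ∀ x, traceSq μ (φ x) = F' x := fun x => by rw [traceSq, hφ, hF']
  let H'' : AddSubgroup (𝓞 K) := (H'.addSubgroupOf D).map φ
  have hcomap : H''.comap φ = H'.addSubgroupOf D :=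
    AddSubgroup.comap_map_eq_self_of_injective hφinj _
  have hH''fi : H''.FiniteIndex := ⟨by
    rw [← AddSubgroup.index_comap_of_surjective H'' hφsurj, hcomap]
    exact AddSubgroup.FiniteIndex.index_ne_zero⟩
  have hper'' : PeriodicMod H'' (traceSq μ) := by
    rintro y _ ⟨x, hx, rfl⟩
    obtain ⟨y, rfl⟩ := hφsurj y
    rw [← map_add, hFφ, hFφ]
    exact hper _ _ hx
  have hDfi : D.index ≠ 0 :=
    (AddSubgroup.finiteIndex_of_le (hH'L.trans hLD)).index_ne_zero
  choose c hc0 hc using fun i => avg_ratChar_sq_div (hn0 i)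
  refine ⟨D.index * ∏ i, c i, mul_pos (by positivity) (Finset.prod_pos fun i _ => hc0 i), ?_⟩
  intro H hHfi hH
  have hfi' : (H ⊓ H'').FiniteIndex := inferInstance
  rw [← avg_mono (inf_le_left : H ⊓ H'' ≤ H) hH, avg_mono (inf_le_right : H ⊓ H'' ≤ H'') hper'',
    ← avg_comp hper'' φ (fun b => by
      obtain ⟨a, rfl⟩ := hφsurj b
      exact ⟨a, by simp⟩), hcomap]
  have h1 : traceSq μ ∘ φ = fun x : D => F' x := funext hFφ
  have h2 : (D.index : ℂ) ≠ 0 := by exact_mod_cast hDfi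
  rw [h1]
  have h3 : avg (H'.addSubgroupOf D) (fun x : D => F' x) = D.index * avg H' F' := by
    rw [key]; field_simp
  rw [h3, havg, Finset.prod_congr rfl fun i _ => hc i, Finset.prod_mul_distrib]
  push_cast
  ring

end Milgram

section Milgram

open NumberField nonZeroDivisors

variable {K : Type*} [Field K] [NumberField K]

theorem exists_orthogonal_traceBasis {μ : K} (hμ0 : μ ≠ 0) (hμ : ContainsCodifferent μ) :
    ∃ (e : Module.Basis (Fin (Module.finrank ℚ K)) ℚ K) (n : Fin (Module.finrank ℚ K) → ℤ),
      (∀ i j, i ≠ j → Algebra.trace ℚ K (μ * (e i * e j)) = 0) ∧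
      (∀ i, 2 * μ * e i ∈ FractionalIdeal.dual ℤ ℚ (1 : FractionalIdeal (𝓞 K)⁰ K)) ∧
      (∀ i, Algebra.trace ℚ K (μ * (e i * e i)) = n i) ∧ ∀ i, n i ≠ 0 := by
  let B : LinearMap.BilinForm ℚ K :=
    (Algebra.traceForm ℚ K).comp (LinearMap.mulLeft ℚ μ) LinearMap.id
  have hB : ∀ x y, B x y = Algebra.trace ℚ K (μ * (x * y)) := fun x y => by
    simp [B, Algebra.traceForm_apply, mul_assoc]
  have hBs : LinearMap.IsSymm B := ⟨fun x y => by simp [hB, mul_comm]⟩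
  have : Invertible (2 : ℚ) := invertibleOfNonzero two_ne_zero
  obtain ⟨v, hv⟩ := LinearMap.BilinForm.exists_orthogonal_basis hBs
  have hmul : ∀ i, ∃ N : ℤ, N ≠ 0 ∧ IsIntegral ℤ (N • (2 * μ * v i)) := fun i =>
    ((IsFractionRing.isAlgebraic_iff ℤ ℚ K).2
      (Algebra.IsAlgebraic.isAlgebraic (R := ℚ) (2 * μ * v i))).exists_integral_multiple
  choose N hN0 hN using hmul
  have hNu : ∀ i, IsUnit (N i : ℚ) := fun i => by simpa using hN0 i
  let e := v.isUnitSMul hNu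
  have hev : ∀ i, e i = (N i : K) * v i := fun i => by
    rw [show e i = _ from Module.Basis.isUnitSMul_apply hNu i, Algebra.smul_def]; simp
  have he : ∀ i j, i ≠ j → Algebra.trace ℚ K (μ * (e i * e j)) = 0 := fun i j hij => by
    have h1 : B (v i) (v j) = 0 := hv hij
    rw [← hB, Module.Basis.isUnitSMul_apply, Module.Basis.isUnitSMul_apply]
    simp [h1]
  have hd : ∀ i, 2 * μ * e i ∈ FractionalIdeal.dual ℤ ℚ (1 : FractionalIdeal (𝓞 K)⁰ K) :=
    fun i => by
      refine FractionalIdeal.one_le_dual_one ℤ ℚ ((FractionalIdeal.mem_one_iff _).2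
        ⟨⟨_, hN i⟩, ?_⟩)
      rw [hev]
      change N i • (2 * μ * v i) = _
      rw [zsmul_eq_mul]
      ring
  have hn : ∀ i, ∃ n : ℤ, Algebra.trace ℚ K (μ * (e i * e i)) = n := fun i => by
    obtain ⟨r, hr⟩ := hμ _ (hd i)
    obtain ⟨n, hn⟩ := mem_dual_one_iff.1 (hd i) r
    refine ⟨n, ?_⟩
    have h1 : e i = 2 * r := mul_left_cancel₀ hμ0 (by linear_combination hr / 2)
    rw [← hn]
    congr 1
    linear_combination μ * e i * h1
  choose n hn using hn
  refine ⟨e, n, he, hd, hn, fun i hi => ?_⟩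
  have h0 : μ * e i = 0 := by
    refine (traceForm_nondegenerate ℚ K).1 _ fun y => ?_
    have h2 : B (e i) = 0 := e.ext fun j => by
      rw [hB]
      rcases eq_or_ne i j with rfl | hij
      · rw [hn, hi]; simp
      · rw [he i j hij]; simp
    have h3 := LinearMap.congr_fun h2 y
    rwa [hB, ← mul_assoc] at h3
  exact e.ne_zero i ((mul_eq_zero.1 h0).resolve_left hμ0)

theorem prod_exp_sign {ι : Type*} [Fintype ι] (p : ι → Prop) [DecidablePred p] (z : ℂ) :
    ∏ i, Complex.exp (if p i then z else -z) =
      Complex.exp ((Nat.card {i // p i}) * (2 * z) - Fintype.card ι * z) := by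
  rw [← Complex.exp_sum]
  congr 1
  have : ∀ i, (if p i then z else -z) = (if p i then 2 * z else 0) - z := fun i => by
    split_ifs <;> ring
  simp only [this, Finset.sum_sub_distrib, Finset.sum_const, Finset.card_univ, nsmul_eq_mul,
    ← Finset.sum_filter, Nat.card_eq_fintype_card, Fintype.card_subtype]

theorem avg_traceSq_mul_star_pos {μ a : K} (ha : ∀ σ : K →+* ℝ, 0 < σ a) (ha0 : a ≠ 0)
    (hμ0 : μ ≠ 0) (hμ : ContainsCodifferent μ) (haμ : ContainsCodifferent (a * μ)) :
    ∃ c : ℝ, 0 < c ∧ ∀ H : AddSubgroup (𝓞 K), H.FiniteIndex → PeriodicMod H (traceSq μ) →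
      PeriodicMod H (traceSq (a * μ)) →
      avg H (traceSq μ) * star (avg H (traceSq (a * μ))) = c := by
  obtain ⟨e, n, he, hd, hn, hn0⟩ := exists_orthogonal_traceBasis hμ0 hμ
  obtain ⟨e', n', he', hd', hn', hn0'⟩ := exists_orthogonal_traceBasis (mul_ne_zero ha0 hμ0) haμ
  obtain ⟨c, hc0, hc⟩ := avg_traceSq_aux hμ0 hμ e he hd n hn hn0
  obtain ⟨c', hc0', hc'⟩ := avg_traceSq_aux (mul_ne_zero ha0 hμ0) haμ e' he' hd' n' hn' hn0'
  have hcard : Nat.card {i // 0 < n i} = Nat.card {i // 0 < n' i} := by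
    have h1 := card_pos_trace_le ha μ (by simp) e e' he he'
      (fun i => by rw [hn']; exact_mod_cast hn0' i)
    have h2 := card_pos_trace_le (a := a⁻¹) (fun σ => by rw [map_inv₀]; exact inv_pos.2 (ha σ))
      (a * μ) (by simp) e' e he' (by simpa [ha0] using he)
      (fun i => by rw [inv_mul_cancel_left₀ ha0, hn]; exact_mod_cast hn0 i)
    simp only [inv_mul_cancel_left₀ ha0, hn, hn', Int.cast_pos] at h1 h2
    exact le_antisymm h1 h2
  refine ⟨c * c', mul_pos hc0 hc0', fun H hH h1 h2 => ?_⟩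
  rw [hc H hH h1, hc' H hH h2, prod_exp_sign, prod_exp_sign, hcard, star_mul']
  set w : ℂ := ((Nat.card {i // 0 < n' i}) * (2 * (Real.pi / 4 * Complex.I)) -
    Fintype.card (Fin (Module.finrank ℚ K)) * (Real.pi / 4 * Complex.I)) with hw
  have h3 : star (Complex.exp w) = Complex.exp (-w) := by
    change (starRingEnd ℂ) _ = _
    rw [← Complex.exp_conj]
    congr 1
    have e2 : (starRingEnd ℂ) 2 = 2 := map_ofNat _ 2
    have e4 : (starRingEnd ℂ) 4 = 4 := map_ofNat _ 4
    simp [hw, e2, e4]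
    ring
  rw [h3]
  have h4 : star (c' : ℂ) = c' := Complex.conj_ofReal _
  rw [h4, Complex.ofReal_mul]
  have h5 : Complex.exp w * Complex.exp (-w) = 1 := by rw [← Complex.exp_add]; simp
  linear_combination (c : ℂ) * c' * h5

end Milgram

section QuadraticGauss

open AddChar

variable {R : Type*} [CommRing R]

/-- The largest ideal on which the additive character `ψ` is trivial. -/
def IsConductor (ψ : AddChar R ℂ) (I : Ideal R) : Prop :=
  ∀ x, x ∈ I ↔ ∀ r, ψ (x * r) = 1

/-- The average of `ψ (y²)` modulo `I`. -/
noncomputable def sqSum (I : Ideal R) (ψ : AddChar R ℂ) : ℂ :=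
  avg I.toAddSubgroup (fun y => ψ (y ^ 2))

theorem IsConductor.apply_eq_one {ψ : AddChar R ℂ} {I : Ideal R} (h : IsConductor ψ I) :
    ∀ x ∈ I, ψ x = 1 := fun x hx => by
  simpa using (h x).1 hx 1

theorem mulShift_eq_one {ψ : AddChar R ℂ} {I : Ideal R} (h : ∀ x ∈ I, ψ x = 1) (t : R) :
    ∀ x ∈ I, ψ.mulShift t x = 1 := fun x hx => by
  rw [mulShift_apply]; exact h _ (I.mul_mem_left t hx)

theorem periodicMod_sq {ψ : AddChar R ℂ} {I : Ideal R} (h : ∀ x ∈ I, ψ x = 1) :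
    PeriodicMod I.toAddSubgroup (fun y => ψ (y ^ 2)) := fun x y hy => by
  have h1 : (x + y) ^ 2 = x ^ 2 + (2 * x + y) * y := by ring
  simp only
  rw [h1, map_add_eq_mul, h _ (I.mul_mem_left _ hy), mul_one]

theorem sqSum_mono {ψ : AddChar R ℂ} {I J : Ideal R} (h : ∀ x ∈ I, ψ x = 1) (hJI : J ≤ I)
    [J.toAddSubgroup.FiniteIndex] : sqSum J ψ = sqSum I ψ :=
  avg_mono (by exact hJI) (periodicMod_sq h)

theorem IsConductor.mulShift {ψ : AddChar R ℂ} {I J : Ideal R} (h : IsConductor ψ I) {s : R}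
    (hJ : ∀ x, x ∈ J ↔ s * x ∈ I) : IsConductor (ψ.mulShift s) J := fun x => by
  rw [hJ, h]
  simp only [mulShift_apply, mul_assoc]

theorem sqSum_mulShift_sq {ψ : AddChar R ℂ} {I : Ideal R} [I.toAddSubgroup.FiniteIndex]
    (h : ∀ x ∈ I, ψ x = 1) {t r s : R} (hrs : r * s - 1 ∈ I) (ht : t - r ^ 2 ∈ I) :
    sqSum I (ψ.mulShift t) = sqSum I ψ := by
  rw [sqSum, sqSum, ← avg_comp (periodicMod_sq h) (AddMonoidHom.mulLeft r) (fun b => ⟨s * b, by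
    have : b - r * (s * b) = -(b * (r * s - 1)) := by ring
    change b - r * (s * b) ∈ I
    rw [this]
    exact I.neg_mem (I.mul_mem_left _ hrs)⟩)]
  have h1 : I.toAddSubgroup.comap (AddMonoidHom.mulLeft r) = I.toAddSubgroup := by
    ext x
    change r * x ∈ I ↔ x ∈ I
    refine ⟨fun hx => ?_, fun hx => I.mul_mem_left _ hx⟩
    have : x = s * (r * x) - x * (r * s - 1) := by ring
    rw [this]
    exact I.sub_mem (I.mul_mem_left _ hx) (I.mul_mem_left _ hrs)
  rw [h1]
  congr 1
  funext y
  have : t * y ^ 2 = (r * y) ^ 2 + y ^ 2 * (t - r ^ 2) := by ring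
  simp only [Function.comp, AddMonoidHom.coe_mulLeft]
  rw [mulShift_apply, this, map_add_eq_mul, h _ (I.mul_mem_left _ ht), mul_one]

theorem sqSum_mul {ψ : AddChar R ℂ} {I J : Ideal R} [I.toAddSubgroup.FiniteIndex]
    [J.toAddSubgroup.FiniteIndex] (h : ∀ x ∈ I * J, ψ x = 1) {e₁ e₂ : R} (he₁ : e₁ ∈ I)
    (he₂ : e₂ ∈ J) (he : e₁ + e₂ = 1) :
    sqSum (I * J) ψ = sqSum I (ψ.mulShift e₂) * sqSum J (ψ.mulShift e₁) := by
  have hIJ : I ⊔ J = ⊤ := by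
    rw [Ideal.eq_top_iff_one, ← he]
    exact Ideal.add_mem _ (Ideal.mem_sup_left he₁) (Ideal.mem_sup_right he₂)
  rw [sqSum, sqSum, sqSum, ← avg_mul_of_coprime]
  · rw [Ideal.mul_eq_inf_of_coprime hIJ]
    change avg (I.toAddSubgroup ⊓ J.toAddSubgroup) _ = _
    congr 1
    funext y
    rw [mulShift_apply, mulShift_apply, ← map_add_eq_mul, ← add_mul, add_comm e₂, he, one_mul]
  · exact periodicMod_sq fun x hx => h (e₂ * x)
      (by rw [mul_comm e₂]; exact Ideal.mul_mem_mul hx he₂)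
  · exact periodicMod_sq fun x hx => h _ (Ideal.mul_mem_mul he₁ hx)
  · intro x
    refine ⟨e₁ * x, I.mul_mem_right _ he₁, ?_⟩
    have : x - e₁ * x = e₂ * x := by linear_combination (-x) * he
    rw [this]
    exact J.mul_mem_right _ he₂

theorem IsConductor.left_of_mul {ψ : AddChar R ℂ} {I J : Ideal R} (h : IsConductor ψ (I * J))
    {e₁ e₂ : R} (he₁ : e₁ ∈ I) (he₂ : e₂ ∈ J) (he : e₁ + e₂ = 1) :
    IsConductor (ψ.mulShift e₂) I := by
  refine h.mulShift fun x => ⟨fun hx => ?_, fun hx => ?_⟩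
  · rw [mul_comm e₂]; exact Ideal.mul_mem_mul hx he₂
  have : x = e₂ * x + e₁ * x := by linear_combination (-x) * he
  rw [this]
  have h1 : e₂ * x ∈ I := (Ideal.mul_le_left : I * J ≤ I) hx
  exact I.add_mem h1 (I.mul_mem_right _ he₁)

theorem sum_comp_sq {F : Type*} [Field F] [Fintype F] [DecidableEq F] (hF : ringChar F ≠ 2)
    (f : F → ℂ) : ∑ q, f (q ^ 2) = ∑ u, ((quadraticChar F u : ℂ) + 1) * f u := by
  rw [← Finset.sum_fiberwise_of_maps_to (t := Finset.univ) (g := fun q : F => q ^ 2)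
    (fun _ _ => Finset.mem_univ _)]
  refine Finset.sum_congr rfl fun u _ => ?_
  have h1 := quadraticChar_card_sqrts hF u
  rw [Finset.sum_congr rfl (g := fun _ => f u) (fun q hq => by
    rw [(Finset.mem_filter.1 hq).2]), Finset.sum_const, nsmul_eq_mul]
  congr 1
  have h2 : ({x | x ^ 2 = u} : Set F).toFinset = Finset.univ.filter (fun q => q ^ 2 = u) := by
    ext; simp
  rw [h2] at h1
  exact_mod_cast h1

theorem sum_comp_mul_sq {F : Type*} [Field F] [Fintype F] (hF : ringChar F ≠ 2)
    (f : F → ℂ) (hf : ∑ u, f u = 0) {t : F} (ht : t ≠ 0) [Decidable (IsSquare t)] :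
    ∑ q, f (t * q ^ 2) = (if IsSquare t then 1 else -1) * ∑ q, f (q ^ 2) := by
  classical
  rw [sum_comp_sq hF f, sum_comp_sq hF (fun u => f (t * u)),
    ← Equiv.sum_comp (Equiv.mulLeft₀ t ht) (fun u => ((quadraticChar F u : ℂ) + 1) * f u)]
  have h0 : ∑ u, f (t * u) = 0 := by
    rw [← hf]; exact Equiv.sum_comp (Equiv.mulLeft₀ t ht) f
  have h1 : ∀ u, Equiv.mulLeft₀ t ht u = t * u := fun _ => rfl
  simp only [h1, map_mul, Int.cast_mul, add_mul, one_mul, Finset.sum_add_distrib,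
    h0, add_zero, mul_assoc, ← Finset.mul_sum]
  split_ifs with h
  · rw [quadraticChar_one_iff_isSquare ht |>.2 h]; simp
  · rw [quadraticChar_neg_one_iff_not_isSquare.2 h]; simp

end QuadraticGauss

section PrimePower

open AddChar NumberField IsDedekindDomain

variable {K : Type*} [Field K] [NumberField K] (π : HeightOneSpectrum (𝓞 K))

theorem asIdeal_pow_ne_bot (k : ℕ) : π.asIdeal ^ k ≠ ⊥ := pow_ne_zero _ π.ne_bot

instance finiteIndex_asIdeal_pow (k : ℕ) : (π.asIdeal ^ k).toAddSubgroup.FiniteIndex :=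
  Ideal.finiteIndex (asIdeal_pow_ne_bot π k)

theorem exists_mem_pow_notMem_pow_succ (k : ℕ) :
    ∃ x, x ∈ π.asIdeal ^ k ∧ x ∉ π.asIdeal ^ (k + 1) := by
  obtain ⟨x, hx, hx'⟩ := SetLike.exists_of_lt
    (Ideal.pow_right_strictAnti π.asIdeal π.ne_bot π.isPrime.ne_top (Nat.lt_succ_self k))
  exact ⟨x, hx, hx'⟩

theorem intValuation_eq_exp_iff {x : 𝓞 K} {k : ℕ} : π.intValuation x = WithZero.exp (-(k : ℤ)) ↔
    x ∈ π.asIdeal ^ k ∧ x ∉ π.asIdeal ^ (k + 1) := by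
  rw [← π.intValuation_le_pow_iff_mem, ← π.intValuation_le_pow_iff_mem, not_le]
  constructor
  · intro h
    rw [h]
    refine ⟨le_rfl, WithZero.exp_lt_exp.2 (by push_cast; omega)⟩
  · rintro ⟨h1, h2⟩
    refine le_antisymm h1 ?_
    have h0 : π.intValuation x ≠ 0 := (zero_le.trans_lt h2).ne'
    rw [← WithZero.exp_log h0] at h2 ⊢
    rw [WithZero.exp_lt_exp] at h2
    rw [WithZero.exp_le_exp]
    push_cast at h2
    omega

theorem mul_mem_pow_add_iff {s x : 𝓞 K} {m j : ℕ} (hs : s ∈ π.asIdeal ^ m)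
    (hs' : s ∉ π.asIdeal ^ (m + 1)) : s * x ∈ π.asIdeal ^ (m + j) ↔ x ∈ π.asIdeal ^ j := by
  rw [← π.intValuation_le_pow_iff_mem, ← π.intValuation_le_pow_iff_mem, map_mul,
    (intValuation_eq_exp_iff π).2 ⟨hs, hs'⟩, Nat.cast_add, neg_add, WithZero.exp_add]
  exact mul_le_mul_iff_of_pos_left (WithZero.exp_pos)

theorem IsConductor.mulShift_pow {ψ : AddChar (𝓞 K) ℂ} {m j : ℕ}
    (h : IsConductor ψ (π.asIdeal ^ (m + j))) {s : 𝓞 K} (hs : s ∈ π.asIdeal ^ m)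
    (hs' : s ∉ π.asIdeal ^ (m + 1)) : IsConductor (ψ.mulShift s) (π.asIdeal ^ j) :=
  h.mulShift fun _ => (mul_mem_pow_add_iff π hs hs').symm

theorem sqSum_mulShift_prime (h2 : (2 : 𝓞 K) ∉ π.asIdeal) {t : 𝓞 K} (ht : t ∉ π.asIdeal)
    [Decidable (IsSquare (Ideal.Quotient.mk π.asIdeal t))] {ψ : AddChar (𝓞 K) ℂ}
    (hψ : IsConductor ψ π.asIdeal) :
    sqSum π.asIdeal (ψ.mulShift t) =
      (if IsSquare (Ideal.Quotient.mk π.asIdeal t) then 1 else -1) * sqSum π.asIdeal ψ := by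
  have := π.isMaximal
  let _ := Ideal.Quotient.field π.asIdeal
  have hfin : Finite (𝓞 K ⧸ π.asIdeal) := Ideal.finiteQuotientOfFreeOfNeBot _ π.ne_bot
  have := Fintype.ofFinite (𝓞 K ⧸ π.asIdeal)
  let f : 𝓞 K ⧸ π.asIdeal → ℂ := fun q => ψ q.out
  have hf : ∀ x, f (Ideal.Quotient.mk π.asIdeal x) = ψ x := fun x => by
    have h1 : (Ideal.Quotient.mk π.asIdeal x).out - x ∈ π.asIdeal :=
      Ideal.Quotient.eq.1 (Quotient.out_eq' _)
    change ψ (Ideal.Quotient.mk π.asIdeal x).out = ψ x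
    rw [← sub_add_cancel (Ideal.Quotient.mk π.asIdeal x).out x, map_add_eq_mul,
      hψ.apply_eq_one _ h1, one_mul]
  have hsum : ∑ u, f u = 0 := by
    have h1 : ∃ r, ψ r ≠ 1 := by
      by_contra! h
      exact π.isPrime.ne_top ((Ideal.eq_top_iff_one _).2 ((hψ 1).2 fun r => h _))
    obtain ⟨r, hr⟩ := h1
    have h3 : ∑ u, f u = ψ r * ∑ u, f u := by
      rw [Finset.mul_sum, ← Equiv.sum_comp (Equiv.addLeft (Ideal.Quotient.mk π.asIdeal r))]
      refine Finset.sum_congr rfl fun u _ => ?_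
      obtain ⟨u, rfl⟩ := Ideal.Quotient.mk_surjective u
      change f (Ideal.Quotient.mk π.asIdeal r + Ideal.Quotient.mk π.asIdeal u) = _
      rw [← map_add, hf, hf, map_add_eq_mul]
    have h4 : (ψ r - 1) * ∑ u, f u = 0 := by linear_combination -h3
    exact (mul_eq_zero.1 h4).resolve_left (sub_ne_zero.2 hr)
  have hchar : ringChar (𝓞 K ⧸ π.asIdeal) ≠ 2 := fun h => by
    apply h2
    rw [← Ideal.Quotient.eq_zero_iff_mem, map_ofNat]
    have := ringChar.Nat.cast_ringChar (R := 𝓞 K ⧸ π.asIdeal)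
    rw [h] at this
    exact_mod_cast this
  have ht0 : Ideal.Quotient.mk π.asIdeal t ≠ 0 := by
    rwa [Ne, Ideal.Quotient.eq_zero_iff_mem]
  have havg : ∀ s : 𝓞 K, sqSum π.asIdeal (ψ.mulShift s) =
      (Fintype.card (𝓞 K ⧸ π.asIdeal) : ℂ)⁻¹ * ∑ q, f (Ideal.Quotient.mk π.asIdeal s * q ^ 2) := by
    intro s
    rw [sqSum, avg_eq_of_bijective (periodicMod_sq (mulShift_eq_one hψ.apply_eq_one s))
      (fun q : 𝓞 K ⧸ π.asIdeal => q.out) (by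
        have hmk : ∀ q : 𝓞 K ⧸ π.asIdeal, Ideal.Quotient.mk π.asIdeal q.out = q :=
          fun q => Quotient.out_eq' _
        refine ⟨fun p q hpq => ?_, fun q => ?_⟩
        · rw [← hmk p, ← hmk q, eq_comm, Ideal.Quotient.eq, sub_eq_neg_add]
          exact QuotientAddGroup.eq.1 hpq
        · obtain ⟨x, rfl⟩ := QuotientAddGroup.mk_surjective q
          refine ⟨Ideal.Quotient.mk π.asIdeal x, QuotientAddGroup.eq.2 ?_⟩
          rw [neg_add_eq_sub]
          exact Ideal.Quotient.eq.1 (hmk _).symm)]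
    congr 1
    refine Finset.sum_congr rfl fun q _ => ?_
    have h1 : q = Ideal.Quotient.mk π.asIdeal q.out := (Quotient.out_eq' _).symm
    conv_rhs => rw [h1]
    rw [← map_pow, ← map_mul, hf, mulShift_apply]
  have h1 := havg 1
  have h5 : ψ.mulShift 1 = ψ := by ext; simp
  rw [h5] at h1
  rw [havg, h1, sum_comp_mul_sq hchar f hsum ht0]
  simp only [map_one, one_mul]
  ring

end PrimePower

section PrimePower

open AddChar NumberField IsDedekindDomain

variable {K : Type*} [Field K] [NumberField K] (π : HeightOneSpectrum (𝓞 K))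

theorem sqSum_pow_add_two (h2 : (2 : 𝓞 K) ∉ π.asIdeal) {k : ℕ} {ψ : AddChar (𝓞 K) ℂ}
    (hψ : IsConductor ψ (π.asIdeal ^ (k + 2))) {ϖ : 𝓞 K} (hϖ : ϖ ∈ π.asIdeal)
    (hϖ' : ϖ ∉ π.asIdeal ^ 2) {t : 𝓞 K} (ht : t ∉ π.asIdeal) :
    sqSum (π.asIdeal ^ (k + 2)) (ψ.mulShift t) =
      (π.asIdeal.toAddSubgroup.index : ℂ)⁻¹ *
        sqSum (π.asIdeal ^ k) ((ψ.mulShift (ϖ ^ 2)).mulShift t) := by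
  have hϖ1 : ∀ {x j}, ϖ * x ∈ π.asIdeal ^ (1 + j) ↔ x ∈ π.asIdeal ^ j := fun {x j} =>
    mul_mem_pow_add_iff π (by simpa using hϖ) hϖ'
  have hψt : ∀ x ∈ π.asIdeal ^ (k + 2), ψ.mulShift t x = 1 := mulShift_eq_one hψ.apply_eq_one t
  have hle : π.asIdeal ^ (k + 2) ≤ π.asIdeal := Ideal.pow_le_self (by omega)
  obtain ⟨l₀, hl₀, hl₀'⟩ := exists_mem_pow_notMem_pow_succ π (k + 1)
  have key := avg_eq_of_char (H := (π.asIdeal ^ (k + 2)).toAddSubgroup)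
    (L := (π.asIdeal ^ (k + 1)).toAddSubgroup) (D := π.asIdeal.toAddSubgroup) hle
    (periodicMod_sq hψt) (fun x => ψ.mulShift (t * (2 * x)))
    (fun x l hl => by
      have h1 : t * (x + l) ^ 2 = t * x ^ 2 + t * (2 * x) * l + t * (l * l) := by ring
      have h3 : l * l ∈ π.asIdeal ^ (k + 2) := by
        have h4 : l * l ∈ π.asIdeal ^ (k + 1) * π.asIdeal ^ (k + 1) := Ideal.mul_mem_mul hl hl
        rw [← pow_add] at h4
        exact Ideal.pow_le_pow_right (by omega) h4
      simp only [mulShift_apply]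
      rw [h1, map_add_eq_mul, map_add_eq_mul, hψ.apply_eq_one _ (Ideal.mul_mem_left _ _ h3),
        mul_one])
    (fun x h hh => by
      rw [mulShift_apply]
      exact hψ.apply_eq_one _ (Ideal.mul_mem_left _ _ hh))
    (fun x => by
      constructor
      · intro hx l hl
        have h3 : l * x ∈ π.asIdeal ^ (k + 1) * π.asIdeal := Ideal.mul_mem_mul hl hx
        rw [← pow_succ] at h3
        rw [mulShift_apply, show t * (2 * x) * l = (t * 2) * (l * x) by ring]
        exact hψ.apply_eq_one _ (Ideal.mul_mem_left _ _ h3)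
      · intro h
        have h3 : (t * 2 * x) * l₀ ∈ π.asIdeal ^ (k + 2) := by
          rw [hψ]
          intro r
          have := h (l₀ * r) (Ideal.mul_mem_right _ _ hl₀)
          rwa [mulShift_apply, show t * (2 * x) * (l₀ * r) = t * 2 * x * l₀ * r by ring] at this
        rw [mul_comm, show k + 2 = (k + 1) + 1 from rfl, mul_mem_pow_add_iff π hl₀ hl₀',
          pow_one] at h3
        have := π.isPrime
        exact ((this.mem_or_mem h3).resolve_left
          (fun h4 => (this.mem_or_mem h4).elim ht h2)))
  rw [sqSum, key]
  congr 1
  let φ : 𝓞 K →+ π.asIdeal.toAddSubgroup :=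
    (AddMonoidHom.mulLeft ϖ).codRestrict _ (fun x => Ideal.mul_mem_right _ _ hϖ)
  have hper : PeriodicMod ((π.asIdeal ^ (k + 2)).toAddSubgroup.addSubgroupOf
      π.asIdeal.toAddSubgroup) (fun x : π.asIdeal.toAddSubgroup =>
        ψ.mulShift t ((x : 𝓞 K) ^ 2)) :=
    fun x h hh => periodicMod_sq hψt x h hh
  have hsup : ∀ b ∈ π.asIdeal, ∃ a, b - ϖ * a ∈ π.asIdeal ^ (k + 2) := by
    intro b hb
    have hind : ∀ n, ∃ a, b - ϖ * a ∈ π.asIdeal ^ (n + 1) := by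
      intro n
      induction n with
      | zero => exact ⟨0, by simpa using hb⟩
      | succ n ih =>
        obtain ⟨a, ha⟩ := ih
        obtain ⟨s, hs, hs'⟩ := exists_mem_pow_notMem_pow_succ π n
        rw [← hϖ1, add_comm 1 n] at hs
        rw [← hϖ1, add_comm 1 (n + 1)] at hs'
        have := π.isPrime
        obtain ⟨d, e, he, hde⟩ := Ideal.exists_mul_add_mem_pow_succ π.ne_bot _ _ hs hs' ha
        refine ⟨a + s * d, ?_⟩
        convert he using 1
        linear_combination -hde
    exact hind (k + 1)
  rw [← avg_comp hper φ (fun b => by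
    obtain ⟨a, ha⟩ := hsup b b.2
    exact ⟨a, ha⟩)]
  have hcomap : ((π.asIdeal ^ (k + 2)).toAddSubgroup.addSubgroupOf
      π.asIdeal.toAddSubgroup).comap φ = (π.asIdeal ^ (k + 1)).toAddSubgroup := by
    ext x
    change ϖ * x ∈ π.asIdeal ^ (k + 2) ↔ x ∈ π.asIdeal ^ (k + 1)
    rw [show k + 2 = 1 + (k + 1) by omega, hϖ1]
  rw [hcomap]
  have htriv : ∀ x ∈ π.asIdeal ^ k, (ψ.mulShift (ϖ ^ 2)).mulShift t x = 1 := fun x hx => by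
    rw [mulShift_apply, mulShift_apply]
    refine hψ.apply_eq_one _ ?_
    rw [show ϖ ^ 2 * (t * x) = ϖ * (ϖ * (t * x)) by ring, show k + 2 = 1 + (1 + k) by omega,
      hϖ1, hϖ1]
    exact Ideal.mul_mem_left _ _ hx
  rw [← sqSum_mono htriv (J := π.asIdeal ^ (k + 1)) (Ideal.pow_le_pow_right (by omega)), sqSum]
  congr 1
  funext y
  simp only [mulShift_apply, Function.comp]
  change ψ (t * (ϖ * y) ^ 2) = _
  congr 1
  ring

theorem sqSum_mulShift_pow (h2 : (2 : 𝓞 K) ∉ π.asIdeal) {t : 𝓞 K} (ht : t ∉ π.asIdeal)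
    [Decidable (IsSquare (Ideal.Quotient.mk π.asIdeal t))] (k : ℕ) (ψ : AddChar (𝓞 K) ℂ)
    (hψ : IsConductor ψ (π.asIdeal ^ k)) :
    sqSum (π.asIdeal ^ k) (ψ.mulShift t) =
      (if IsSquare (Ideal.Quotient.mk π.asIdeal t) then 1 else -1) ^ k *
        sqSum (π.asIdeal ^ k) ψ := by
  induction k using Nat.twoStepInduction generalizing ψ with
  | zero =>
    have h1 : ψ = 1 := by
      ext x; exact hψ.apply_eq_one x (by simp)
    have h3 : ψ.mulShift t = ψ := by rw [h1]; ext; simp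
    rw [h3]
    simp
  | one =>
    rw [pow_one] at hψ ⊢
    rw [sqSum_mulShift_prime π h2 ht hψ, pow_one]
  | more k ih _ =>
    obtain ⟨ϖ, hϖ, hϖ'⟩ := exists_mem_pow_notMem_pow_succ π 1
    have hϖ2 : IsConductor (ψ.mulShift (ϖ ^ 2)) (π.asIdeal ^ k) := hψ.mulShift fun x => by
      rw [sq, mul_assoc, show k + 2 = 1 + (1 + k) by omega, mul_mem_pow_add_iff π hϖ hϖ',
        mul_mem_pow_add_iff π hϖ hϖ']
    rw [pow_one] at hϖ
    have h1 : (1 : 𝓞 K) ∉ π.asIdeal := fun h =>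
      π.isPrime.ne_top ((Ideal.eq_top_iff_one _).2 h)
    have h3 := sqSum_pow_add_two π h2 hψ hϖ hϖ' h1
    have h5 : ∀ χ : AddChar (𝓞 K) ℂ, χ.mulShift 1 = χ := fun χ => by ext; simp
    rw [h5, h5] at h3
    rw [sqSum_pow_add_two π h2 hψ hϖ hϖ' ht, ih _ hϖ2, h3, pow_add]
    split_ifs <;> ring

end PrimePower

section FourSum

open AddChar NumberField IsDedekindDomain ComplexOrder

variable {K : Type*} [Field K] [NumberField K]

theorem exists_mul_sub_one_mem_pow (π : HeightOneSpectrum (𝓞 K)) {x : 𝓞 K}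
    (hx : x ∉ π.asIdeal) (n : ℕ) : ∃ s, x * s - 1 ∈ π.asIdeal ^ n := by
  obtain ⟨s, i, hi, h⟩ := Ideal.IsMaximal.exists_inv_pow π.asIdeal hx n
  refine ⟨s, ?_⟩
  have : x * s - 1 = -i := by linear_combination h
  rw [this]
  exact neg_mem hi

theorem notMem_of_sub_sq_mem_pow_succ {π : HeightOneSpectrum (𝓞 K)} {a r : 𝓞 K}
    (ha : a ∉ π.asIdeal) {m : ℕ} (h : a - r ^ 2 ∈ π.asIdeal ^ (m + 1)) : r ∉ π.asIdeal := by
  intro hr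
  refine ha ?_
  rw [← sub_add_cancel a (r ^ 2), sq r]
  exact Ideal.add_mem _ (Ideal.pow_le_self (by omega) (sq r ▸ h)) (Ideal.mul_mem_left _ _ hr)

theorem exists_sub_sq_mem_pow_succ {π : HeightOneSpectrum (𝓞 K)} (h2 : (2 : 𝓞 K) ∉ π.asIdeal)
    {a r : 𝓞 K} (ha : a ∉ π.asIdeal) {m : ℕ} (h : a - r ^ 2 ∈ π.asIdeal ^ (m + 1)) :
    ∃ t, t - r ∈ π.asIdeal ^ (m + 1) ∧ a - t ^ 2 ∈ π.asIdeal ^ (m + 1 + 1) := by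
  obtain ⟨w, hw⟩ := exists_mul_sub_one_mem_pow π (x := 2 * r)
    (fun h' => (π.isPrime.mem_or_mem h').elim h2 (notMem_of_sub_sq_mem_pow_succ ha h)) 1
  refine ⟨r + w * (a - r ^ 2), ?_, ?_⟩
  · rw [add_sub_cancel_left]
    exact Ideal.mul_mem_left _ _ h
  have h3 : a - (r + w * (a - r ^ 2)) ^ 2 =
      -((a - r ^ 2) * (2 * r * w - 1)) - w ^ 2 * ((a - r ^ 2) * (a - r ^ 2)) := by ring
  rw [h3, pow_succ _ (m + 1)]
  rw [pow_one] at hw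
  exact Ideal.sub_mem _ (neg_mem (Ideal.mul_mem_mul h hw))
    (Ideal.mul_mem_left _ _ (Ideal.mul_mem_mul h (Ideal.pow_le_self (by omega) h)))

theorem exists_seq_sub_sq_mem_pow {π : HeightOneSpectrum (𝓞 K)} (h2 : (2 : 𝓞 K) ∉ π.asIdeal)
    {a : 𝓞 K} (ha : a ∉ π.asIdeal) (hs : IsSquare (Ideal.Quotient.mk π.asIdeal a)) :
    ∃ r : ℕ → 𝓞 K, ∀ m, r (m + 1) - r m ∈ π.asIdeal ^ (m + 1) ∧
      a - r m ^ 2 ∈ π.asIdeal ^ (m + 1) := by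
  obtain ⟨q, hq⟩ := hs
  obtain ⟨r₀, rfl⟩ := Ideal.Quotient.mk_surjective q
  have h0 : a - r₀ ^ 2 ∈ π.asIdeal ^ (0 + 1) := by
    rw [zero_add, pow_one, sq]
    exact Ideal.Quotient.eq.1 (by rw [hq, map_mul])
  choose! F hF using fun (m : ℕ) (r : 𝓞 K) (h : a - r ^ 2 ∈ π.asIdeal ^ (m + 1)) =>
    exists_sub_sq_mem_pow_succ h2 ha h
  let r : ℕ → 𝓞 K := fun m => Nat.rec r₀ F m
  have hr : ∀ m, a - r m ^ 2 ∈ π.asIdeal ^ (m + 1) := fun m => by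
    induction m with
    | zero => exact h0
    | succ m ih => exact (hF m (r m) ih).2
  exact ⟨r, fun m => ⟨(hF m (r m) (hr m)).1, hr m⟩⟩

theorem exists_sub_sq_mem_pow {π : HeightOneSpectrum (𝓞 K)} (h2 : (2 : 𝓞 K) ∉ π.asIdeal)
    {a : 𝓞 K} (ha : a ∉ π.asIdeal) (hs : IsSquare (Ideal.Quotient.mk π.asIdeal a)) (n : ℕ) :
    ∃ r s, a - r ^ 2 ∈ π.asIdeal ^ n ∧ r * s - 1 ∈ π.asIdeal ^ n := by
  obtain ⟨r, hr⟩ := exists_seq_sub_sq_mem_pow h2 ha hs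
  obtain ⟨s, hs⟩ := exists_mul_sub_one_mem_pow π (notMem_of_sub_sq_mem_pow_succ ha (hr n).2) n
  exact ⟨r n, s, Ideal.pow_le_pow_right (by omega) (hr n).2, hs⟩

/-- The product `G(1) * conj G(a) * conj (G(f) * conj G(af))` of quadratic Gauss sums. -/
noncomputable def fourSum (I : Ideal (𝓞 K)) (ψ : AddChar (𝓞 K) ℂ) (a f : 𝓞 K) : ℂ :=
  sqSum I ψ * star (sqSum I (ψ.mulShift a)) *
    star (sqSum I (ψ.mulShift f) * star (sqSum I ((ψ.mulShift a).mulShift f)))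

theorem fourSum_mul {ψ : AddChar (𝓞 K) ℂ} {I J : Ideal (𝓞 K)} (hI : I ≠ ⊥) (hJ : J ≠ ⊥)
    (h : ∀ x ∈ I * J, ψ x = 1) {e₁ e₂ : 𝓞 K} (he₁ : e₁ ∈ I) (he₂ : e₂ ∈ J) (he : e₁ + e₂ = 1)
    (a f : 𝓞 K) :
    fourSum (I * J) ψ a f = fourSum I (ψ.mulShift e₂) a f * fourSum J (ψ.mulShift e₁) a f := by
  have := Ideal.finiteIndex hI
  have := Ideal.finiteIndex hJ
  have h1 := fun t => sqSum_mul (mulShift_eq_one h t) he₁ he₂ he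
  have h2 := sqSum_mul h he₁ he₂ he
  simp only [mulShift_mulShift] at h1
  simp only [fourSum, mulShift_mulShift, h1, h2, star_mul', mul_comm e₁, mul_comm e₂,
    mul_right_comm _ e₁, mul_right_comm _ e₂]
  ring

theorem fourSum_nonneg_of_eq {ψ : AddChar (𝓞 K) ℂ} {I : Ideal (𝓞 K)} {a f : 𝓞 K} {ε : ℝ}
    (h1 : sqSum I (ψ.mulShift a) = ε * sqSum I ψ)
    (h2 : sqSum I ((ψ.mulShift a).mulShift f) = ε * sqSum I (ψ.mulShift f)) :
    0 ≤ fourSum I ψ a f := by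
  have h3 : fourSum I ψ a f = (ε * sqSum I ψ * star (sqSum I ψ)) *
      (ε * sqSum I (ψ.mulShift f) * star (sqSum I (ψ.mulShift f))) := by
    rw [fourSum, h1, h2]
    simp only [star_mul', star_star]
    have : star (ε : ℂ) = ε := Complex.conj_ofReal _
    rw [this]
    ring
  have h4 : fourSum I ψ a f = (ε ^ 2 * Complex.normSq (sqSum I ψ) *
      Complex.normSq (sqSum I (ψ.mulShift f)) : ℝ) := by
    rw [h3]
    have := Complex.mul_conj (sqSum I ψ)
    have h5 := Complex.mul_conj (sqSum I (ψ.mulShift f))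
    change _ * star _ = _ at this
    change _ * star _ = _ at h5
    push_cast
    rw [← this, ← h5]
    ring
  rw [h4]
  exact Complex.zero_le_real.2 (mul_nonneg (mul_nonneg (sq_nonneg _) (Complex.normSq_nonneg _))
    (Complex.normSq_nonneg _))

/-- Conditions at a prime containing the conductor `I` which force `fourSum I ψ a f ≥ 0`. -/
def FourSumCondition (π : HeightOneSpectrum (𝓞 K)) (I : Ideal (𝓞 K)) (a f : 𝓞 K) : Prop :=
  (∀ n : ℕ, ∃ r s, a - r ^ 2 ∈ π.asIdeal ^ n ∧ r * s - 1 ∈ π.asIdeal ^ n) ∨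
  ((2 : 𝓞 K) ∉ π.asIdeal ∧ a ∉ π.asIdeal ∧ (IsSquare (Ideal.Quotient.mk π.asIdeal a) ∨
    ∃ m, Even m ∧ f ∈ π.asIdeal ^ m ∧ f ∉ π.asIdeal ^ (m + 1) ∧ I ≤ π.asIdeal ^ m))

theorem fourSum_nonneg_of_top {ψ : AddChar (𝓞 K) ℂ} (h : IsConductor ψ ⊤) (a f : 𝓞 K) :
    0 ≤ fourSum ⊤ ψ a f := by
  have h1 : ψ = 1 := by ext x; exact h.apply_eq_one x (by simp)
  have h2 : ∀ t, ψ.mulShift t = ψ := fun t => by rw [h1]; ext; simp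
  exact fourSum_nonneg_of_eq (ε := 1) (by simp [h2]) (by simp [h2])

theorem fourSum_nonneg_of_pow {π : HeightOneSpectrum (𝓞 K)} {k : ℕ} {ψ : AddChar (𝓞 K) ℂ}
    (h : IsConductor ψ (π.asIdeal ^ k)) {a f : 𝓞 K}
    (hc : FourSumCondition π (π.asIdeal ^ k) a f) : 0 ≤ fourSum (π.asIdeal ^ k) ψ a f := by
  classical
  have hcomm : (ψ.mulShift a).mulShift f = (ψ.mulShift f).mulShift a := by
    rw [mulShift_mulShift, mulShift_mulShift, mul_comm]
  have hc : (∀ n : ℕ, ∃ r s, a - r ^ 2 ∈ π.asIdeal ^ n ∧ r * s - 1 ∈ π.asIdeal ^ n) ∨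
      ((2 : 𝓞 K) ∉ π.asIdeal ∧ a ∉ π.asIdeal ∧ ¬ IsSquare (Ideal.Quotient.mk π.asIdeal a) ∧
      ∃ m, Even m ∧ f ∈ π.asIdeal ^ m ∧ f ∉ π.asIdeal ^ (m + 1) ∧
        π.asIdeal ^ k ≤ π.asIdeal ^ m) := by
    by_cases hs : IsSquare (Ideal.Quotient.mk π.asIdeal a)
    · exact Or.inl (hc.elim id fun h => exists_sub_sq_mem_pow h.1 h.2.1 hs)
    · exact hc.imp_right fun h => ⟨h.1, h.2.1, hs, h.2.2.resolve_left hs⟩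
  rcases hc with hc | ⟨h2, ha, hs, hc⟩
  · obtain ⟨r, s, hr, hrs⟩ := hc k
    refine fourSum_nonneg_of_eq (ε := 1) ?_ ?_
    · rw [sqSum_mulShift_sq h.apply_eq_one hrs hr]; simp
    · rw [hcomm, sqSum_mulShift_sq (mulShift_eq_one h.apply_eq_one f) hrs hr]; simp
  · obtain ⟨m, hm, hf, hf', hle⟩ := hc
    have hmk : m ≤ k := by
      by_contra! hlt
      obtain ⟨x, hx, hx'⟩ := exists_mem_pow_notMem_pow_succ π k
      exact hx' (Ideal.pow_le_pow_right hlt (hle hx))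
    obtain ⟨j, rfl⟩ := Nat.exists_eq_add_of_le hmk
    have hψf : IsConductor (ψ.mulShift f) (π.asIdeal ^ j) := h.mulShift_pow π hf hf'
    have hle : π.asIdeal ^ (m + j) ≤ π.asIdeal ^ j := Ideal.pow_le_pow_right (by omega)
    refine fourSum_nonneg_of_eq (ε := (-1) ^ j) ?_ ?_
    · rw [sqSum_mulShift_pow π h2 ha _ _ h, if_neg hs, pow_add, hm.neg_one_pow]
      push_cast
      ring
    · rw [hcomm, sqSum_mono (mulShift_eq_one hψf.apply_eq_one a) hle,
        sqSum_mono hψf.apply_eq_one hle, sqSum_mulShift_pow π h2 ha _ _ hψf, if_neg hs]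
      push_cast
      ring

theorem fourSum_nonneg (I : Ideal (𝓞 K)) (hI : I ≠ ⊥) {a f : 𝓞 K}
    (hc : ∀ π : HeightOneSpectrum (𝓞 K), I ≤ π.asIdeal → FourSumCondition π I a f) :
    ∀ ψ, IsConductor ψ I → 0 ≤ fourSum I ψ a f := by
  induction I using UniqueFactorizationMonoid.induction_on_coprime with
  | h0 => exact absurd rfl hI
  | h1 hx =>
    rw [Ideal.isUnit_iff.1 hx]
    exact fun ψ h => fourSum_nonneg_of_top h a f
  | @hpr p i hp =>
    intro ψ h
    let π : HeightOneSpectrum (𝓞 K) := ⟨p, Ideal.isPrime_of_prime hp, hp.ne_zero⟩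
    rcases Nat.eq_zero_or_pos i with rfl | hi
    · rw [pow_zero, Ideal.one_eq_top] at h ⊢
      exact fourSum_nonneg_of_top h a f
    · exact fourSum_nonneg_of_pow (π := π) h (hc π (Ideal.pow_le_self hi.ne'))
  | @hcp x y hxy ihx ihy =>
    intro ψ h
    have hx : x ≠ ⊥ := fun h => hI (by simp [h])
    have hy : y ≠ ⊥ := fun h => hI (by simp [h])
    have hsup : x ⊔ y = ⊤ := Ideal.isUnit_iff.1
      (hxy (Ideal.dvd_iff_le.2 le_sup_left) (Ideal.dvd_iff_le.2 le_sup_right))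
    obtain ⟨e₁, he₁, e₂, he₂, he⟩ := Submodule.mem_sup.1 ((Ideal.eq_top_iff_one _).1 hsup)
    have hcond : ∀ {x y : Ideal (𝓞 K)}, x ⊔ y = ⊤ → (∀ π : HeightOneSpectrum (𝓞 K),
        x * y ≤ π.asIdeal → FourSumCondition π (x * y) a f) → ∀ π : HeightOneSpectrum (𝓞 K),
        x ≤ π.asIdeal → FourSumCondition π x a f := by
      intro x y hsup hc π hπ
      refine (hc π (Ideal.mul_le_left.trans hπ)).imp_right (And.imp_right (And.imp_right
        (Or.imp_right ?_)))
      rintro ⟨m, hm, hf, hf', hle⟩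
      refine ⟨m, hm, hf, hf', ?_⟩
      rw [← Ideal.dvd_iff_le] at hle ⊢
      refine π.prime.pow_dvd_of_dvd_mul_right m (fun hy => ?_) hle
      exact π.isPrime.ne_top (top_le_iff.1 (hsup ▸ sup_le hπ (Ideal.dvd_iff_le.1 hy)))
    rw [fourSum_mul hx hy h.apply_eq_one he₁ he₂ he]
    refine mul_nonneg (ihx hx (hcond hsup hc) _ (h.left_of_mul he₁ he₂ he))
      (ihy hy (hcond (sup_comm x y ▸ hsup) (mul_comm x y ▸ hc)) _ ?_)
    rw [mul_comm] at h
    rw [add_comm] at he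
    exact h.left_of_mul he₂ he₁ he

theorem fourSum_nonpos {π : HeightOneSpectrum (𝓞 K)} {k : ℕ} {ψ : AddChar (𝓞 K) ℂ}
    (h : IsConductor ψ (π.asIdeal ^ (1 + k))) (h2 : (2 : 𝓞 K) ∉ π.asIdeal) {a f : 𝓞 K}
    (ha : a ∈ π.asIdeal) (ha' : a ∉ π.asIdeal ^ 2) (hf : f ∉ π.asIdeal)
    (hfs : ¬ IsSquare (Ideal.Quotient.mk π.asIdeal f)) :
    fourSum (π.asIdeal ^ (1 + k)) ψ a f ≤ 0 := by
  classical
  have hψa : IsConductor (ψ.mulShift a) (π.asIdeal ^ k) :=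
    h.mulShift_pow π (by simpa using ha) ha'
  have hle : π.asIdeal ^ (1 + k) ≤ π.asIdeal ^ k := Ideal.pow_le_pow_right (by omega)
  rw [fourSum, sqSum_mulShift_pow π h2 hf _ _ h, if_neg hfs,
    sqSum_mono (mulShift_eq_one hψa.apply_eq_one f) hle,
    sqSum_mono hψa.apply_eq_one hle, sqSum_mulShift_pow π h2 hf _ _ hψa, if_neg hfs]
  set x := sqSum (π.asIdeal ^ (1 + k)) ψ
  set y := sqSum (π.asIdeal ^ k) (ψ.mulShift a)
  have h3 : x * star y * star ((-1) ^ (1 + k) * x * star ((-1) ^ k * y)) =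
      -((Complex.normSq x * Complex.normSq y : ℝ) : ℂ) := by
    have h4 := Complex.mul_conj x
    have h5 := Complex.mul_conj y
    change _ * star _ = _ at h4
    change _ * star _ = _ at h5
    have h6 : star ((-1 : ℂ)) = -1 := by simp
    have h7 : ((-1 : ℂ) ^ k) * (-1) ^ k = 1 := by rw [← mul_pow]; simp
    push_cast
    rw [← h4, ← h5]
    simp only [star_mul', star_star, star_pow, h6, pow_add, pow_one]
    linear_combination (-x * star y * star x * y) * h7
  rw [h3, neg_nonpos]
  exact Complex.zero_le_real.2 (mul_nonneg (Complex.normSq_nonneg _) (Complex.normSq_nonneg _))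

end FourSum

section Reciprocity

open AddChar NumberField IsDedekindDomain ComplexOrder nonZeroDivisors

variable {K : Type*} [Field K] [NumberField K]

/-- The additive character `x ↦ exp (2πi Tr (μ x))` of the ring of integers. -/
noncomputable def traceChar (μ : K) : AddChar (𝓞 K) ℂ :=
  ratChar.compAddMonoidHom ((Algebra.trace ℚ K).toAddMonoidHom.comp
    ((AddMonoidHom.mulLeft μ).comp (algebraMap (𝓞 K) K).toAddMonoidHom))

theorem traceChar_apply (μ : K) (x : 𝓞 K) :
    traceChar μ x = ratChar (Algebra.trace ℚ K (μ * (x : K))) := rfl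

theorem traceChar_mulShift (μ : K) (t : 𝓞 K) :
    (traceChar μ).mulShift t = traceChar ((t : K) * μ) := by
  ext x
  rw [mulShift_apply, traceChar_apply, traceChar_apply]
  congr 2
  push_cast
  ring

theorem sqSum_traceChar (μ : K) (I : Ideal (𝓞 K)) :
    sqSum I (traceChar μ) = avg I.toAddSubgroup (traceSq μ) := by
  rw [sqSum]
  congr 1

theorem exists_isConductor (ψ : AddChar (𝓞 K) ℂ) : ∃ I, IsConductor ψ I :=
  ⟨{ carrier := {x | ∀ r, ψ (x * r) = 1}
     add_mem' := fun {x y} hx hy r => by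
      simp only [Set.mem_ofPred_eq] at hx hy
      rw [add_mul, map_add_eq_mul, hx, hy, one_mul]
     zero_mem' := fun r => by simp
     smul_mem' := fun c x hx r => by
      simp only [Set.mem_ofPred_eq] at hx
      rw [smul_eq_mul, mul_comm c, mul_assoc, hx] }, fun x => Iff.rfl⟩

theorem exists_mul_dual_integral :
    ∃ N : 𝓞 K, N ≠ 0 ∧ ∀ w ∈ FractionalIdeal.dual ℤ ℚ (1 : FractionalIdeal (𝓞 K)⁰ K),
      ∃ r : 𝓞 K, (r : K) = N * w := by
  obtain ⟨N, hN, h⟩ := FractionalIdeal.isFractional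
    (FractionalIdeal.dual ℤ ℚ (1 : FractionalIdeal (𝓞 K)⁰ K))
  refine ⟨N, nonZeroDivisors.ne_zero hN, fun w hw => ?_⟩
  obtain ⟨r, hr⟩ := h w hw
  exact ⟨r, hr.trans (Algebra.smul_def _ _)⟩

theorem fourSum_traceChar_pos {a f : 𝓞 K} {μ : K} (ha : ∀ σ : K →+* ℝ, 0 < σ a) (ha0 : a ≠ 0)
    (hf0 : f ≠ 0) (hμ0 : μ ≠ 0) (h1 : ContainsCodifferent μ)
    (h2 : ContainsCodifferent ((a : K) * μ)) (h3 : ContainsCodifferent ((f : K) * μ))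
    (h4 : ContainsCodifferent ((a : K) * ((f : K) * μ))) {I : Ideal (𝓞 K)} (hI0 : I ≠ ⊥)
    (hI : IsConductor (traceChar μ) I) : 0 < fourSum I (traceChar μ) a f := by
  have ha0' : (a : K) ≠ 0 := by exact_mod_cast ha0
  have hf0' : (f : K) ≠ 0 := by exact_mod_cast hf0
  obtain ⟨c, hc, h⟩ := avg_traceSq_mul_star_pos ha ha0' hμ0 h1 h2
  obtain ⟨c', hc', h'⟩ := avg_traceSq_mul_star_pos ha ha0' (mul_ne_zero hf0' hμ0) h3 h4
  have hfin := Ideal.finiteIndex hI0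
  have hp : ∀ ν : 𝓞 K, PeriodicMod I.toAddSubgroup (traceSq ((ν : K) * μ)) := by
    intro ν
    have := periodicMod_sq (mulShift_eq_one hI.apply_eq_one ν)
    rw [traceChar_mulShift] at this
    exact this
  have h5 := h I.toAddSubgroup hfin (by simpa using hp 1) (hp a)
  have h6 := h' I.toAddSubgroup hfin (hp f) (by
    have := hp (a * f)
    push_cast at this
    rwa [mul_assoc] at this)
  rw [fourSum, traceChar_mulShift, traceChar_mulShift, traceChar_mulShift, mul_left_comm,
    sqSum_traceChar, sqSum_traceChar, sqSum_traceChar, sqSum_traceChar, h5, h6]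
  have h7 : star (c' : ℂ) = c' := Complex.conj_ofReal _
  rw [h7, ← Complex.ofReal_mul]
  exact_mod_cast mul_pos hc hc'

/-- A consequence of quadratic reciprocity over a number field. -/
theorem isSquare_mod_of_forall_even {va : HeightOneSpectrum (𝓞 K)} {a f : 𝓞 K}
    (hva : va.asIdeal = Ideal.span {a}) (h2 : (2 : 𝓞 K) ∉ va.asIdeal)
    (ha : ∀ σ : K →+* ℝ, 0 < σ a)
    (hdy : ∀ π : HeightOneSpectrum (𝓞 K), (2 : 𝓞 K) ∈ π.asIdeal →
      ∀ n : ℕ, ∃ r s, a - r ^ 2 ∈ π.asIdeal ^ n ∧ r * s - 1 ∈ π.asIdeal ^ n)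
    (hf0 : f ≠ 0) (hf : f ∉ va.asIdeal)
    (hev : ∀ π : HeightOneSpectrum (𝓞 K), π ≠ va → (2 : 𝓞 K) ∉ π.asIdeal →
      ¬ IsSquare (Ideal.Quotient.mk π.asIdeal a) →
      ∃ m, Even m ∧ f ∈ π.asIdeal ^ m ∧ f ∉ π.asIdeal ^ (m + 1)) :
    IsSquare (Ideal.Quotient.mk va.asIdeal f) := by
  by_contra hfs
  have ha0 : a ≠ 0 := by
    rintro rfl
    exact va.ne_bot (by rw [hva]; simp)
  have ha1 : a ∈ va.asIdeal := by rw [hva]; exact Ideal.mem_span_singleton_self a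
  have ha2 : a ∉ va.asIdeal ^ 2 := by
    intro h
    obtain ⟨x, hx, hx'⟩ := exists_mem_pow_notMem_pow_succ va 1
    rw [pow_one, hva, Ideal.mem_span_singleton] at hx
    obtain ⟨y, rfl⟩ := hx
    exact hx' (Ideal.mul_mem_right _ _ h)
  have ha0' : (a : K) ≠ 0 := by exact_mod_cast ha0
  have hf0' : (f : K) ≠ 0 := by exact_mod_cast hf0
  obtain ⟨N, hN0, hN⟩ := exists_mul_dual_integral (K := K)
  have hN0' : (N : K) ≠ 0 := by exact_mod_cast hN0
  set μ : K := (4 * a * f * N)⁻¹ with hμ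
  have hμ0 : μ ≠ 0 := by simp [hμ, ha0, hf0, hN0]
  have hcod : ∀ ν : K, (∃ s : 𝓞 K, (s : K) * ν = a * f * μ) → ContainsCodifferent ν := by
    rintro ν ⟨s, hs⟩ w hw
    obtain ⟨r, hr⟩ := hN w hw
    refine ⟨s * r, ?_⟩
    have : 4 * ν * ((s * r : 𝓞 K) : K) = 4 * (s * ν) * r := by push_cast; ring
    rw [this, hs, hr, hμ]
    field_simp
  obtain ⟨q, h4⟩ : ∃ q : 𝓞 K, (q : K) = 4 := ⟨4, map_ofNat (algebraMap (𝓞 K) K) 4⟩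
  have hq0 : q ≠ 0 := by rintro rfl; simp at h4
  obtain ⟨I, hI⟩ := exists_isConductor (traceChar μ)
  have hI0 : I ≠ ⊥ := by
    have h1 : q * a * f * N ∈ I := by
      rw [hI]
      intro r
      rw [traceChar_apply, ratChar_eq_one_iff]
      have h3 : μ * ((q * a * f * N * r : 𝓞 K) : K) = r := by
        have h5 : μ * (4 * a * f * N) = 1 := inv_mul_cancel₀ (by simp [ha0, hf0, hN0])
        push_cast
        linear_combination (r : K) * h5 + (μ * a * f * N * r) * h4
      rw [h3]
      exact ⟨Algebra.trace ℤ (𝓞 K) r, (Algebra.trace_localization ℤ (nonZeroDivisors ℤ) r)⟩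
    intro h
    rw [h, Ideal.mem_bot] at h1
    simp [ha0, hf0, hN0, hq0] at h1
  have hIaf : I ≤ Ideal.span {a * f} := by
    intro x hx
    have h1 : μ * x ∈ FractionalIdeal.dual ℤ ℚ (1 : FractionalIdeal (𝓞 K)⁰ K) := by
      rw [mem_dual_one_iff]
      intro y
      have := (hI x).1 hx y
      rw [traceChar_apply, ratChar_eq_one_iff] at this
      push_cast at this
      rwa [← mul_assoc] at this
    obtain ⟨r, hr⟩ := hcod (a * f * μ) ⟨1, by simp⟩ _ h1
    rw [Ideal.mem_span_singleton]
    refine ⟨q * r, ?_⟩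
    have h2 : (x : K) = ((a * f * (q * r) : 𝓞 K) : K) := by
      apply mul_left_cancel₀ hμ0
      rw [hr]
      push_cast
      linear_combination (-μ * a * f * r) * h4
    exact_mod_cast h2
  have hpos := fourSum_traceChar_pos ha ha0 hf0 hμ0 (hcod _ ⟨a * f, by push_cast; ring⟩)
    (hcod _ ⟨f, by ring⟩) (hcod _ ⟨a, by ring⟩) (hcod _ ⟨1, by push_cast; ring⟩) hI0 hI
  obtain ⟨k, J, hJ, rfl⟩ := WfDvdMonoid.max_power_factor' hI0 va.prime.not_isUnit
  have hJ0 : J ≠ ⊥ := right_ne_zero_of_mul hI0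
  obtain ⟨j, rfl⟩ : ∃ j, k = 1 + j := by
    refine Nat.exists_eq_add_of_le (Nat.one_le_iff_ne_zero.2 ?_)
    rintro rfl
    refine hJ (Ideal.dvd_iff_le.2 ?_)
    rw [pow_zero, one_mul] at hIaf
    refine hIaf.trans ?_
    rw [hva]
    exact (Ideal.span_singleton_le_span_singleton).2 (dvd_mul_right a f)
  have hsup : va.asIdeal ^ (1 + j) ⊔ J = ⊤ := by
    rw [← Ideal.isCoprime_iff_sup_eq]
    refine IsCoprime.pow_left ?_
    rw [Ideal.isCoprime_iff_sup_eq]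
    exact va.isMaximal.1.2 _ (left_lt_sup.2 fun h => hJ (Ideal.dvd_iff_le.2 h))
  obtain ⟨e₁, he₁, e₂, he₂, he⟩ := Submodule.mem_sup.1 ((Ideal.eq_top_iff_one _).1 hsup)
  rw [fourSum_mul (asIdeal_pow_ne_bot va _) hJ0 hI.apply_eq_one he₁ he₂ he] at hpos
  refine hpos.not_ge (mul_nonpos_of_nonpos_of_nonneg
    (fourSum_nonpos (hI.left_of_mul he₁ he₂ he) h2 ha1 ha2 hf hfs) (fourSum_nonneg J hJ0 ?_ _ ?_))
  · intro π hπ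
    by_cases h2π : (2 : 𝓞 K) ∈ π.asIdeal
    · exact Or.inl (hdy π h2π)
    have hne : π ≠ va := by
      rintro rfl
      exact hJ (Ideal.dvd_iff_le.2 hπ)
    refine Or.inr ⟨h2π, fun haπ => hne ?_, or_iff_not_imp_left.2 fun hs => ?_⟩
    · refine HeightOneSpectrum.ext (va.isMaximal.eq_of_le π.isPrime.ne_top ?_).symm
      rwa [hva, Ideal.span_singleton_le_iff_mem]
    · obtain ⟨m, hm, hfm, hfm'⟩ := hev π hne h2π hs
      refine ⟨m, hm, hfm, hfm', ?_⟩
      rw [← Ideal.dvd_iff_le]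
      refine π.prime.pow_dvd_of_dvd_mul_left m (a := va.asIdeal ^ (1 + j)) (fun h => hne ?_) ?_
      · refine HeightOneSpectrum.ext (va.isMaximal.eq_of_le π.isPrime.ne_top ?_).symm
        exact Ideal.dvd_iff_le.1 (π.prime.dvd_of_dvd_pow h)
      · rw [Ideal.dvd_iff_le]
        refine hIaf.trans ?_
        rw [Ideal.span_singleton_le_iff_mem]
        exact Ideal.mul_mem_left _ _ hfm
  · rw [mul_comm] at hI
    rw [add_comm] at he
    exact hI.left_of_mul he₂ he₁ he

end Reciprocity

section AdicSquares

open NumberField IsDedekindDomain WithZero Filter Topology MonoidWithZeroHom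

variable {K : Type*} [Field K] [NumberField K] {π : HeightOneSpectrum (𝓞 K)}

theorem intToAdicCompletion_le_iff {x : 𝓞 K} {n : ℕ} :
    Valued.v (intToAdicCompletion π x) ≤ exp (-(n : ℤ)) ↔ x ∈ π.asIdeal ^ n := by
  rw [← π.intValuation_le_pow_iff_mem, ← π.valuation_of_algebraMap (K := K)]
  have : intToAdicCompletion π x = ((algebraMap (𝓞 K) K x : K) : π.adicCompletion K) := by
    rw [intToAdicCompletion, HeightOneSpectrum.algebraMap_adicCompletion]; rfl
  rw [this, HeightOneSpectrum.adicCompletion.valued_coe]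

theorem exists_lt_exp_subset {s : Set (π.adicCompletion K)} (hs : s ∈ 𝓝 0) :
    ∃ n : ℕ, ∀ x, Valued.v x ≤ exp (-(n : ℤ)) → x ∈ s := by
  obtain ⟨γ, hγ⟩ := Valued.mem_nhds_zero.1 hs
  have h0 := ValueGroup₀.embedding_unit_ne_zero γ
  refine ⟨(1 - log (ValueGroup₀.embedding γ.1)).toNat, fun x hx => hγ ?_⟩
  rw [Set.mem_ofPred_eq, Valuation.restrict_lt_iff_lt_embedding]
  refine hx.trans_lt ?_
  generalize ValueGroup₀.embedding γ.1 = g at h0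
  rw [← exp_log h0, exp_lt_exp, log_exp]
  omega

theorem setOf_lt_exp_mem_nhds (n : ℤ) :
    {x : π.adicCompletion K | Valued.v x < exp n} ∈ 𝓝 0 := by
  obtain ⟨y, hy⟩ := HeightOneSpectrum.valuedAdicCompletion_surjective K π (exp n)
  rw [Valued.mem_nhds_zero]
  refine ⟨Units.mk0 (Valued.v.restrict y)
    (by rw [Ne, Valuation.restrict_eq_zero_iff, hy]; exact exp_ne_zero), fun x hx => ?_⟩
  simpa [← hy] using hx

theorem intToAdicCompletion_sub (x y : 𝓞 K) : intToAdicCompletion π (x - y) =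
    intToAdicCompletion π x - intToAdicCompletion π y := by
  simp [intToAdicCompletion]

theorem intToAdicCompletion_pow (x : 𝓞 K) (n : ℕ) : intToAdicCompletion π (x ^ n) =
    intToAdicCompletion π x ^ n := by
  simp [intToAdicCompletion]

theorem isSquare_adicCompletion {a : 𝓞 K} (h2 : (2 : 𝓞 K) ∉ π.asIdeal) (ha : a ∉ π.asIdeal)
    (hs : IsSquare (Ideal.Quotient.mk π.asIdeal a)) : IsSquare (intToAdicCompletion π a) := by
  obtain ⟨r, hr⟩ := exists_seq_sub_sq_mem_pow h2 ha hs
  have hle : ∀ n m, n ≤ m → r m - r n ∈ π.asIdeal ^ n := fun n m hm => by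
    induction m, hm using Nat.le_induction with
    | base => simp
    | succ m hm ih =>
      rw [← sub_add_sub_cancel _ (r m)]
      exact Ideal.add_mem _ (Ideal.pow_le_pow_right (by omega) (hr m).1) ih
  have hc : CauchySeq (fun n => intToAdicCompletion π (r n)) := by
    rw [CauchySeq, Valued.cauchy_iff]
    refine ⟨inferInstance, fun γ => ?_⟩
    obtain ⟨n, hn⟩ := exists_lt_exp_subset (π := π) (Valued.mem_nhds_zero.2 ⟨γ, subset_rfl⟩)
    refine ⟨_, image_mem_map (Ici_mem_atTop n), ?_⟩
    rintro _ ⟨p, hp, rfl⟩ _ ⟨q, hq, rfl⟩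
    refine hn _ ?_
    rw [← intToAdicCompletion_sub, intToAdicCompletion_le_iff, ← sub_sub_sub_cancel_right _ _ (r n)]
    exact Ideal.sub_mem _ (hle _ _ hq) (hle _ _ hp)
  obtain ⟨w, hw⟩ := cauchySeq_tendsto_of_complete hc
  refine ⟨w, ?_⟩
  have h1 : Tendsto (fun n => intToAdicCompletion π a - intToAdicCompletion π (r n) ^ 2) atTop
      (𝓝 (intToAdicCompletion π a - w ^ 2)) := tendsto_const_nhds.sub (hw.pow 2)
  have h3 : Tendsto (fun n => intToAdicCompletion π a - intToAdicCompletion π (r n) ^ 2) atTop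
      (𝓝 0) := by
    intro s hs
    obtain ⟨n, hn⟩ := exists_lt_exp_subset hs
    refine mem_map.2 (mem_of_superset (Ici_mem_atTop n) fun m hm => hn _ ?_)
    change Valued.v (intToAdicCompletion π a - intToAdicCompletion π (r m) ^ 2) ≤ _
    rw [← intToAdicCompletion_pow, ← intToAdicCompletion_sub, intToAdicCompletion_le_iff]
    exact Ideal.pow_le_pow_right (Nat.le_succ_of_le hm) (hr m).2
  rw [← sq]
  exact sub_eq_zero.1 (tendsto_nhds_unique h1 h3)

theorem exists_sub_sq_mem_of_isSquare {a : 𝓞 K} (h : IsSquare (intToAdicCompletion π a)) (n : ℕ) :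
    ∃ r, a - r ^ 2 ∈ π.asIdeal ^ n := by
  obtain ⟨w, hw⟩ := h
  have hw1 : Valued.v w ≤ 1 := by
    have := (intToAdicCompletion_le_iff (π := π) (x := a) (n := 0)).2 (by simp)
    rw [hw, map_mul] at this
    by_contra! h
    exact (one_lt_mul'' h h).not_ge (by simpa using this)
  have hN : (fun y => w - y) ⁻¹' {x : π.adicCompletion K | Valued.v x < exp (-(n : ℤ))} ∈ 𝓝 w := by
    refine ContinuousAt.preimage_mem_nhds (by fun_prop) ?_
    rw [sub_self]
    exact setOf_lt_exp_mem_nhds _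
  have hn1 : exp (-(n : ℤ)) ≤ (1 : ℤᵐ⁰) := by rw [← exp_zero, exp_le_exp]; omega
  obtain ⟨k, hk⟩ := (HeightOneSpectrum.denseRange_algebraMap K π).mem_nhds hN
  change Valued.v (w - algebraMap K _ k) < _ at hk
  have hv : ∀ x : K, Valued.v (algebraMap K (π.adicCompletion K) x) = π.valuation K x := fun x => by
    rw [HeightOneSpectrum.algebraMap_adicCompletion]
    exact HeightOneSpectrum.adicCompletion.valued_coe K π x
  have hk1 : π.valuation K k ≤ 1 := by
    rw [← hv, ← sub_sub_cancel w (algebraMap K _ k)]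
    exact (Valuation.map_sub _ _ _).trans (max_le hw1 (hk.le.trans hn1))
  obtain ⟨r, hr⟩ := π.exists_valuation_sub_lt_of_integer hk1 (Units.mk0 (exp (-(n : ℤ))) exp_ne_zero)
  refine ⟨r, ?_⟩
  have hwr : Valued.v (w - intToAdicCompletion π r) ≤ exp (-(n : ℤ)) := by
    rw [← sub_sub_sub_cancel_right _ _ (algebraMap K _ k)]
    refine (Valuation.map_sub _ _ _).trans (max_le hk.le ?_)
    rw [intToAdicCompletion, ← map_sub, hv]
    exact hr.le
  have hr1 : Valued.v (w + intToAdicCompletion π r) ≤ 1 := by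
    refine (Valuation.map_add _ _ _).trans (max_le hw1 ?_)
    have := (intToAdicCompletion_le_iff (π := π) (x := r) (n := 0)).2 (by simp)
    simpa using this
  rw [← intToAdicCompletion_le_iff, intToAdicCompletion_sub, intToAdicCompletion_pow, hw,
    show w * w - intToAdicCompletion π r ^ 2 =
      (w - intToAdicCompletion π r) * (w + intToAdicCompletion π r) by ring, map_mul]
  simpa using mul_le_mul' hwr hr1

end AdicSquares

section LocalAnalysis

open WithZero

/-- The form `a³σ⁴ + e(aβσ² - τ²)²`. -/
def quarticForm {F : Type*} [Field F] (a β e σ τ : F) : F :=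
  a ^ 3 * σ ^ 4 + e * (a * β * σ ^ 2 - τ ^ 2) ^ 2

/-- A point with `v = 1` on the surface with homogeneous parameter `(σ, τ)`. -/
structure IsAffinePoint {F : Type*} [Field F] (a b β c d σ τ x y z u : F) : Prop where
  eq_left : x ^ 2 - a * z ^ 2 = -(b * ((u - quarticForm a β (b * c ^ 2 * d) σ τ) *
    (u - quarticForm a β (b * c ^ 2 * d + 2 * c) σ τ)))
  eq_right : x ^ 2 - a * y ^ 2 = -(a * (a * σ ^ 2 - τ ^ 2) ^ 2 * u)

theorem isSquare_exp_iff {n : ℤ} : IsSquare (exp n : ℤᵐ⁰) ↔ Even n := by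
  constructor
  · rintro ⟨s, hs⟩
    have h0 : s ≠ 0 := by rintro rfl; simp at hs
    rw [← exp_log h0, ← exp_add, exp_inj] at hs
    exact ⟨_, hs⟩
  · rintro ⟨m, rfl⟩
    exact ⟨exp m, exp_add _ _⟩

theorem isSquare_of_mul_left {x y : ℤᵐ⁰} (hx : x ≠ 0) (h : IsSquare (x * y)) (hs : IsSquare x) :
    IsSquare y := by
  have := h.div hs
  rwa [mul_div_cancel_left₀ _ hx] at this

theorem le_exp_of_lt_exp {x : ℤᵐ⁰} {n : ℤ} (h : x < exp n) : x ≤ exp (n - 1) := by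
  obtain rfl | h0 := eq_or_ne x 0
  · exact zero_le
  · rw [← log_lt_iff_lt_exp h0] at h
    rw [← log_le_iff_le_exp h0]
    omega

variable {K : Type*} [Field K] (v : Valuation K ℤᵐ⁰) {a b β c d σ τ x y z u : K}

theorem map_sq_sub_mul_sq (ha : v a = 1) (hn : ∀ x, ¬ v (x ^ 2 - a) < 1) (x y : K) :
    v (x ^ 2 - a * y ^ 2) = max (v x) (v y) ^ 2 := by
  rcases lt_trichotomy (v x) (v y) with h | h | h
  · rw [max_eq_right h.le, v.map_sub_eq_of_lt_right] <;> simp [ha]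
    exact pow_lt_pow_left₀ h zero_le two_ne_zero
  · obtain rfl | hy := eq_or_ne y 0
    · simp [h]
    · have hy' : v y ≠ 0 := by simpa
      rw [h, max_self, show x ^ 2 - a * y ^ 2 = ((x / y) ^ 2 - a) * y ^ 2 by field_simp,
        map_mul, map_pow]
      suffices v ((x / y) ^ 2 - a) = 1 by rw [this, one_mul]
      refine le_antisymm (v.map_sub_le ?_ ha.le) (not_lt.1 (hn _))
      simp [h, hy']
  · rw [max_eq_left h.le, v.map_sub_eq_of_lt_left] <;> simp [ha]
    exact pow_lt_pow_left₀ h zero_le two_ne_zero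

theorem map_sq_sub_mul_sq_of_not_isSquare (hn : ¬ IsSquare (v a)) (x y : K) :
    v (x ^ 2 - a * y ^ 2) = max (v x ^ 2) (v a * v y ^ 2) := by
  have h0 : v a ≠ 0 := fun h => hn (h ▸ IsSquare.zero)
  by_cases h : v x = 0 ∧ v y = 0
  · have hx : x = 0 := by simpa using h.1
    have hy : y = 0 := by simpa using h.2
    simp [hx, hy]
  · have : v (x ^ 2) ≠ v (a * y ^ 2) := by
      intro he
      rw [map_mul, map_pow, map_pow] at he
      by_cases hy : v y = 0
      · exact h ⟨by simpa [hy] using he, hy⟩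
      · exact hn ⟨v x / v y, by field_simp; exact he.symm⟩
    rw [sub_eq_add_neg, v.map_add_of_distinct_val (by simpa using this)]
    simp

theorem IsAffinePoint.scale (h : IsAffinePoint a b β c d σ τ x y z u) {κ : K} (hκ : κ ≠ 0) :
    IsAffinePoint a b β c d (σ / κ) (τ / κ) (x / κ ^ 4) (y / κ ^ 4) (z / κ ^ 4) (u / κ ^ 4) := by
  obtain ⟨h1, h2⟩ := h
  constructor
  · have : (x / κ ^ 4) ^ 2 - a * (z / κ ^ 4) ^ 2 = (x ^ 2 - a * z ^ 2) / κ ^ 8 := by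
      field_simp
    rw [this, h1]
    simp only [quarticForm]
    field_simp
  · have : (x / κ ^ 4) ^ 2 - a * (y / κ ^ 4) ^ 2 = (x ^ 2 - a * y ^ 2) / κ ^ 8 := by
      field_simp
    rw [this, h2]
    field_simp

theorem quarticForm_div {e κ : K} (hκ : κ ≠ 0) :
    quarticForm a β e (σ / κ) (τ / κ) = quarticForm a β e σ τ / κ ^ 4 := by
  simp only [quarticForm]
  field_simp

theorem IsAffinePoint.false_of_lt (h : IsAffinePoint a b β c d σ τ x y z u)
    (ha : v a = 1) (hn : ∀ x, ¬ v (x ^ 2 - a) < 1) (hb : v b = 1)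
    (hC : v (a * σ ^ 2 - τ ^ 2) = 1) (hσ : v σ = 1) (hu : v (u - a ^ 3 * σ ^ 4) < 1)
    (hpq : v (u - quarticForm a β (b * c ^ 2 * d) σ τ) *
      v (u - quarticForm a β (b * c ^ 2 * d + 2 * c) σ τ) < 1) : False := by
  have h1 := congr_arg v h.eq_left
  rw [map_sq_sub_mul_sq v ha hn, v.map_neg, map_mul, map_mul, hb, one_mul] at h1
  rw [← h1] at hpq
  have hx : v x < 1 := (le_max_left _ _).trans_lt ((pow_lt_one_iff_of_nonneg zero_le two_ne_zero).1 hpq)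
  have h2 : a * (y ^ 2 - a * (a * (a * σ ^ 2 - τ ^ 2) * σ ^ 2) ^ 2) =
      x ^ 2 + a * (a * σ ^ 2 - τ ^ 2) ^ 2 * (u - a ^ 3 * σ ^ 4) := by
    linear_combination -h.eq_right
  have h3 := congr_arg v h2
  rw [map_mul, map_sq_sub_mul_sq v ha hn, ha, one_mul] at h3
  have h4 : (1 : ℤᵐ⁰) ≤ max (v y) (v (a * (a * σ ^ 2 - τ ^ 2) * σ ^ 2)) ^ 2 :=
    one_le_pow₀ (le_max_of_le_right (by simp [ha, hC, hσ]))
  rw [h3] at h4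
  refine h4.not_gt (v.map_add_lt ?_ ?_)
  · rw [map_pow]; exact pow_lt_one₀ zero_le hx two_ne_zero
  · simpa [ha, hC] using hu

/-- At a place where `a` is a nonsquare unit and `c` is a unit, `u - A` and `u - B` have even
valuation. -/
theorem IsAffinePoint.isSquare_map_of_unit (h : IsAffinePoint a b β c d σ τ x y z u)
    (ha : v a = 1) (hn : ∀ x, ¬ v (x ^ 2 - a) < 1) (h2 : v 2 = 1) (hb : v b = 1) (hc : v c = 1)
    (hd : v d ≤ 1) (hβ : v β ≤ 1) (hm : max (v σ) (v τ) = 1)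
    (hB0 : u - quarticForm a β (b * c ^ 2 * d + 2 * c) σ τ ≠ 0) :
    IsSquare (v (u - quarticForm a β (b * c ^ 2 * d) σ τ)) := by
  have hσ1 : v σ ≤ 1 := hm ▸ le_max_left _ _
  have hτ1 : v τ ≤ 1 := hm ▸ le_max_right _ _
  have hC : v (a * σ ^ 2 - τ ^ 2) = 1 := by
    rw [v.map_sub_swap, map_sq_sub_mul_sq v ha hn, max_comm, hm, one_pow]
  have h1 := congr_arg v h.eq_left
  rw [map_sq_sub_mul_sq v ha hn, v.map_neg, map_mul, map_mul, hb, one_mul] at h1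
  have hpq : IsSquare (v (u - quarticForm a β (b * c ^ 2 * d) σ τ) *
      v (u - quarticForm a β (b * c ^ 2 * d + 2 * c) σ τ)) := h1 ▸ ⟨_, sq _⟩
  have hu : v u = max (v x) (v y) ^ 2 := by
    rw [← map_sq_sub_mul_sq v ha hn, h.eq_right]; simp [ha, hC]
  have hus : IsSquare (v u) := ⟨_, hu.trans (sq _)⟩
  have hAB : v ((u - quarticForm a β (b * c ^ 2 * d) σ τ) -
      (u - quarticForm a β (b * c ^ 2 * d + 2 * c) σ τ)) = v (a * β * σ ^ 2 - τ ^ 2) ^ 2 := by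
    rw [show (u - quarticForm a β (b * c ^ 2 * d) σ τ) -
      (u - quarticForm a β (b * c ^ 2 * d + 2 * c) σ τ) = 2 * c * (a * β * σ ^ 2 - τ ^ 2) ^ 2 by
        simp only [quarticForm]; ring]
    simp [h2, hc]
  have hD1 : v (a * β * σ ^ 2 - τ ^ 2) ≤ 1 := by
    refine v.map_sub_le ?_ ?_
    · rw [map_mul, map_mul, map_pow, ha, one_mul]
      exact mul_le_one₀ hβ zero_le (pow_le_one₀ zero_le hσ1)
    · rw [map_pow]; exact pow_le_one₀ zero_le hτ1
  have he : v (b * c ^ 2 * d) ≤ 1 := by simpa [hb, hc] using hd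
  by_contra hp
  set p := v (u - quarticForm a β (b * c ^ 2 * d) σ τ) with hpdef
  have hp0 : p ≠ 0 := fun h => hp (h ▸ IsSquare.zero)
  have hq0 : v (u - quarticForm a β (b * c ^ 2 * d + 2 * c) σ τ) ≠ 0 := by simpa using hB0
  have hq : ¬ IsSquare (v (u - quarticForm a β (b * c ^ 2 * d + 2 * c) σ τ)) := fun hq =>
    hp (isSquare_of_mul_left hq0 (mul_comm p _ ▸ hpq) hq)
  have hpq' : p = v (u - quarticForm a β (b * c ^ 2 * d + 2 * c) σ τ) := by
    by_contra hne
    rw [sub_eq_add_neg, v.map_add_of_distinct_val (by rwa [v.map_neg]), v.map_neg] at hAB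
    rcases max_choice (v (u - quarticForm a β (b * c ^ 2 * d) σ τ))
      (v (u - quarticForm a β (b * c ^ 2 * d + 2 * c) σ τ)) with h | h
    · exact hp ⟨_, (h.symm.trans hAB).trans (sq _)⟩
    · exact hq ⟨_, (h.symm.trans hAB).trans (sq _)⟩
  have hDp : v (a * β * σ ^ 2 - τ ^ 2) ^ 2 < p := by
    refine lt_of_le_of_ne ?_ fun h => hp ⟨_, h.symm.trans (sq _)⟩
    rw [← hAB]
    exact v.map_sub_le le_rfl hpq'.ge
  have hA1 : v (quarticForm a β (b * c ^ 2 * d) σ τ) ≤ 1 := by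
    refine v.map_add_le ?_ ?_
    · simpa [ha] using pow_le_one₀ zero_le hσ1
    · rw [map_mul, map_pow]
      exact mul_le_one₀ he zero_le (pow_le_one₀ zero_le hD1)
  rcases lt_trichotomy p 1 with h | h | h
  · have hD : v (a * β * σ ^ 2 - τ ^ 2) < 1 :=
      (pow_lt_one_iff_of_nonneg zero_le two_ne_zero).1 (hDp.trans h)
    have hσ : v σ = 1 := by
      refine hσ1.antisymm (not_lt.1 fun hσ => ?_)
      have hτ : v τ = 1 := by
        rcases max_choice (v σ) (v τ) with h | h
        · exact absurd (h.symm.trans hm) hσ.ne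
        · exact h.symm.trans hm
      rw [v.map_sub_eq_of_lt_right, map_pow, hτ, one_pow] at hD
      · exact hD.false
      · rw [map_mul, map_mul, map_pow, map_pow, ha, one_mul, hτ, one_pow]
        exact (mul_le_of_le_one_left zero_le hβ).trans_lt (pow_lt_one₀ zero_le hσ two_ne_zero)
    refine IsAffinePoint.false_of_lt v ‹_› ha hn hb hC hσ ?_ ?_
    · rw [show u - a ^ 3 * σ ^ 4 = (u - quarticForm a β (b * c ^ 2 * d) σ τ) +
        b * c ^ 2 * d * (a * β * σ ^ 2 - τ ^ 2) ^ 2 by simp only [quarticForm]; ring]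
      refine v.map_add_lt h ?_
      rw [map_mul, map_pow]
      exact (mul_le_of_le_one_left zero_le he).trans_lt (pow_lt_one₀ zero_le hD two_ne_zero)
    · rw [← hpq', ← hpdef]
      exact mul_lt_one_of_nonneg_of_lt_one_left zero_le h h.le
  · exact hp (h ▸ IsSquare.one)
  · have : v u = p := by
      rw [← sub_add_cancel u (quarticForm a β (b * c ^ 2 * d) σ τ),
        v.map_add_eq_of_lt_left (hA1.trans_lt h)]
    exact hp (this ▸ hus)

end LocalAnalysis

section LocalAnalysis

open WithZero

variable {K : Type*} [Field K] (v : Valuation K ℤᵐ⁰) {a b β c d σ τ x y z u : K}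

/-- At a place where `c` is a uniformizer and `a`, `bd` are nonsquare units, `u - A` has even
valuation, and neither `u - A` nor `u - B` vanishes. -/
theorem IsAffinePoint.isSquare_map_of_uniformizer (h : IsAffinePoint a b β c d σ τ x y z u)
    (ha : v a = 1) (hn : ∀ x, ¬ v (x ^ 2 - a) < 1) (h2 : v 2 = 1) (hb : v b = 1)
    (hc : v c = exp (-1)) (hd : v d = 1) (hbd : ∀ x, ¬ v (x ^ 2 - b * d) < 1) (hβ : v β ≤ 1)
    (hm : max (v σ) (v τ) = 1) :
    IsSquare (v (u - quarticForm a β (b * c ^ 2 * d) σ τ)) ∧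
      u - quarticForm a β (b * c ^ 2 * d) σ τ ≠ 0 ∧
      u - quarticForm a β (b * c ^ 2 * d + 2 * c) σ τ ≠ 0 := by
  have hσ1 : v σ ≤ 1 := hm ▸ le_max_left _ _
  have hτ1 : v τ ≤ 1 := hm ▸ le_max_right _ _
  have hC : v (a * σ ^ 2 - τ ^ 2) = 1 := by
    rw [v.map_sub_swap, map_sq_sub_mul_sq v ha hn, max_comm, hm, one_pow]
  have h1 := congr_arg v h.eq_left
  rw [map_sq_sub_mul_sq v ha hn, v.map_neg, map_mul, map_mul, hb, one_mul] at h1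
  have hu : v u = max (v x) (v y) ^ 2 := by
    rw [← map_sq_sub_mul_sq v ha hn, h.eq_right]; simp [ha, hC]
  have hus : IsSquare (v u) := ⟨_, hu.trans (sq _)⟩
  have hAB : u - quarticForm a β (b * c ^ 2 * d + 2 * c) σ τ =
      (u - quarticForm a β (b * c ^ 2 * d) σ τ) - 2 * c * (a * β * σ ^ 2 - τ ^ 2) ^ 2 := by
    simp only [quarticForm]; ring
  have hD1 : v (a * β * σ ^ 2 - τ ^ 2) ≤ 1 := by
    refine v.map_sub_le ?_ ?_
    · rw [map_mul, map_mul, map_pow, ha, one_mul]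
      exact mul_le_one₀ hβ zero_le (pow_le_one₀ zero_le hσ1)
    · rw [map_pow]; exact pow_le_one₀ zero_le hτ1
  have hc1 : exp (-1) < (1 : ℤᵐ⁰) := by rw [← exp_zero, exp_lt_exp]; norm_num
  have he : v (b * c ^ 2 * d) = exp (-2) := by
    rw [map_mul, map_mul, map_pow, hb, hc, hd, one_mul, mul_one, ← exp_nsmul]; rfl
  have h21 : exp (-2) < (exp (-1) : ℤᵐ⁰) := by rw [exp_lt_exp]; norm_num
  have hE : v (2 * c * (a * β * σ ^ 2 - τ ^ 2) ^ 2) ≤ exp (-1) := by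
    rw [map_mul, map_mul, h2, hc, one_mul, map_pow]
    exact mul_le_of_le_one_right zero_le (pow_le_one₀ zero_le hD1)
  have heD : v (b * c ^ 2 * d * (a * β * σ ^ 2 - τ ^ 2) ^ 2) ≤ exp (-2) := by
    rw [map_mul, he, map_pow]
    exact mul_le_of_le_one_right zero_le (pow_le_one₀ zero_le hD1)
  obtain hσ | hσ := hσ1.eq_or_lt
  · have hA : v (quarticForm a β (b * c ^ 2 * d) σ τ) = 1 := by
      have h1 : v (a ^ 3 * σ ^ 4) = 1 := by simp [ha, hσ]
      rw [quarticForm, v.map_add_eq_of_lt_left, h1]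
      rw [h1]
      exact heD.trans_lt (h21.trans hc1)
    have hlt : ¬ v (u - quarticForm a β (b * c ^ 2 * d) σ τ) < 1 := fun hp => by
      refine IsAffinePoint.false_of_lt v h ha hn hb hC hσ ?_ ?_
      · rw [show u - a ^ 3 * σ ^ 4 = (u - quarticForm a β (b * c ^ 2 * d) σ τ) +
          b * c ^ 2 * d * (a * β * σ ^ 2 - τ ^ 2) ^ 2 by simp only [quarticForm]; ring]
        exact v.map_add_lt hp (heD.trans_lt (h21.trans hc1))
      · rw [hAB]
        exact mul_lt_one_of_nonneg_of_lt_one_left zero_le hp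
          (v.map_sub_lt hp (hE.trans_lt hc1)).le
    refine ⟨?_, fun h0 => hlt (by simp [h0]), fun h0 => hlt ?_⟩
    · obtain hp | hp := (not_lt.1 hlt).eq_or_lt
      · exact hp ▸ IsSquare.one
      · have : v u = v (u - quarticForm a β (b * c ^ 2 * d) σ τ) := by
          conv_lhs => rw [← sub_add_cancel u (quarticForm a β (b * c ^ 2 * d) σ τ)]
          rw [v.map_add_eq_of_lt_left (hA.trans_lt hp)]
        exact this ▸ hus
    · rw [hAB, sub_eq_zero] at h0
      rw [h0]
      exact hE.trans_lt hc1
  · have hτ : v τ = 1 := by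
      rcases max_choice (v σ) (v τ) with h | h
      · exact absurd (h.symm.trans hm) hσ.ne
      · exact h.symm.trans hm
    have hσ' : v σ ≤ exp (-1) := le_exp_of_lt_exp (n := 0) hσ
    have hD : v (a * β * σ ^ 2 - τ ^ 2) = 1 := by
      rw [v.map_sub_eq_of_lt_right, map_pow, hτ, one_pow]
      rw [map_mul, map_mul, map_pow, map_pow, ha, one_mul, hτ, one_pow]
      exact (mul_le_of_le_one_left zero_le hβ).trans_lt (pow_lt_one₀ zero_le hσ two_ne_zero)
    have hσ4 : v (a ^ 3 * σ ^ 4) ≤ exp (-4) := by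
      rw [map_mul, map_pow, map_pow, ha, one_pow, one_mul]
      refine (pow_le_pow_left₀ zero_le hσ' 4).trans_eq ?_
      rw [← exp_nsmul]; rfl
    have h43 : exp (-4) ≤ (exp (-3) : ℤᵐ⁰) := by rw [exp_le_exp]; norm_num
    have h32 : exp (-3) < (exp (-2) : ℤᵐ⁰) := by rw [exp_lt_exp]; norm_num
    have hA : v (quarticForm a β (b * c ^ 2 * d) σ τ) = exp (-2) := by
      rw [quarticForm, v.map_add_eq_of_lt_right]
      · rw [map_mul, map_pow, hD, he, one_pow, mul_one]
      · rw [map_mul _ (b * c ^ 2 * d), map_pow _ (_ - _), hD, he, one_pow, mul_one]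
        exact hσ4.trans_lt (h43.trans_lt h32)
    have hE' : v (2 * c * (a * β * σ ^ 2 - τ ^ 2) ^ 2) = exp (-1) := by
      rw [map_mul, map_mul, h2, hc, one_mul, map_pow, hD, one_pow, mul_one]
    have hnp : exp (-1) < v (u - quarticForm a β (b * c ^ 2 * d) σ τ) := by
      by_contra! hp
      have hu1 : v u ≤ exp (-1) := by
        rw [← sub_add_cancel u (quarticForm a β (b * c ^ 2 * d) σ τ)]
        exact v.map_add_le hp (hA.trans_le h21.le)
      have hu2 : v u ≤ exp (-2) := by
        refine le_exp_of_lt_exp (n := -1) (lt_of_le_of_ne hu1 fun h => ?_)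
        rw [h, isSquare_exp_iff] at hus
        exact absurd hus (by decide)
      have hp2 : v (u - quarticForm a β (b * c ^ 2 * d) σ τ) ≤ exp (-2) :=
        v.map_sub_le hu2 hA.le
      have hq : v (u - quarticForm a β (b * c ^ 2 * d + 2 * c) σ τ) = exp (-1) := by
        rw [hAB, v.map_sub_eq_of_lt_right, hE']
        rw [hE']; exact hp2.trans_lt h21
      have hp3 : v (u - quarticForm a β (b * c ^ 2 * d) σ τ) ≤ exp (-3) := by
        refine le_exp_of_lt_exp (n := -2) (lt_of_le_of_ne hp2 fun h => ?_)
        rw [hq, h, ← exp_add] at h1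
        have : IsSquare (exp (-2 + -1) : ℤᵐ⁰) := ⟨_, h1.symm.trans (sq _)⟩
        rw [isSquare_exp_iff] at this
        exact absurd this (by decide)
      have hx4 : v (x ^ 2) ≤ exp (-4) := by
        rw [map_pow]
        refine (pow_le_pow_left₀ zero_le (le_max_left _ (v z)) 2).trans ?_
        rw [h1, hq]
        refine (mul_le_mul_left hp3 _).trans_eq ?_
        rw [← exp_add]; rfl
      have key : y ^ 2 - b * d * ((a * σ ^ 2 - τ ^ 2) * c * (a * β * σ ^ 2 - τ ^ 2)) ^ 2 =
          a⁻¹ * x ^ 2 + (a * σ ^ 2 - τ ^ 2) ^ 2 *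
            ((u - quarticForm a β (b * c ^ 2 * d) σ τ) + a ^ 3 * σ ^ 4) := by
        have ha0 : a ≠ 0 := by rintro rfl; simp at ha
        field_simp
        simp only [quarticForm]
        linear_combination -h.eq_right
      have hk := congr_arg v key
      rw [map_sq_sub_mul_sq v (by simp [hb, hd]) hbd] at hk
      have h5 : exp (-2) ≤ max (v y) (v ((a * σ ^ 2 - τ ^ 2) * c * (a * β * σ ^ 2 - τ ^ 2))) ^ 2 := by
        refine le_trans ?_ (pow_le_pow_left₀ zero_le (le_max_right _ _) 2)
        rw [map_mul, map_mul, hC, hc, hD, one_mul, mul_one, ← exp_nsmul]; rfl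
      rw [hk] at h5
      refine (h5.trans (v.map_add_le (g := exp (-3)) ?_ ?_)).not_gt h32
      · rw [map_mul, map_inv₀, ha, inv_one, one_mul]
        exact hx4.trans h43
      · rw [map_mul, map_pow, hC, one_pow, one_mul]
        exact v.map_add_le hp3 (hσ4.trans h43)
    refine ⟨?_, fun h0 => ?_, fun h0 => ?_⟩
    · have : v u = v (u - quarticForm a β (b * c ^ 2 * d) σ τ) := by
        conv_lhs => rw [← sub_add_cancel u (quarticForm a β (b * c ^ 2 * d) σ τ)]
        rw [v.map_add_eq_of_lt_left ((hA.trans_lt h21).trans hnp)]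
      exact this ▸ hus
    · rw [h0, map_zero] at hnp
      exact hnp.not_ge zero_le
    · rw [hAB, sub_eq_zero] at h0
      rw [h0, hE'] at hnp
      exact hnp.false

/-- The condition at a place where `a` is a uniformizer. -/
theorem exists_notSquare_of_uniformizer {A B C D : K}
    (h₁ : x ^ 2 - a * z ^ 2 = -(b * ((u - A) * (u - B)))) (h₂ : x ^ 2 - a * y ^ 2 = -(a * C ^ 2 * u))
    (ha : v a = exp (-1)) (hb : v b = 1) (hA : v A = 1) (hB : v B = 1) (hC : v C = 1) (hD : v D = 1)
    (hAB : B = A + 2 * c * D ^ 2) (hc : v c = 1) (hn : ∀ x, ¬ v (x ^ 2 - c) < 1) {i t : K}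
    (h2 : v 2 = 1) (hi : v (i ^ 2 + 1) < 1) (ht : v (t ^ 2 - 2) < 1) :
    (v (u - B) = 1 ∧ ∀ w, ¬ v (w ^ 2 - (u - B)) < 1) ∨
      (v (u - A) = 1 ∧ ∀ w, ¬ v (w ^ 2 - (u - A)) < 1) := by
  have hns : ¬ IsSquare (v a) := by rw [ha, isSquare_exp_iff]; decide
  have ha1 : v a < 1 := by rw [ha, ← exp_zero, exp_lt_exp]; norm_num
  have e₁ := congr_arg v h₁
  have e₂ := congr_arg v h₂
  rw [map_sq_sub_mul_sq_of_not_isSquare v hns, v.map_neg, map_mul, map_mul, hb, one_mul] at e₁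
  rw [map_sq_sub_mul_sq_of_not_isSquare v hns, v.map_neg, map_mul, map_mul, map_pow, hC, one_pow,
    mul_one] at e₂
  have hx : v x ^ 2 ≤ v a * v u := e₂ ▸ le_max_left _ _
  have hdvd : ∀ {p q r s : ℤᵐ⁰}, ¬ IsSquare r → s ≠ 0 → max (p ^ 2) (r * q ^ 2) = s * s → p = s := by
    intro p q r s hr hs h
    rw [← sq] at h
    rcases max_choice (p ^ 2) (r * q ^ 2) with h' | h'
    · exact (pow_left_inj₀ zero_le zero_le two_ne_zero).1 (h'.symm.trans h)
    · refine absurd ⟨s / q, ?_⟩ hr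
      have := h'.symm.trans h
      have hq : q ≠ 0 := by
        rintro rfl
        exact hs (by simpa [eq_comm] using this)
      rw [div_mul_div_comm, ← sq, ← sq, ← this]
      field_simp
  have hu : v u = 1 := by
    rcases lt_trichotomy (v u) 1 with h | h | h
    · rw [v.map_sub_eq_of_lt_right (h.trans_eq hA.symm), v.map_sub_eq_of_lt_right (h.trans_eq hB.symm),
        hA, hB] at e₁
      rw [hdvd hns one_ne_zero e₁, one_pow] at hx
      exact absurd hx (mul_lt_one_of_nonneg_of_lt_one_left zero_le ha1 h.le).not_ge
    · exact h
    · have hu0 : v u ≠ 0 := (zero_lt_one.trans h).ne'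
      rw [v.map_sub_eq_of_lt_left (hA.trans_lt h), v.map_sub_eq_of_lt_left (hB.trans_lt h)] at e₁
      have hxu := hdvd hns hu0 e₁
      rw [hxu, sq] at hx
      have := le_of_mul_le_mul_right hx (zero_lt_iff.2 hu0)
      exact absurd (this.trans_lt ha1) h.not_gt
  have hx1 : v x ^ 2 < 1 := by rw [hu, mul_one] at hx; exact hx.trans_lt ha1
  have hlt : v (u - A) * v (u - B) < 1 := by
    have hle : max (v x ^ 2) (v a * v z ^ 2) ≤ 1 := by
      rw [e₁]; exact mul_le_one₀ (v.map_sub_le hu.le hA.le) zero_le (v.map_sub_le hu.le hB.le)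
    rw [← e₁]
    refine lt_of_le_of_ne hle fun h => ?_
    rw [hdvd hns one_ne_zero (h.trans (mul_one 1).symm)] at hx1
    simp at hx1
  have main : ∀ {f w s : K}, v s = 1 → v (f - c * s ^ 2) < 1 → ¬ v (w ^ 2 - f) < 1 := by
    intro f w s hs hf hw
    have : v (w ^ 2 - c * s ^ 2) < 1 := by
      rw [← sub_add_sub_cancel _ f]; exact v.map_add_lt hw hf
    rw [map_sq_sub_mul_sq v hc hn, pow_lt_one_iff_of_nonneg zero_le two_ne_zero, hs] at this
    exact this.not_ge (le_max_right _ _)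
  have ht1 : v t = 1 := by
    have : v (t ^ 2) = 1 := by
      rw [← sub_add_cancel (t ^ 2) 2, v.map_add_eq_of_lt_right (ht.trans_eq h2.symm), h2]
    rwa [map_pow, pow_eq_one_iff_of_nonneg zero_le two_ne_zero] at this
  have hi1 : v i = 1 := by
    have : v (i ^ 2) = 1 := by
      rw [← add_sub_cancel_right (i ^ 2) 1, v.map_sub_eq_of_lt_right (by simpa using hi), map_one]
    rwa [map_pow, pow_eq_one_iff_of_nonneg zero_le two_ne_zero] at this
  have h2D : v (2 * c * D ^ 2) = 1 := by simp [h2, hc, hD]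
  by_cases hp : v (u - A) < 1
  · left
    have hq : u - B = (u - A) - 2 * c * D ^ 2 := by rw [hAB]; ring
    refine ⟨?_, fun w => main (s := i * t * D) (by simp [hi1, ht1, hD]) ?_⟩
    · rw [hq, v.map_sub_eq_of_lt_right (by rwa [h2D]), h2D]
    · rw [hq, show (u - A) - 2 * c * D ^ 2 - c * (i * t * D) ^ 2 =
        (u - A) + (-(c * D ^ 2 * 2 * (i ^ 2 + 1)) - c * D ^ 2 * i ^ 2 * (t ^ 2 - 2)) by ring]
      refine v.map_add_lt hp (v.map_sub_lt ?_ ?_)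
      · simpa [hc, hD, h2] using hi
      · simpa [hc, hD, hi1] using ht
  · right
    have hp1 : v (u - A) = 1 := (v.map_sub_le hu.le hA.le).antisymm (not_lt.1 hp)
    rw [hp1, one_mul] at hlt
    have hq : u - A = (u - B) + 2 * c * D ^ 2 := by rw [hAB]; ring
    refine ⟨hp1, fun w => main (s := t * D) (by simp [ht1, hD]) ?_⟩
    rw [hq, show (u - B) + 2 * c * D ^ 2 - c * (t * D) ^ 2 =
      (u - B) - c * D ^ 2 * (t ^ 2 - 2) by ring]
    refine v.map_sub_lt hlt ?_
    simpa [hc, hD] using ht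

end LocalAnalysis

section LocalAnalysis

open WithZero

variable {K : Type*} [Field K] (v : Valuation K ℤᵐ⁰) {a b β c d σ τ x y z u : K}

theorem IsAffinePoint.exists_notSquare (h : IsAffinePoint a b β c d σ τ x y z u)
    (hστ : σ ≠ 0 ∨ τ ≠ 0) (ha : v a = exp (-1)) (hb : v b = 1) (hβ : v β = 1) (hc : v c = 1)
    (hd : v d = 1) (hbcd : v (b * c * d + 2) = 1) (hn : ∀ x, ¬ v (x ^ 2 - c) < 1) {i t : K}
    (h2 : v 2 = 1) (hi : v (i ^ 2 + 1) < 1) (ht : v (t ^ 2 - 2) < 1) :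
    ∃ s, (v ((u - quarticForm a β (b * c ^ 2 * d + 2 * c) σ τ) * s ^ 2) = 1 ∧
        ∀ w, ¬ v (w ^ 2 - (u - quarticForm a β (b * c ^ 2 * d + 2 * c) σ τ) * s ^ 2) < 1) ∨
      (v ((u - quarticForm a β (b * c ^ 2 * d) σ τ) * s ^ 2) = 1 ∧
        ∀ w, ¬ v (w ^ 2 - (u - quarticForm a β (b * c ^ 2 * d) σ τ) * s ^ 2) < 1) := by
  have ha1 : v a < 1 := by rw [ha, ← exp_zero, exp_lt_exp]; norm_num
  have ha0 : a ≠ 0 := by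
    rintro rfl
    rw [map_zero] at ha
    exact exp_ne_zero ha.symm
  have hAu : ∀ {E D : K}, v E < 1 → v D = 1 → v (E + b * c ^ 2 * d * D ^ 2) = 1 := by
    intro E D hE hD
    have : v (b * c ^ 2 * d * D ^ 2) = 1 := by simp [hb, hc, hd, hD]
    rw [v.map_add_eq_of_lt_right (by rwa [this]), this]
  have hBu : ∀ {E D : K}, v E < 1 → v D = 1 → v (E + (b * c ^ 2 * d + 2 * c) * D ^ 2) = 1 := by
    intro E D hE hD
    have : v ((b * c ^ 2 * d + 2 * c) * D ^ 2) = 1 := by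
      rw [show b * c ^ 2 * d + 2 * c = c * (b * c * d + 2) by ring]
      simp [hc, hbcd, hD]
    rw [v.map_add_eq_of_lt_right (by rwa [this]), this]
  by_cases hle : v σ ≤ v τ
  · have hτ : τ ≠ 0 := by
      rintro rfl
      exact hστ.elim (fun h => h (by simpa using hle)) (fun h => h rfl)
    have hs : v (σ / τ) ≤ 1 := by
      rw [map_div₀]; exact div_le_one_of_le₀ hle zero_le
    have hD : v (a * β * (σ / τ) ^ 2 - (τ / τ) ^ 2) = 1 := by
      rw [div_self hτ, one_pow, v.map_sub_eq_of_lt_right, map_one]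
      rw [map_mul, map_mul, map_pow, hβ, mul_one, map_one]
      exact mul_lt_one_of_nonneg_of_lt_one_left zero_le ha1 (pow_le_one₀ zero_le hs)
    have hC : v (a * (σ / τ) ^ 2 - (τ / τ) ^ 2) = 1 := by
      rw [div_self hτ, one_pow, v.map_sub_eq_of_lt_right, map_one]
      rw [map_mul, map_pow, map_one]
      exact mul_lt_one_of_nonneg_of_lt_one_left zero_le ha1 (pow_le_one₀ zero_le hs)
    have hE : v (a ^ 3 * (σ / τ) ^ 4) < 1 := by
      rw [map_mul, map_pow, map_pow]
      exact mul_lt_one_of_nonneg_of_lt_one_left zero_le (pow_lt_one₀ zero_le ha1 three_ne_zero)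
        (pow_le_one₀ zero_le hs)
    have h' := h.scale hτ
    have := exists_notSquare_of_uniformizer v h'.eq_left h'.eq_right ha hb (hAu hE hD) (hBu hE hD) hC hD
      (by simp only [quarticForm]; ring) hc hn h2 hi ht
    refine ⟨1 / τ ^ 2, ?_⟩
    have hr : ∀ e, (u - quarticForm a β e σ τ) * (1 / τ ^ 2) ^ 2 =
        u / τ ^ 4 - quarticForm a β e (σ / τ) (τ / τ) := by
      intro e
      rw [quarticForm_div hτ]
      field_simp
    simpa only [hr] using this
  · have hσ : σ ≠ 0 := by
      rintro rfl
      simp at hle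
    have hs : v (τ / σ) < 1 := by
      rw [map_div₀, div_lt_one₀]
      · exact not_le.1 hle
      · simpa [zero_lt_iff] using hσ
    have hs' : v ((τ / σ) ^ 2 / a) < 1 := by
      have h1 := le_exp_of_lt_exp (n := 0) hs
      rw [map_div₀, map_pow, ha]
      refine (div_le_div_of_nonneg_right (pow_le_pow_left₀ zero_le h1 2) zero_le).trans_lt ?_
      rw [← exp_nsmul, ← exp_sub, ← exp_zero, exp_lt_exp]
      norm_num
    have hD : v (β * (σ / σ) ^ 2 - (τ / σ) ^ 2 / a) = 1 := by
      rw [div_self hσ, one_pow, mul_one, v.map_sub_eq_of_lt_left, hβ]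
      rwa [hβ]
    have hC : v ((σ / σ) ^ 2 - (τ / σ) ^ 2 / a) = 1 := by
      rw [div_self hσ, one_pow, v.map_sub_eq_of_lt_left, map_one]
      rwa [map_one]
    have hE : v (a * (σ / σ) ^ 4) < 1 := by
      rw [div_self hσ, one_pow, mul_one]; exact ha1
    have h' := h.scale hσ
    have hq : ∀ e, quarticForm a β e (σ / σ) (τ / σ) = (a * (σ / σ) ^ 4 +
        e * (β * (σ / σ) ^ 2 - (τ / σ) ^ 2 / a) ^ 2) * a ^ 2 := by
      intro e
      simp only [quarticForm]
      field_simp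
    have h1 : (x / σ ^ 4 / a ^ 2) ^ 2 - a * (z / σ ^ 4 / a ^ 2) ^ 2 =
        -(b * ((u / σ ^ 4 / a ^ 2 - (a * (σ / σ) ^ 4 +
          b * c ^ 2 * d * (β * (σ / σ) ^ 2 - (τ / σ) ^ 2 / a) ^ 2)) *
          (u / σ ^ 4 / a ^ 2 - (a * (σ / σ) ^ 4 +
          (b * c ^ 2 * d + 2 * c) * (β * (σ / σ) ^ 2 - (τ / σ) ^ 2 / a) ^ 2)))) := by
      have := h'.eq_left
      rw [hq, hq] at this
      generalize a * (σ / σ) ^ 4 + b * c ^ 2 * d * (β * (σ / σ) ^ 2 - (τ / σ) ^ 2 / a) ^ 2 = A at *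
      generalize a * (σ / σ) ^ 4 + (b * c ^ 2 * d + 2 * c) *
        (β * (σ / σ) ^ 2 - (τ / σ) ^ 2 / a) ^ 2 = B at *
      generalize x / σ ^ 4 = X at *
      generalize z / σ ^ 4 = Z at *
      generalize u / σ ^ 4 = U at *
      field_simp
      linear_combination this
    have h2' : (x / σ ^ 4 / a ^ 2) ^ 2 - a * (y / σ ^ 4 / a ^ 2) ^ 2 =
        -(a * ((σ / σ) ^ 2 - (τ / σ) ^ 2 / a) ^ 2 * (u / σ ^ 4 / a ^ 2)) := by
      have := h'.eq_right
      generalize x / σ ^ 4 = X at *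
      generalize y / σ ^ 4 = Y at *
      generalize u / σ ^ 4 = U at *
      generalize σ / σ = S at *
      generalize τ / σ = T at *
      field_simp
      linear_combination this
    have := exists_notSquare_of_uniformizer v h1 h2' ha hb (hAu hE hD) (hBu hE hD) hC hD
      (by ring) hc hn h2 hi ht
    refine ⟨1 / (σ ^ 2 * a), ?_⟩
    have hr : ∀ e, (u - quarticForm a β e σ τ) * (1 / (σ ^ 2 * a)) ^ 2 =
        u / σ ^ 4 / a ^ 2 - (a * (σ / σ) ^ 4 +
          e * (β * (σ / σ) ^ 2 - (τ / σ) ^ 2 / a) ^ 2) := by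
      intro e
      simp only [quarticForm]
      field_simp
    simpa only [hr] using this

end LocalAnalysis

section GlobalAnalysis

open WithZero NumberField IsDedekindDomain

variable {K : Type*} [Field K] [NumberField K]

theorem valuation_algebraMap_eq (π : HeightOneSpectrum (𝓞 K)) (x : 𝓞 K) :
    π.valuation K (algebraMap (𝓞 K) K x) = π.intValuation x := π.valuation_of_algebraMap x

theorem valuation_algebraMap_lt_one_iff {π : HeightOneSpectrum (𝓞 K)} {x : 𝓞 K} :
    π.valuation K (algebraMap (𝓞 K) K x) < 1 ↔ x ∈ π.asIdeal := π.valuation_lt_one_iff_mem x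

theorem not_valuation_sq_sub_lt_one {π : HeightOneSpectrum (𝓞 K)} {a : 𝓞 K}
    (ha : ¬ IsSquare (Ideal.Quotient.mk π.asIdeal a)) (x : K) :
    ¬ π.valuation K (x ^ 2 - algebraMap (𝓞 K) K a) < 1 := by
  intro hx
  have hx1 : π.valuation K x ≤ 1 := by
    have : π.valuation K (x ^ 2) ≤ 1 := by
      rw [← sub_add_cancel (x ^ 2) (algebraMap (𝓞 K) K a)]
      exact Valuation.map_add_le _ hx.le (π.valuation_le_one a)
    rw [map_pow] at this
    exact (pow_le_one_iff_of_nonneg zero_le two_ne_zero).1 this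
  obtain ⟨r, hr⟩ := π.exists_valuation_sub_lt_of_integer hx1 1
  refine ha ⟨Ideal.Quotient.mk _ r, ?_⟩
  rw [← map_mul, Ideal.Quotient.eq, ← neg_mem_iff, ← valuation_algebraMap_lt_one_iff (K := K)]
  have hr1 : π.valuation K (algebraMap (𝓞 K) K r) ≤ 1 := π.valuation_le_one r
  have : algebraMap (𝓞 K) K (-(a - r * r)) = (algebraMap (𝓞 K) K r - x) *
      (algebraMap (𝓞 K) K r + x) + (x ^ 2 - algebraMap (𝓞 K) K a) := by
    rw [map_neg, map_sub, map_mul]; ring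
  rw [this]
  refine Valuation.map_add_lt _ ?_ hx
  rw [map_mul]
  exact mul_lt_one_of_nonneg_of_lt_one_left zero_le hr (Valuation.map_add_le _ hr1 hx1)

theorem exists_valuation_sq_sub_lt_one {va : HeightOneSpectrum (𝓞 K)} {a : 𝓞 K} {f : K}
    (hva : va.asIdeal = Ideal.span {a}) (h2 : (2 : 𝓞 K) ∉ va.asIdeal)
    (ha : ∀ σ : K →+* ℝ, 0 < σ a)
    (hdy : ∀ π : HeightOneSpectrum (𝓞 K), (2 : 𝓞 K) ∈ π.asIdeal →
      ∀ n : ℕ, ∃ r s, a - r ^ 2 ∈ π.asIdeal ^ n ∧ r * s - 1 ∈ π.asIdeal ^ n)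
    (hf : va.valuation K f = 1)
    (hev : ∀ π : HeightOneSpectrum (𝓞 K), π ≠ va → (2 : 𝓞 K) ∉ π.asIdeal →
      ¬ IsSquare (Ideal.Quotient.mk π.asIdeal a) → IsSquare (π.valuation K f)) :
    ∃ w, va.valuation K (w ^ 2 - f) < 1 := by
  have ha0 : a ≠ 0 := by
    rintro rfl
    exact va.ne_bot (by rw [hva]; simp)
  have ha0' : algebraMap (𝓞 K) K a ≠ 0 := by simpa using ha0
  have hf0 : f ≠ 0 := by rintro rfl; simp at hf
  obtain ⟨n, d, hd, rfl⟩ := IsFractionRing.div_surjective (𝓞 K) f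
  have hd0 : d ≠ 0 := nonZeroDivisors.ne_zero hd
  have hd0' : algebraMap (𝓞 K) K d ≠ 0 := by simpa using hd0
  have hn0 : n ≠ 0 := by rintro rfl; simp at hf0
  obtain ⟨m, hm⟩ : ∃ m : ℕ, va.valuation K (algebraMap (𝓞 K) K d) = exp (-(m : ℤ)) := by
    rw [valuation_algebraMap_eq]
    exact ⟨_, va.intValuation_if_neg hd0⟩
  have hna : va.valuation K (algebraMap (𝓞 K) K a) = exp (-1) := by
    rw [valuation_algebraMap_eq]
    exact va.intValuation_singleton ha0 hva
  have hmem : n * d ∈ va.asIdeal ^ (2 * m) := by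
    rw [← va.intValuation_le_pow_iff_mem, ← valuation_algebraMap_eq (K := K), map_mul, map_mul]
    rw [map_div₀, div_eq_one_iff_eq (by simpa using hd0)] at hf
    rw [hf, hm, ← exp_add, exp_le_exp]
    push_cast
    omega
  rw [hva, Ideal.span_singleton_pow, Ideal.mem_span_singleton'] at hmem
  obtain ⟨G, hG⟩ := hmem
  have hG' : algebraMap (𝓞 K) K G = algebraMap (𝓞 K) K n / algebraMap (𝓞 K) K d *
      (algebraMap (𝓞 K) K d / algebraMap (𝓞 K) K a ^ m) ^ 2 := by
    have := congr_arg (algebraMap (𝓞 K) K) hG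
    simp only [map_mul, map_pow] at this
    field_simp
    rw [← this, pow_mul', mul_comm]
  have hG0 : G ≠ 0 := by
    rintro rfl
    rw [zero_mul] at hG
    exact mul_ne_zero hn0 hd0 hG.symm
  have hda : va.valuation K (algebraMap (𝓞 K) K d / algebraMap (𝓞 K) K a ^ m) = 1 := by
    rw [map_div₀, map_pow, hna, hm, ← exp_nsmul, ← exp_sub, exp_eq_one]
    simp
  have hGa : G ∉ va.asIdeal := by
    rw [← va.valuation_eq_one_iff_notMem (K := K), hG', map_mul, map_pow, hf, hda]
    simp
  obtain ⟨s, hs⟩ := isSquare_mod_of_forall_even hva h2 ha hdy hG0 hGa (fun π h1 h2 h3 => by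
    have h4 : IsSquare (π.intValuation G) := by
      rw [← valuation_algebraMap_eq (K := K), hG', map_mul, map_pow]
      exact (hev π h1 h2 h3).mul ⟨_, sq _⟩
    obtain ⟨k, hk⟩ : ∃ k : ℕ, π.intValuation G = exp (-(k : ℤ)) := ⟨_, π.intValuation_if_neg hG0⟩
    rw [hk, isSquare_exp_iff, even_neg, Int.even_coe_nat] at h4
    exact ⟨k, h4, (intValuation_eq_exp_iff π).1 hk⟩)
  obtain ⟨r, rfl⟩ := Ideal.Quotient.mk_surjective s
  rw [← map_mul, Ideal.Quotient.eq, ← neg_mem_iff, ← valuation_algebraMap_lt_one_iff (K := K)] at hs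
  refine ⟨algebraMap (𝓞 K) K r * (algebraMap (𝓞 K) K a ^ m / algebraMap (𝓞 K) K d), ?_⟩
  have : (algebraMap (𝓞 K) K r * (algebraMap (𝓞 K) K a ^ m / algebraMap (𝓞 K) K d)) ^ 2 -
      algebraMap (𝓞 K) K n / algebraMap (𝓞 K) K d = algebraMap (𝓞 K) K (-(G - r * r)) /
      (algebraMap (𝓞 K) K d / algebraMap (𝓞 K) K a ^ m) ^ 2 := by
    rw [map_neg, map_sub, map_mul, hG']
    field_simp
    ring
  rw [this, map_div₀, map_pow, hda, one_pow, div_one]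
  exact hs

end GlobalAnalysis

section Params

open WithZero NumberField IsDedekindDomain

variable {K : Type u} [Field K] [NumberField K] {g : ℕ} {a b c d : 𝓞 K}
  {va vb vc vd : HeightOneSpectrum (𝓞 K)}

theorem HeightOneSpectrum.eq_of_mem_of_span {π ρ : HeightOneSpectrum (𝓞 K)} {x : 𝓞 K}
    (hρ : ρ.asIdeal = Ideal.span {x}) (hx : x ∈ π.asIdeal) : π = ρ := by
  have hle : ρ.asIdeal ≤ π.asIdeal := by
    rw [hρ, Ideal.span_singleton_le_iff_mem]; exact hx
  exact (HeightOneSpectrum.ext (ρ.isMaximal.eq_of_le π.isPrime.ne_top hle)).symm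

theorem isSquare_mk_of_isSquare {π : HeightOneSpectrum (𝓞 K)} {x : 𝓞 K}
    (h : IsSquare (intToAdicCompletion π x)) : IsSquare (Ideal.Quotient.mk π.asIdeal x) := by
  obtain ⟨r, hr⟩ := exists_sub_sq_mem_of_isSquare h 1
  rw [pow_one, ← Ideal.Quotient.eq] at hr
  exact ⟨Ideal.Quotient.mk _ r, by rw [hr, map_pow, sq]⟩

theorem not_isSquare_mk_mul {π : HeightOneSpectrum (𝓞 K)} {x y : 𝓞 K}
    (hx : ¬ IsSquare (Ideal.Quotient.mk π.asIdeal x)) (hy : IsSquare (Ideal.Quotient.mk π.asIdeal y))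
    (hy0 : y ∉ π.asIdeal) : ¬ IsSquare (Ideal.Quotient.mk π.asIdeal (x * y)) := by
  have := π.isMaximal
  let _ := Ideal.Quotient.field π.asIdeal
  intro h
  rw [map_mul] at h
  have h0 : Ideal.Quotient.mk π.asIdeal y ≠ 0 := by rwa [Ne, Ideal.Quotient.eq_zero_iff_mem]
  have := h.div hy
  rw [mul_div_cancel_right₀ _ h0] at this
  exact hx this

theorem eq_zero_of_sq_eq_mul_sq {π : HeightOneSpectrum (𝓞 K)} {t x y : K}
    (ht : ¬ IsSquare (π.valuation K t)) (h : x ^ 2 - t * y ^ 2 = 0) : x = 0 ∧ y = 0 := by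
  have h1 := map_sq_sub_mul_sq_of_not_isSquare _ ht x y
  rw [h, map_zero] at h1
  have h2 : π.valuation K x ^ 2 ≤ 0 := h1 ▸ le_max_left _ _
  have h3 : π.valuation K t * π.valuation K y ^ 2 ≤ 0 := h1 ▸ le_max_right _ _
  have ht0 : t ≠ 0 := by rintro rfl; exact ht (by simp)
  exact ⟨by simpa using h2, by simpa [ht0] using h3⟩

theorem Params.not_sPoint (hP : Params K g a b c d va vb vc vd) {β : 𝓞 K} (hβ : β ∉ va.asIdeal)
    {σ τ : K} (hστ : σ ≠ 0 ∨ τ ≠ 0) :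
    ¬ SPoint (algebraMap (𝓞 K) K a) (algebraMap (𝓞 K) K b)
      (quarticForm (algebraMap (𝓞 K) K a) (algebraMap (𝓞 K) K β) (algebraMap (𝓞 K) K b *
        algebraMap (𝓞 K) K c ^ 2 * algebraMap (𝓞 K) K d) σ τ)
      (quarticForm (algebraMap (𝓞 K) K a) (algebraMap (𝓞 K) K β) (algebraMap (𝓞 K) K b *
        algebraMap (𝓞 K) K c ^ 2 * algebraMap (𝓞 K) K d + 2 * algebraMap (𝓞 K) K c) σ τ)
      (algebraMap (𝓞 K) K a * σ ^ 2 - τ ^ 2) := by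
  rintro ⟨x, y, z, u, w, hne, h₁, h₂⟩
  have hunit : ∀ {π : HeightOneSpectrum (𝓞 K)} {x : 𝓞 K}, x ∉ π.asIdeal →
      π.valuation K (algebraMap (𝓞 K) K x) = 1 := fun {π x} h =>
    π.valuation_eq_one_iff_notMem.2 h
  have hne_of : ∀ {π ρ : HeightOneSpectrum (𝓞 K)} {x : 𝓞 K}, ρ.asIdeal = Ideal.span {x} →
      π ≠ ρ → x ∉ π.asIdeal := fun h h' h'' => h' (HeightOneSpectrum.eq_of_mem_of_span h h'')
  have hgen : ∀ {π : HeightOneSpectrum (𝓞 K)} {x : 𝓞 K}, π.asIdeal = Ideal.span {x} →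
      π.valuation K (algebraMap (𝓞 K) K x) = exp (-1) := fun {π x} h => by
    rw [valuation_algebraMap_eq]
    refine π.intValuation_singleton ?_ h
    rintro rfl
    exact π.ne_bot (by rw [h]; simp)
  have hle : ∀ (π : HeightOneSpectrum (𝓞 K)) (x : 𝓞 K),
      π.valuation K (algebraMap (𝓞 K) K x) ≤ 1 := fun π x => π.valuation_le_one x
  have h2v : ∀ {π : HeightOneSpectrum (𝓞 K)}, (2 : 𝓞 K) ∉ π.asIdeal → π.valuation K 2 = 1 := by
    intro π h
    have := hunit h
    rwa [map_ofNat] at this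
  obtain ⟨hab, hac, had, hbc, hbd, hcd⟩ := hP.distinct
  have ha0 : algebraMap (𝓞 K) K a ≠ 0 := by
    intro h
    have := hgen hP.span_a
    rw [h, map_zero] at this
    exact exp_ne_zero this.symm
  have haodd : ¬ IsSquare (va.valuation K (algebraMap (𝓞 K) K a)) := by
    rw [hgen hP.span_a, isSquare_exp_iff]; decide
  have hw : w ≠ 0 := by
    rintro rfl
    obtain ⟨rfl, rfl⟩ := eq_zero_of_sq_eq_mul_sq haodd (h₂.trans (by ring))
    have hba : ¬ IsSquare (va.valuation K (algebraMap (𝓞 K) K a / algebraMap (𝓞 K) K b)) := by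
      rw [map_div₀, hunit (hne_of hP.span_b hab), div_one]; exact haodd
    have hb0 : algebraMap (𝓞 K) K b ≠ 0 := by
      intro h
      rw [h, div_zero, map_zero] at hba
      exact hba IsSquare.zero
    obtain ⟨rfl, rfl⟩ := eq_zero_of_sq_eq_mul_sq (x := u) (y := z) hba (by
      field_simp
      linear_combination h₁)
    exact hne ⟨rfl, rfl, rfl, rfl, rfl⟩
  have hpt : IsAffinePoint (algebraMap (𝓞 K) K a) (algebraMap (𝓞 K) K b) (algebraMap (𝓞 K) K β)
      (algebraMap (𝓞 K) K c) (algebraMap (𝓞 K) K d) σ τ (x / w) (y / w) (z / w) (u / w) := by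
    constructor
    · have h : (x / w) ^ 2 - algebraMap (𝓞 K) K a * (z / w) ^ 2 =
          (x ^ 2 - algebraMap (𝓞 K) K a * z ^ 2) / w ^ 2 := by field_simp
      rw [h, h₁]
      field_simp
    · have h : (x / w) ^ 2 - algebraMap (𝓞 K) K a * (y / w) ^ 2 =
          (x ^ 2 - algebraMap (𝓞 K) K a * y ^ 2) / w ^ 2 := by field_simp
      rw [h, h₂]
      field_simp
  clear hne h₁ h₂
  generalize x / w = x at hpt
  generalize y / w = y at hpt
  generalize z / w = z at hpt
  generalize u / w = u at hpt
  obtain ⟨h2a, h2b, h2c, -⟩ := hP.not_dvd_two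
  have hca : ¬ IsSquare (Ideal.Quotient.mk va.asIdeal c) := fun h =>
    hP.c_nsq_a (isSquare_adicCompletion h2a (hne_of hP.span_c hac) h)
  have hacn : ¬ IsSquare (Ideal.Quotient.mk vc.asIdeal a) := fun h =>
    hP.a_nsq_c (isSquare_adicCompletion h2c (hne_of hP.span_a hac.symm) h)
  have hbcn : ¬ IsSquare (Ideal.Quotient.mk vc.asIdeal b) := fun h =>
    hP.b_nsq_c (isSquare_adicCompletion h2c (hne_of hP.span_b hbc.symm) h)
  have hbdn : ¬ IsSquare (Ideal.Quotient.mk vc.asIdeal (b * d)) :=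
    not_isSquare_mk_mul hbcn (isSquare_mk_of_isSquare hP.d_sq_c) (hne_of hP.span_d hcd)
  have hab1 : IsSquare (Ideal.Quotient.mk vb.asIdeal a) := by
    have : Ideal.Quotient.mk vb.asIdeal a = 1 := by
      rw [← map_one (Ideal.Quotient.mk vb.asIdeal), Ideal.Quotient.eq, hP.span_b,
        Ideal.mem_span_singleton]
      exact hP.cong_a
    rw [this]; exact IsSquare.one
  obtain ⟨t, ht⟩ := exists_sub_sq_mem_of_isSquare (a := 2) (π := va)
    (by
      rw [intToAdicCompletion, map_ofNat, map_ofNat]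
      exact hP.sq_two_a) 1
  obtain ⟨i, hi⟩ := exists_sub_sq_mem_of_isSquare (a := -1) (π := va)
    (by simpa [intToAdicCompletion] using hP.sq_neg_one_a) 1
  rw [pow_one, ← neg_mem_iff, ← valuation_algebraMap_lt_one_iff (K := K)] at ht hi
  have ht' : va.valuation K (algebraMap (𝓞 K) K t ^ 2 - 2) < 1 := by
    rwa [neg_sub, map_sub, map_pow, map_ofNat] at ht
  have hi' : va.valuation K (algebraMap (𝓞 K) K i ^ 2 + 1) < 1 := by
    simpa [add_comm] using hi
  have hscale : ∀ π : HeightOneSpectrum (𝓞 K), ∃ κ : K, κ ≠ 0 ∧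
      max (π.valuation K (σ / κ)) (π.valuation K (τ / κ)) = 1 := by
    intro π
    rcases le_total (π.valuation K σ) (π.valuation K τ) with h | h
    · have hτ : τ ≠ 0 := by
        rintro rfl
        exact hστ.elim (fun h' => h' (by simpa using h)) (fun h' => h' rfl)
      have hτ' : π.valuation K τ ≠ 0 := by simpa using hτ
      refine ⟨τ, hτ, ?_⟩
      rw [map_div₀, map_div₀, div_self hτ', max_eq_right (div_le_one_of_le₀ h zero_le)]
    · have hσ : σ ≠ 0 := by
        rintro rfl
        exact hστ.elim (fun h' => h' rfl) (fun h' => h' (by simpa using h))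
      have hσ' : π.valuation K σ ≠ 0 := by simpa using hσ
      refine ⟨σ, hσ, ?_⟩
      rw [map_div₀, map_div₀, div_self hσ', max_eq_left (div_le_one_of_le₀ h zero_le)]
  have hsub : ∀ {κ e : K}, κ ≠ 0 → u / κ ^ 4 - quarticForm (algebraMap (𝓞 K) K a)
      (algebraMap (𝓞 K) K β) e (σ / κ) (τ / κ) = (u - quarticForm (algebraMap (𝓞 K) K a)
      (algebraMap (𝓞 K) K β) e σ τ) / (κ ^ 2) ^ 2 := by
    intro κ e hκ
    rw [quarticForm_div hκ, ← sub_div, ← pow_mul]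
  have hsq : ∀ {π : HeightOneSpectrum (𝓞 K)} {κ f : K}, κ ≠ 0 →
      IsSquare (π.valuation K (f / (κ ^ 2) ^ 2)) → IsSquare (π.valuation K f) := by
    intro π κ f hκ h
    have : f = f / (κ ^ 2) ^ 2 * (κ ^ 2) ^ 2 := by field_simp
    rw [this, map_mul, map_pow]
    exact h.mul ⟨_, sq _⟩
  -- the place dividing `c`
  obtain ⟨κ, hκ, hm⟩ := hscale vc
  have hvc := (hpt.scale hκ).isSquare_map_of_uniformizer _ (hunit (hne_of hP.span_a hac.symm))
    (not_valuation_sq_sub_lt_one hacn) (h2v h2c) (hunit (hne_of hP.span_b hbc.symm))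
    (hgen hP.span_c) (hunit (hne_of hP.span_d hcd))
    (by rw [← map_mul]; exact not_valuation_sq_sub_lt_one hbdn) (hle _ _) hm
  rw [hsub hκ, hsub hκ] at hvc
  obtain ⟨hvc1, hA0, hB0⟩ := hvc
  replace hvc1 := hsq hκ hvc1
  replace hA0 := (div_ne_zero_iff.1 hA0).1
  replace hB0 := (div_ne_zero_iff.1 hB0).1
  clear hκ hm κ
  -- all other places where `a` is inert
  have hevA : ∀ π : HeightOneSpectrum (𝓞 K), π ≠ va → (2 : 𝓞 K) ∉ π.asIdeal →
      ¬ IsSquare (Ideal.Quotient.mk π.asIdeal a) → IsSquare (π.valuation K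
        (u - quarticForm (algebraMap (𝓞 K) K a) (algebraMap (𝓞 K) K β) (algebraMap (𝓞 K) K b *
        algebraMap (𝓞 K) K c ^ 2 * algebraMap (𝓞 K) K d) σ τ)) := by
    intro π h1 h2 h3
    by_cases hc : π = vc
    · exact hc ▸ hvc1
    · obtain ⟨κ, hκ, hm⟩ := hscale π
      refine hsq hκ ?_
      rw [← hsub hκ]
      have hb : π ≠ vb := by
        rintro rfl
        exact h3 hab1
      refine (hpt.scale hκ).isSquare_map_of_unit _ (hunit (hne_of hP.span_a h1))
        (not_valuation_sq_sub_lt_one h3) (h2v h2) (hunit (hne_of hP.span_b hb))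
        (hunit (hne_of hP.span_c hc)) (hle _ _) (hle _ _) hm ?_
      rw [hsub hκ]
      exact div_ne_zero hB0 (by positivity)
  have hevB : ∀ π : HeightOneSpectrum (𝓞 K), π ≠ va → (2 : 𝓞 K) ∉ π.asIdeal →
      ¬ IsSquare (Ideal.Quotient.mk π.asIdeal a) → IsSquare (π.valuation K
        (u - quarticForm (algebraMap (𝓞 K) K a) (algebraMap (𝓞 K) K β) (algebraMap (𝓞 K) K b *
        algebraMap (𝓞 K) K c ^ 2 * algebraMap (𝓞 K) K d + 2 * algebraMap (𝓞 K) K c) σ τ)) := by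
    intro π h1 h2 h3
    have hb : π ≠ vb := by
      rintro rfl
      exact h3 hab1
    refine isSquare_of_mul_left (by simpa using hA0) ?_ (hevA π h1 h2 h3)
    have := congr_arg (π.valuation K) hpt.eq_left
    rw [map_sq_sub_mul_sq _ (hunit (hne_of hP.span_a h1)) (not_valuation_sq_sub_lt_one h3),
      Valuation.map_neg, map_mul, hunit (hne_of hP.span_b hb), one_mul, map_mul] at this
    exact this ▸ ⟨_, sq _⟩
  have hdy : ∀ π : HeightOneSpectrum (𝓞 K), (2 : 𝓞 K) ∈ π.asIdeal →
      ∀ n : ℕ, ∃ r s, a - r ^ 2 ∈ π.asIdeal ^ n ∧ r * s - 1 ∈ π.asIdeal ^ n := by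
    intro π h2 n
    obtain ⟨r, hr⟩ := exists_sub_sq_mem_of_isSquare (hP.sq_ab_bad π (Or.inl h2)).1 (n + 1)
    have hr0 : r ∉ π.asIdeal := by
      intro h
      have ha : a ∈ π.asIdeal := by
        rw [← sub_add_cancel a (r ^ 2)]
        exact Ideal.add_mem _ (Ideal.pow_le_self (Nat.succ_ne_zero n) hr)
          (Ideal.pow_mem_of_mem _ h 2 two_pos)
      exact h2a (HeightOneSpectrum.eq_of_mem_of_span hP.span_a ha ▸ h2)
    obtain ⟨s, hs⟩ := exists_mul_sub_one_mem_pow π hr0 n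
    exact ⟨r, s, Ideal.pow_le_pow_right (Nat.le_succ n) hr, hs⟩
  have hfin : ∀ f : K, (∀ π : HeightOneSpectrum (𝓞 K), π ≠ va → (2 : 𝓞 K) ∉ π.asIdeal →
      ¬ IsSquare (Ideal.Quotient.mk π.asIdeal a) → IsSquare (π.valuation K f)) → ∀ s : K,
      ¬ (va.valuation K (f * s ^ 2) = 1 ∧ ∀ w, ¬ va.valuation K (w ^ 2 - f * s ^ 2) < 1) := by
    rintro f hf s ⟨h1, h2⟩
    obtain ⟨w, hw⟩ := exists_valuation_sq_sub_lt_one hP.span_a h2a (fun σ => (hP.pos_real σ).1) hdy h1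
      (fun π h3 h4 h5 => by
        rw [map_mul, map_pow]
        exact (hf π h3 h4 h5).mul ⟨_, sq _⟩)
    exact h2 w hw
  -- the place dividing `a`
  have hbcd : va.valuation K (algebraMap (𝓞 K) K b * algebraMap (𝓞 K) K c * algebraMap (𝓞 K) K d + 2)
      = 1 := by
    have : b * c * d + 2 ∉ va.asIdeal := by
      rw [hP.span_a, Ideal.mem_span_singleton]; exact hP.not_dvd
    have := hunit this
    rwa [map_add, map_mul, map_mul, map_ofNat] at this
  obtain ⟨s, hs | hs⟩ := hpt.exists_notSquare _ hστ (hgen hP.span_a) (hunit (hne_of hP.span_b hab))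
    (hunit hβ) (hunit (hne_of hP.span_c hac)) (hunit (hne_of hP.span_d had)) hbcd
    (not_valuation_sq_sub_lt_one hca) (h2v h2a) hi' ht'
  · exact hfin _ hevB s hs
  · exact hfin _ hevA s hs

end Params

section QuadraticForms

open Polynomial Matrix

variable {ι R S : Type*} [Fintype ι] [CommRing R] [CommRing S]

/-- The bilinear form of a matrix. -/
def matrixBilin (P : Matrix ι ι R) (x y : ι → R) : R := x ⬝ᵥ P *ᵥ y

theorem matrixBilin_add_left (P : Matrix ι ι R) (x y z : ι → R) :
    matrixBilin P (x + y) z = matrixBilin P x z + matrixBilin P y z := by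
  simp [matrixBilin, add_dotProduct]

theorem matrixBilin_add_right (P : Matrix ι ι R) (x y z : ι → R) :
    matrixBilin P x (y + z) = matrixBilin P x y + matrixBilin P x z := by
  simp [matrixBilin, mulVec_add, dotProduct_add]

theorem matrixBilin_smul_left (P : Matrix ι ι R) (r : R) (x y : ι → R) :
    matrixBilin P (r • x) y = r * matrixBilin P x y := by
  simp [matrixBilin, smul_dotProduct]

theorem matrixBilin_smul_right (P : Matrix ι ι R) (r : R) (x y : ι → R) :
    matrixBilin P x (r • y) = r * matrixBilin P x y := by
  simp [matrixBilin, mulVec_smul, dotProduct_smul]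

theorem map_matrixBilin (f : R →+* S) (P : Matrix ι ι R) (x y : ι → R) :
    f (matrixBilin P x y) = matrixBilin (P.map f) (f ∘ x) (f ∘ y) := by
  rw [matrixBilin, RingHom.map_dotProduct, matrixBilin]
  congr 1
  ext i
  simp [RingHom.map_mulVec]

theorem matrixBilin_eq_sum (P : Matrix ι ι R) (x y : ι → R) :
    matrixBilin P x y = ∑ i, ∑ j, x i * (P i j * y j) := by
  simp [matrixBilin, dotProduct, mulVec, Finset.mul_sum]

theorem natDegree_matrixBilin_le {P : Matrix ι ι R[X]} {x y : ι → R[X]} {k m n : ℕ}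
    (hP : ∀ i j, (P i j).natDegree ≤ k) (hx : ∀ i, (x i).natDegree ≤ m)
    (hy : ∀ i, (y i).natDegree ≤ n) : (matrixBilin P x y).natDegree ≤ m + (k + n) := by
  rw [matrixBilin_eq_sum]
  exact natDegree_sum_le_of_forall_le _ _ fun i _ => natDegree_sum_le_of_forall_le _ _ fun j _ =>
    natDegree_mul_le_of_le (hx i) (natDegree_mul_le_of_le (hP i j) (hy j))

theorem coeff_matrixBilin {P : Matrix ι ι R} {x y : ι → R[X]} {m n : ℕ}
    (hx : ∀ i, (x i).natDegree ≤ m) (hy : ∀ i, (y i).natDegree ≤ n) :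
    (matrixBilin (P.map C) x y).coeff (m + n) =
      matrixBilin P (fun i => (x i).coeff m) (fun i => (y i).coeff n) := by
  simp only [matrixBilin_eq_sum, finsetSum_coeff]
  refine Finset.sum_congr rfl fun i _ => Finset.sum_congr rfl fun j _ => ?_
  rw [map_apply, coeff_mul_add_eq_of_natDegree_le (hx i) ((natDegree_C_mul_le _ _).trans (hy j)),
    coeff_C_mul]

variable {F : Type*} [Field F]

theorem exists_irreducible_dvd_odd_natDegree {h : F[X]} (hh : Odd h.natDegree) :
    ∃ p, Irreducible p ∧ p ∣ h ∧ Odd p.natDegree := by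
  induction h using WfDvdMonoid.induction_on_irreducible with
  | zero => simp at hh
  | unit u hu => simp [natDegree_eq_zero_of_isUnit hu] at hh
  | mul a i ha hi ih =>
    rw [natDegree_mul hi.ne_zero ha, Nat.odd_add] at hh
    by_cases h : Odd i.natDegree
    · exact ⟨i, hi, dvd_mul_right _ _, h⟩
    · obtain ⟨p, hp, hpa, hp'⟩ := ih (by
        by_contra h'
        exact h (hh.2 (Nat.not_odd_iff_even.1 h')))
      exact ⟨p, hp, hpa.mul_left i, hp'⟩

/-- Springer's theorem, for a simple extension given by an irreducible polynomial. -/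
theorem exists_isotropic_of_odd_natDegree (M : Matrix ι ι F) {p : F[X]} (hp : Irreducible p)
    (hodd : Odd p.natDegree) {v : ι → F[X]} (hv : ∃ i, ¬ p ∣ v i)
    (hdvd : p ∣ matrixBilin (M.map C) v v) : ∃ w, w ≠ 0 ∧ matrixBilin M w w = 0 := by
  induction hN : p.natDegree using Nat.strong_induction_on generalizing p v with
  | _ N ih =>
  subst hN
  by_contra! haniso
  have hmod : ∃ v : ι → F[X], (∃ i, ¬ p ∣ v i) ∧ p ∣ matrixBilin (M.map C) v v ∧
      ∀ i, (v i).natDegree < p.natDegree := by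
    refine ⟨fun i => v i % p, ?_, ?_, fun i => natDegree_mod_lt _ hp.natDegree_pos.ne'⟩
    · obtain ⟨i, hi⟩ := hv
      exact ⟨i, fun h => hi ((EuclideanDomain.dvd_mod_iff dvd_rfl).1 h)⟩
    · have hve : v = (fun i => v i % p) + p • (fun i => v i / p) := by
        ext1 i
        simp [EuclideanDomain.mod_add_div]
      rw [hve] at hdvd
      simp only [matrixBilin_add_left, matrixBilin_add_right, matrixBilin_smul_left,
        matrixBilin_smul_right] at hdvd
      rw [add_assoc] at hdvd
      exact (dvd_add_left (dvd_add (dvd_mul_right _ _) (dvd_mul_right _ _))).1 hdvd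
  obtain ⟨v, ⟨i₀, hi₀⟩, hdvd, hdeg⟩ := hmod
  obtain ⟨g, hg⟩ := IsPrincipalIdealRing.principal (Ideal.span (Set.range v))
  have hgd : ∀ i, g ∣ v i := fun i => by
    rw [← Ideal.mem_span_singleton, ← Ideal.submodule_span_eq, ← hg]
    exact Ideal.subset_span ⟨i, rfl⟩
  choose v' hv' using hgd
  have hg0 : g ≠ 0 := by
    rintro rfl
    exact hi₀ (by rw [hv' i₀, zero_mul]; exact dvd_zero _)
  have hpg : ¬ p ∣ g := fun h => hi₀ (hv' i₀ ▸ h.mul_right _)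
  obtain ⟨c, hc⟩ : ∃ c : ι → F[X], ∑ i, c i * v' i = 1 := by
    have : g ∈ Ideal.span (Set.range v) := by
      rw [hg]; exact Submodule.mem_span_singleton_self g
    obtain ⟨c, hc⟩ := (Ideal.mem_span_range_iff_exists_fun).1 this
    refine ⟨c, mul_left_cancel₀ hg0 ?_⟩
    rw [Finset.mul_sum, mul_one]
    conv_rhs => rw [← hc]
    refine Finset.sum_congr rfl fun i _ => ?_
    rw [hv' i]; ring
  have hdvd' : p ∣ matrixBilin (M.map C) v' v' := by
    have : v = g • v' := funext hv'
    rw [this, matrixBilin_smul_left, matrixBilin_smul_right] at hdvd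
    exact (hp.prime.dvd_or_dvd ((hp.prime.dvd_or_dvd hdvd).resolve_left hpg)).resolve_left hpg
  have hdeg' : ∀ i, (v' i).natDegree < p.natDegree := fun i => by
    by_cases h : v' i = 0
    · rw [h, natDegree_zero]; exact hp.natDegree_pos
    · refine lt_of_le_of_lt ?_ (hdeg i)
      rw [hv' i, natDegree_mul hg0 h]
      omega
  have hne : ∃ i, v' i ≠ 0 := by
    by_contra! h
    simp [h] at hc
  obtain ⟨i₁, hi₁⟩ := hne
  obtain ⟨k, -, hk⟩ := Finset.exists_max_image Finset.univ
    (fun i => (v' i).natDegree) ⟨i₁, Finset.mem_univ _⟩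
  obtain ⟨j, hj, hjd⟩ : ∃ j, v' j ≠ 0 ∧ ∀ i, (v' i).natDegree ≤ (v' j).natDegree := by
    by_cases hk0 : v' k = 0
    · refine ⟨i₁, hi₁, fun i => (hk i (Finset.mem_univ _)).trans ?_⟩
      simp [hk0]
    · exact ⟨k, hk0, fun i => hk i (Finset.mem_univ _)⟩
  set m := (v' j).natDegree with hm
  have hco : (matrixBilin (M.map C) v' v').coeff (m + m) ≠ 0 := by
    rw [coeff_matrixBilin hjd hjd]
    refine haniso _ fun h => ?_
    have := congr_fun h j
    rw [hm] at this
    exact hj (leadingCoeff_eq_zero.1 this)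
  have hnd : (matrixBilin (M.map C) v' v').natDegree = m + m := by
    refine le_antisymm ?_ (le_natDegree_of_ne_zero hco)
    refine (natDegree_matrixBilin_le (k := 0) (fun i j => by simp) hjd hjd).trans_eq (by omega)
  obtain ⟨h, hh⟩ := hdvd'
  have hh0 : h ≠ 0 := by
    rintro rfl
    rw [hh, mul_zero] at hco
    simp at hco
  have hdh : m + m = p.natDegree + h.natDegree := by
    rw [← hnd, hh, natDegree_mul hp.ne_zero hh0]
  have hmp : m < p.natDegree := hdeg' j
  have hhodd : Odd h.natDegree := by
    rcases hodd with ⟨r, hr⟩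
    exact ⟨m - r - 1, by omega⟩
  obtain ⟨p₁, hp₁, hp₁h, hp₁o⟩ := exists_irreducible_dvd_odd_natDegree hhodd
  have hlt : p₁.natDegree < p.natDegree := (natDegree_le_of_dvd hp₁h hh0).trans_lt (by omega)
  obtain ⟨w, hw0, hw⟩ := ih _ hlt hp₁ hp₁o (v := v') (by
    by_contra! hall
    exact hp₁.not_isUnit (isUnit_of_dvd_one (hc ▸ Finset.dvd_sum fun i _ => (hall i).mul_left _)))
    (hh ▸ hp₁h.mul_left p) rfl
  exact haniso w hw0 hw

/-- The Amer–Brumer theorem, in polynomial form. -/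
theorem exists_common_zero_of_pencil (M N : Matrix ι ι F) (d : ℕ) {w : ι → F[X]} (hw0 : w ≠ 0)
    (hd : ∀ i, (w i).natDegree ≤ d)
    (hw : matrixBilin (M.map C) w w + X * matrixBilin (N.map C) w w = 0) :
    ∃ u, u ≠ 0 ∧ matrixBilin M u u = 0 ∧ matrixBilin N u u = 0 := by
  have hC : ∀ (P : Matrix ι ι F) (u : ι → F),
      matrixBilin (P.map C) (C ∘ u) (C ∘ u) = C (matrixBilin P u u) := fun P u =>
    (map_matrixBilin C P u u).symm
  induction d generalizing w with
  | zero =>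
    have hwC : w = C ∘ fun i => (w i).coeff 0 := by
      ext1 i
      exact eq_C_of_natDegree_le_zero (hd i)
    have hu0 : (fun i => (w i).coeff 0) ≠ 0 := by
      intro h
      rw [h] at hwC
      exact hw0 (hwC.trans (by ext1; simp))
    refine ⟨_, hu0, ?_⟩
    rw [hwC, hC, hC] at hw
    have h0 := congr_arg (coeff · 0) hw
    have h1 := congr_arg (coeff · 1) hw
    simp only [coeff_add, coeff_C_zero, coeff_X_mul_zero, add_zero, coeff_zero] at h0
    simp only [coeff_add, coeff_C_succ, coeff_X_mul, coeff_C_zero, zero_add, coeff_zero] at h1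
    exact ⟨h0, h1⟩
  | succ d ih =>
    set u : ι → F := fun i => (w i).coeff (d + 1) with hu
    by_cases hu0 : u = 0
    · refine ih hw0 (fun i => ?_) hw
      refine Nat.le_of_lt_succ (lt_of_le_of_ne (hd i) fun h => ?_)
      have h1 : (w i).coeff d.succ = 0 := congr_fun hu0 i
      rw [← h] at h1
      have : w i = 0 := leadingCoeff_eq_zero.1 h1
      rw [this, natDegree_zero] at h
      omega
    set U : ι → F[X] := C ∘ u with hU
    set w₀ : ι → F[X] := fun i => w i - C (u i) * X ^ (d + 1) with hw₀
    have hw₀d : ∀ i, (w₀ i).natDegree ≤ d := fun i => by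
      rw [natDegree_le_iff_coeff_eq_zero]
      intro n hn
      simp only [hw₀, hu, coeff_sub, coeff_C_mul, coeff_X_pow]
      split_ifs with h
      · rw [h]; ring
      · rw [coeff_eq_zero_of_natDegree_lt ((hd i).trans_lt (by omega))]; ring
    have hUd : ∀ i, (U i).natDegree ≤ 0 := fun i => (natDegree_C (u i)).le
    have hwU : w = (X ^ (d + 1) : F[X]) • U + w₀ := by
      ext1 i
      simp [hw₀, hU]
    set q := matrixBilin M u u
    set q' := matrixBilin N u u
    set b₁ := matrixBilin (M.map C) U w₀ + matrixBilin (M.map C) w₀ U with hb₁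
    set b₂ := matrixBilin (N.map C) U w₀ + matrixBilin (N.map C) w₀ U with hb₂
    set r₁ := matrixBilin (M.map C) w₀ w₀ with hr₁
    set r₂ := matrixBilin (N.map C) w₀ w₀ with hr₂
    have hQ : ∀ (s t : F[X]), matrixBilin (M.map C) (s • U + t • w₀) (s • U + t • w₀) +
        X * matrixBilin (N.map C) (s • U + t • w₀) (s • U + t • w₀) =
        s ^ 2 * (C q + X * C q') + s * t * (b₁ + X * b₂) + t ^ 2 * (r₁ + X * r₂) := by
      intro s t
      simp only [matrixBilin_add_left, matrixBilin_add_right, matrixBilin_smul_left,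
        matrixBilin_smul_right, hb₁, hb₂, hr₁, hr₂, hU, hC]
      ring
    have hw1 := hQ (X ^ (d + 1)) 1
    rw [one_smul, ← hwU, hw] at hw1
    have hPC : ∀ (P : Matrix ι ι F) i j, ((P.map C) i j).natDegree ≤ 0 := fun P i j => by simp
    have hbd₁ : b₁.natDegree ≤ d := natDegree_add_le_of_degree_le
      ((natDegree_matrixBilin_le (hPC M) hUd hw₀d).trans (by omega))
      ((natDegree_matrixBilin_le (hPC M) hw₀d hUd).trans (by omega))
    have hbd₂ : b₂.natDegree ≤ d := natDegree_add_le_of_degree_le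
      ((natDegree_matrixBilin_le (hPC N) hUd hw₀d).trans (by omega))
      ((natDegree_matrixBilin_le (hPC N) hw₀d hUd).trans (by omega))
    have hrd₁ : r₁.natDegree ≤ d + d := (natDegree_matrixBilin_le (hPC M) hw₀d hw₀d).trans (by omega)
    have hrd₂ : r₂.natDegree ≤ d + d := (natDegree_matrixBilin_le (hPC N) hw₀d hw₀d).trans (by omega)
    have hbd : (b₁ + X * b₂).natDegree ≤ d + 1 := natDegree_add_le_of_degree_le (by omega)
      ((natDegree_mul_le_of_le natDegree_X_le hbd₂).trans (by omega))
    have hrd : (r₁ + X * r₂).natDegree ≤ d + d + 1 := natDegree_add_le_of_degree_le (by omega)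
      ((natDegree_mul_le_of_le natDegree_X_le hrd₂).trans (by omega))
    set b := b₁ + X * b₂
    set r := r₁ + X * r₂
    have hq' : q' = 0 := by
      have := congr_arg (coeff · (2 * (d + 1) + 1)) hw1
      simp only [one_pow, one_mul, mul_one, coeff_add, coeff_zero, ← pow_mul'] at this
      rw [coeff_X_pow_mul', if_pos (by omega), coeff_X_pow_mul', if_pos (by omega),
        coeff_eq_zero_of_natDegree_lt (hbd.trans_lt (by omega)),
        coeff_eq_zero_of_natDegree_lt (hrd.trans_lt (by omega)), Nat.add_sub_cancel_left] at this
      simpa [coeff_X_mul, coeff_C] using this.symm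
    have hqb : q + b.coeff (d + 1) = 0 := by
      have := congr_arg (coeff · (2 * (d + 1))) hw1
      simp only [one_pow, one_mul, mul_one, coeff_add, coeff_zero, ← pow_mul'] at this
      rw [coeff_X_pow_mul', if_pos (by omega), coeff_X_pow_mul', if_pos (by omega),
        coeff_eq_zero_of_natDegree_lt (hrd.trans_lt (by omega)), Nat.sub_self,
        show 2 * (d + 1) - (d + 1) = d + 1 by omega] at this
      simpa using this.symm
    by_cases hq : q = 0
    · exact ⟨u, hu0, hq, hq'⟩
    set s := b + C q * X ^ (d + 1) with hs
    have hsd : s.natDegree ≤ d := by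
      rw [natDegree_le_iff_coeff_eq_zero]
      intro n hn
      simp only [hs, coeff_add, coeff_C_mul, coeff_X_pow]
      split_ifs with h
      · rw [h, mul_one, add_comm, hqb]
      · rw [coeff_eq_zero_of_natDegree_lt (hbd.trans_lt (by omega))]; ring
    have hQw := hQ (-s) (C q)
    rw [hq', C_0, mul_zero, add_zero] at hQw hw1
    have hzero : s ^ 2 * C q - s * C q * b + C q ^ 2 * r = 0 := by
      rw [hs]
      linear_combination -C q ^ 2 * hw1
    refine ih (w := (-s) • U + C q • w₀) ?_ ?_ ?_
    · intro h
      have hmul : C q • w = (s + C q * X ^ (d + 1)) • U := by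
        rw [hwU]
        have : C q • w₀ = s • U := by
          rw [neg_smul, neg_add_eq_zero] at h
          exact h.symm
        rw [smul_add, this, smul_smul, ← add_smul, add_comm s]
      have h1 : (s + C q * X ^ (d + 1)) ^ 2 * C q = 0 := by
        have h2 : matrixBilin (M.map C) (C q • w) (C q • w) +
            X * matrixBilin (N.map C) (C q • w) (C q • w) = 0 := by
          simp only [matrixBilin_smul_left, matrixBilin_smul_right]
          linear_combination C q ^ 2 * hw
        rw [hmul] at h2
        simp only [matrixBilin_smul_left, matrixBilin_smul_right, hU, hC] at h2
        change _ * (_ * C q) + _ * (_ * (_ * C q')) = 0 at h2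
        rw [hq'] at h2
        rw [C_0] at h2
        linear_combination h2
      have h3 : s + C q * X ^ (d + 1) = 0 := by
        simpa [hq] using h1
      have h4 := congr_arg (coeff · (d + 1)) h3
      simp only [coeff_add, coeff_C_mul, coeff_X_pow_self, mul_one, coeff_zero] at h4
      rw [coeff_eq_zero_of_natDegree_lt (hsd.trans_lt (by omega)), zero_add] at h4
      exact hq h4
    · intro i
      simp only [Pi.add_apply, Pi.smul_apply, smul_eq_mul]
      refine natDegree_add_le_of_degree_le ?_ ((natDegree_C_mul_le _ _).trans (hw₀d i))
      rw [neg_mul, natDegree_neg]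
      exact (natDegree_mul_le_of_le hsd (hUd i)).trans (by omega)
    · rw [hQw]
      linear_combination hzero

end QuadraticForms

section QuadraticForms

open Polynomial Matrix

variable {ι : Type*} [Fintype ι]

/-- A pencil of quadratic forms which is isotropic over an odd degree simple extension has
a common zero over the base field. -/
theorem exists_common_zero_of_irreducible {K : Type*} [Field K] (M N : Matrix ι ι K) {p : K[X]}
    (hp : Irreducible p) (hodd : Odd p.natDegree) {v : ι → K[X]} (hv : ∃ i, ¬ p ∣ v i)
    (hM : p ∣ matrixBilin (M.map C) v v) (hN : p ∣ matrixBilin (N.map C) v v) :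
    ∃ u, u ≠ 0 ∧ matrixBilin M u u = 0 ∧ matrixBilin N u u = 0 := by
  let f : K →+* RatFunc K := algebraMap K (RatFunc K)
  let t : RatFunc K := algebraMap K[X] (RatFunc K) X
  obtain ⟨p₁, hp₁, hp₁p, hp₁o⟩ := exists_irreducible_dvd_odd_natDegree (h := p.map f)
    (by rwa [natDegree_map])
  have hC : ∀ P : Matrix ι ι K, p ∣ matrixBilin (P.map C) v v →
      p₁ ∣ matrixBilin ((P.map f).map C) (mapRingHom f ∘ v) (mapRingHom f ∘ v) := fun P hP => by
    refine hp₁p.trans ?_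
    have := map_dvd (mapRingHom f) hP
    rw [map_matrixBilin, coe_mapRingHom] at this
    rw [coe_mapRingHom]
    convert this using 2
    ext1 i j
    simp
  obtain ⟨w, hw0, hw⟩ := exists_isotropic_of_odd_natDegree (M.map f + t • N.map f) hp₁ hp₁o
    (v := mapRingHom f ∘ v) (by
      obtain ⟨i, hi⟩ := hv
      refine ⟨i, fun h => hp₁.not_isUnit ?_⟩
      have hcop : IsCoprime p (v i) := (hp.coprime_iff_not_dvd).2 hi
      exact (hcop.map (mapRingHom f)).isUnit_of_dvd' hp₁p h) (by
      have : (M.map f + t • N.map f).map C = (M.map f).map C + C t • (N.map f).map C := by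
        ext1 i j
        simp
      rw [this]
      have hsplit : ∀ (P Q : Matrix ι ι (RatFunc K)[X]) (s : (RatFunc K)[X])
          (x : ι → (RatFunc K)[X]), matrixBilin (P + s • Q) x x =
            matrixBilin P x x + s * matrixBilin Q x x := fun P Q s x => by
        simp [matrixBilin, add_mulVec, smul_mulVec]
      rw [hsplit]
      exact dvd_add (hC M hM) ((hC N hN).mul_left _))
  obtain ⟨⟨s, hs⟩, hsw⟩ :=
    IsLocalization.exist_integer_multiples_of_finite (nonZeroDivisors K[X]) w
  choose W hW using hsw
  have hs0 : algebraMap K[X] (RatFunc K) s ≠ 0 := by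
    simpa using nonZeroDivisors.ne_zero hs
  have hWw : algebraMap K[X] (RatFunc K) ∘ W = algebraMap K[X] (RatFunc K) s • w := by
    ext1 i
    simp [hW, Algebra.smul_def]
  have hinj : Function.Injective (algebraMap K[X] (RatFunc K)) :=
    IsFractionRing.injective _ _
  have hW0 : W ≠ 0 := by
    rintro rfl
    refine hw0 ?_
    ext1 i
    have := congr_fun hWw i
    simpa [hs0] using this.symm
  refine exists_common_zero_of_pencil M N (Finset.univ.sup fun i => (W i).natDegree) hW0
    (fun i => Finset.le_sup (f := fun i => (W i).natDegree) (Finset.mem_univ i)) (hinj ?_)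
  have hmap : ∀ P : Matrix ι ι K, (P.map C).map (algebraMap K[X] (RatFunc K)) = P.map f := by
    intro P
    ext1 i j
    simp [f]
  rw [map_add, map_mul, map_matrixBilin, map_matrixBilin, hWw, hmap, hmap, map_zero,
    matrixBilin_smul_left, matrixBilin_smul_right, matrixBilin_smul_left, matrixBilin_smul_right]
  have hw' : matrixBilin (M.map f) w w + t * matrixBilin (N.map f) w w = 0 := by
    rw [← hw]
    simp [matrixBilin, add_mulVec, smul_mulVec]
  change _ + t * _ = 0
  linear_combination (algebraMap K[X] (RatFunc K) s) ^ 2 * hw'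

theorem exists_common_zero_of_odd_finrank {K L : Type*} [Field K] [Field L] [CharZero K]
    [Algebra K L] [FiniteDimensional K L] (hodd : Odd (Module.finrank K L)) (M N : Matrix ι ι K)
    {x : ι → L} (hx : x ≠ 0) (hM : matrixBilin (M.map (algebraMap K L)) x x = 0)
    (hN : matrixBilin (N.map (algebraMap K L)) x x = 0) :
    ∃ u, u ≠ 0 ∧ matrixBilin M u u = 0 ∧ matrixBilin N u u = 0 := by
  let pb := Field.powerBasisOfFiniteOfSeparable K L
  choose v hv using fun i => pb.exists_eq_aeval' (x i)
  have hdvd : ∀ P : Matrix ι ι K, matrixBilin (P.map (algebraMap K L)) x x = 0 →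
      minpoly K pb.gen ∣ matrixBilin (P.map C) v v := fun P hP => by
    refine minpoly.dvd _ _ ?_
    rw [← hP]
    have := map_matrixBilin (aeval pb.gen : K[X] →ₐ[K] L).toRingHom (P.map C) v v
    refine this.trans ?_
    congr 1
    · ext1 i j
      simp
    all_goals
      ext1 i
      exact (hv i).symm
  refine exists_common_zero_of_irreducible M N
    (minpoly.irreducible (Algebra.IsIntegral.isIntegral pb.gen))
    (by rwa [pb.natDegree_minpoly, ← pb.finrank]) ?_ (hdvd M hM) (hdvd N hN)
  by_contra! hall
  refine hx (funext fun i => ?_)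
  rw [hv i]
  exact aeval_eq_zero_of_dvd_aeval_eq_zero (hall i) (minpoly.aeval _ _)

/-- The first quadric defining the del Pezzo surface. -/
def firstQuadric {F : Type*} [Field F] (a b A B : F) : Matrix (Fin 5) (Fin 5) F :=
  !![1, 0, 0, 0, 0; 0, 0, 0, 0, 0; 0, 0, -a, 0, 0; 0, 0, 0, b, -(b * (A + B));
    0, 0, 0, 0, b * A * B]

/-- The second quadric defining the del Pezzo surface. -/
def secondQuadric {F : Type*} [Field F] (a C : F) : Matrix (Fin 5) (Fin 5) F :=
  !![1, 0, 0, 0, 0; 0, -a, 0, 0, 0; 0, 0, 0, 0, 0; 0, 0, 0, 0, a * C ^ 2; 0, 0, 0, 0, 0]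

theorem sPoint_iff {F : Type*} [Field F] (a b A B C : F) : SPoint a b A B C ↔
    ∃ w, w ≠ 0 ∧ matrixBilin (firstQuadric a b A B) w w = 0 ∧
      matrixBilin (secondQuadric a C) w w = 0 := by
  have key : ∀ w : Fin 5 → F,
      (matrixBilin (firstQuadric a b A B) w w =
        w 0 ^ 2 - a * w 2 ^ 2 + b * ((w 3 - A * w 4) * (w 3 - B * w 4))) ∧
      matrixBilin (secondQuadric a C) w w = w 0 ^ 2 - a * w 1 ^ 2 + a * C ^ 2 * (w 3 * w 4) := by
    intro w
    constructor <;>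
    · simp [matrixBilin_eq_sum, Fin.sum_univ_five, firstQuadric, secondQuadric]
      ring
  constructor
  · rintro ⟨x, y, z, u, v, h0, h1, h2⟩
    refine ⟨![x, y, z, u, v], fun h => h0 ?_, ?_, ?_⟩
    · exact ⟨congr_fun h 0, congr_fun h 1, congr_fun h 2, congr_fun h 3, congr_fun h 4⟩
    · rw [(key _).1]
      exact eq_neg_iff_add_eq_zero.1 h1
    · rw [(key _).2]
      exact eq_neg_iff_add_eq_zero.1 h2
  · rintro ⟨w, h0, h1, h2⟩
    rw [(key _).1] at h1
    rw [(key _).2] at h2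
    refine ⟨w 0, w 1, w 2, w 3, w 4, fun h => h0 ?_, eq_neg_iff_add_eq_zero.2 h1,
      eq_neg_iff_add_eq_zero.2 h2⟩
    ext i
    fin_cases i <;> simp [h]

theorem sPoint_of_odd_finrank {K L : Type*} [Field K] [Field L] [CharZero K]
    [Algebra K L] [FiniteDimensional K L] (hodd : Odd (Module.finrank K L)) {a b A B C : K}
    (h : SPoint (algebraMap K L a) (algebraMap K L b) (algebraMap K L A) (algebraMap K L B)
      (algebraMap K L C)) : SPoint a b A B C := by
  rw [sPoint_iff] at h ⊢
  obtain ⟨w, hw0, h1, h2⟩ := h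
  refine exists_common_zero_of_odd_finrank hodd _ _ hw0 ?_ ?_
  · rw [← h1]
    congr 1
    ext i j
    fin_cases i <;> fin_cases j <;> simp [firstQuadric]
  · rw [← h2]
    congr 1
    ext i j
    fin_cases i <;> fin_cases j <;> simp [secondQuadric]

theorem sNoZeroCycleDegOne_of_not_sPoint {K : Type u} [Field K] [CharZero K] {a b A B C : K}
    (h : ¬ SPoint a b A B C) : SNoZeroCycleDegOne K a b A B C := by
  intro r _ L _ _ _ n hL hsum
  have heven : ∀ i, Even (Module.finrank K (L i)) := fun i =>
    Nat.not_odd_iff_even.1 fun hodd => h (sPoint_of_odd_finrank hodd (hL i))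
  have : Even (∑ i, n i * (Module.finrank K (L i) : ℤ)) :=
    Finset.even_sum _ fun i _ => (Int.even_coe_nat _ |>.2 (heven i)).mul_left _
  rw [hsum] at this
  exact absurd this (by decide)

end QuadraticForms

/-- Theorem 5.1(2) for the del Pezzo surfaces: if `g` is odd then for every
`θ ∈ K ∪ {∞}` the surface `S_θ` has no `K`-rational point and no zero-cycle of
degree 1. -/
theorem stmt16 (K : Type u) [Field K] [NumberField K] (h g : ℕ) (hg1 : 1 ≤ g)
    (hgodd : Odd g) (a b c d : 𝓞 K)
    (va vb vc vd : HeightOneSpectrum (𝓞 K)) (hP : Params K g a b c d va vb vc vd) :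
    (∀ θ : K,
      ¬ SPoint (algebraMap (𝓞 K) K a) (algebraMap (𝓞 K) K b)
          (Aval (algebraMap (𝓞 K) K a) (algebraMap (𝓞 K) K b) (algebraMap (𝓞 K) K c)
            (algebraMap (𝓞 K) K d) h g θ)
          (Bval (algebraMap (𝓞 K) K a) (algebraMap (𝓞 K) K b) (algebraMap (𝓞 K) K c)
            (algebraMap (𝓞 K) K d) h g θ)
          (Cval (algebraMap (𝓞 K) K a) h g θ) ∧
      SNoZeroCycleDegOne K (algebraMap (𝓞 K) K a) (algebraMap (𝓞 K) K b)
          (Aval (algebraMap (𝓞 K) K a) (algebraMap (𝓞 K) K b) (algebraMap (𝓞 K) K c)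
            (algebraMap (𝓞 K) K d) h g θ)
          (Bval (algebraMap (𝓞 K) K a) (algebraMap (𝓞 K) K b) (algebraMap (𝓞 K) K c)
            (algebraMap (𝓞 K) K d) h g θ)
          (Cval (algebraMap (𝓞 K) K a) h g θ)) ∧
    (¬ SPoint (algebraMap (𝓞 K) K a) (algebraMap (𝓞 K) K b)
        (Ainf (algebraMap (𝓞 K) K a) (algebraMap (𝓞 K) K b) (algebraMap (𝓞 K) K c)
          (algebraMap (𝓞 K) K d) h)
        (Binf (algebraMap (𝓞 K) K a) (algebraMap (𝓞 K) K b) (algebraMap (𝓞 K) K c)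
          (algebraMap (𝓞 K) K d) h)
        (Cinf (algebraMap (𝓞 K) K a) h) ∧
      SNoZeroCycleDegOne K (algebraMap (𝓞 K) K a) (algebraMap (𝓞 K) K b)
        (Ainf (algebraMap (𝓞 K) K a) (algebraMap (𝓞 K) K b) (algebraMap (𝓞 K) K c)
          (algebraMap (𝓞 K) K d) h)
        (Binf (algebraMap (𝓞 K) K a) (algebraMap (𝓞 K) K b) (algebraMap (𝓞 K) K c)
          (algebraMap (𝓞 K) K d) h)
        (Cinf (algebraMap (𝓞 K) K a) h)) := by
  obtain ⟨k, hk⟩ : ∃ k, g + 1 = 2 * k := by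
    obtain ⟨m, rfl⟩ := hgodd
    exact ⟨m + 1, by ring⟩
  have hk' : 2 * g + 2 = 4 * k := by omega
  have ha : algebraMap (𝓞 K) K a ≠ 0 := fun h => va.ne_bot (by
    rw [hP.span_a, (FaithfulSMul.algebraMap_eq_zero_iff _ _).1 h, Ideal.span_singleton_eq_bot])
  have hβ : b ^ (2 * h + 1) ∉ va.asIdeal := fun hb => hP.distinct.1
    (HeightOneSpectrum.eq_of_mem_of_span hP.span_b (va.isPrime.mem_of_pow_mem _ hb))
  refine ⟨fun θ => ?_, ?_⟩
  · have key := hP.not_sPoint hβ (σ := algebraMap (𝓞 K) K a ^ h * θ ^ k) (τ := 1)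
      (Or.inr one_ne_zero)
    have hkey : ¬ SPoint (algebraMap (𝓞 K) K a) (algebraMap (𝓞 K) K b)
          (Aval (algebraMap (𝓞 K) K a) (algebraMap (𝓞 K) K b) (algebraMap (𝓞 K) K c)
            (algebraMap (𝓞 K) K d) h g θ)
          (Bval (algebraMap (𝓞 K) K a) (algebraMap (𝓞 K) K b) (algebraMap (𝓞 K) K c)
            (algebraMap (𝓞 K) K d) h g θ)
          (Cval (algebraMap (𝓞 K) K a) h g θ) := by
      convert key using 2 <;>
      · simp only [Aval, Bval, Cval, Dval, quarticForm, map_pow, hk, hk']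
        ring
    exact ⟨hkey, sNoZeroCycleDegOne_of_not_sPoint hkey⟩
  · have key := hP.not_sPoint hβ (σ := algebraMap (𝓞 K) K a ^ h) (τ := 0)
      (Or.inl (pow_ne_zero _ ha))
    have hkey : ¬ SPoint (algebraMap (𝓞 K) K a) (algebraMap (𝓞 K) K b)
        (Ainf (algebraMap (𝓞 K) K a) (algebraMap (𝓞 K) K b) (algebraMap (𝓞 K) K c)
          (algebraMap (𝓞 K) K d) h)
        (Binf (algebraMap (𝓞 K) K a) (algebraMap (𝓞 K) K b) (algebraMap (𝓞 K) K c)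
          (algebraMap (𝓞 K) K d) h)
        (Cinf (algebraMap (𝓞 K) K a) h) := by
      convert key using 2 <;>
      · simp only [Ainf, Binf, Cinf, Dinf, quarticForm, map_pow]
        ring
    exact ⟨hkey, sNoZeroCycleDegOne_of_not_sPoint hkey⟩
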